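/- Let n ≥ 2, p ≥ 1, λ ∈ (1, ∞) with λ' = λ/(λ−1), and ε ∈ [0, 1/2]. For each nonzero nonnegative continuous function f : ℝⁿ → ℝ with compact support there exists a point c ∈ ℝⁿ such that for every nonzero nonnegative continuous function g : ℝⁿ → ℝ with compact support, ‖f‖₁^{n+λ'p} ‖g‖₁^{n+λ'p} ≤ d_{n,p,λ} ‖f‖_λ^{λ'p} ‖g‖_λ^{λ'p} ( ∫_{ℝⁿ} ∫_{ℝⁿ} f(x − c) g(y) ⟨x,y⟩_ε^p dx dy )^{n}. -/

import Mathlib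

open MeasureTheory Real
open scoped RealInnerProductSpace

/-- The constant `R_{n,p}` from the Haberl–Schuster asymmetric `L_p` Blaschke–Santaló
inequality: the value of the sharp bound, attained for the Euclidean ball. -/
noncomputable def Rnp (n : ℕ) (p : ℝ) : ℝ :=
  Real.pi ^ ((n : ℝ) / (2 * p) + n) / (Real.Gamma (((n : ℝ) + 2) / 2)) ^ (2 : ℕ) *
    (2 * Real.Gamma (((n : ℝ) + p + 2) / 2) /
      (Real.Gamma (((n : ℝ) + 2) / 2) * Real.Gamma ((p + 1) / 2))) ^ ((n : ℝ) / p)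

/-- The constant `a_{n,p,λ}` for `λ > 1`, with `λ' = λ/(λ-1)`; here
`B(m,l) = Γ(m)Γ(l)/Γ(m+l)` is the Beta function. -/
noncomputable def anpl (n : ℕ) (p lam : ℝ) : ℝ :=
  (((n : ℝ) / p) * ((n : ℝ) / ((lam / (lam - 1)) * p) + 1) ^ (lam / (lam - 1) - 1) *
      ((lam / (lam - 1)) * p / (n : ℝ) + 1) ^ ((n : ℝ) / p) *
      (Real.Gamma ((n : ℝ) / p) * Real.Gamma (lam / (lam - 1)) /
        Real.Gamma ((n : ℝ) / p + lam / (lam - 1)))) ^ p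

/-- The constant `b_{n,p,λ} = (n/(n+p))^n a_{n,p,λ} R_{n,p}^p n^p` for `λ > 1`. -/
noncomputable def bnpl (n : ℕ) (p lam : ℝ) : ℝ :=
  ((n : ℝ) / ((n : ℝ) + p)) ^ (n : ℝ) * anpl n p lam * Rnp n p ^ p * (n : ℝ) ^ p

/-- The asymmetric bracket `⟨x,y⟩_ε^p` applied to a real number `s = ⟨x,y⟩`:
`(1-ε) (max{s,0})^p + ε (max{-s,0})^p`. -/
noncomputable def epsPow (eps p s : ℝ) : ℝ :=
  (1 - eps) * (max s 0) ^ p + eps * (max (-s) 0) ^ p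

/-- The constant `d_{n,p,λ} = a_{n,p,λ} b_{n,p,λ} n^{-p}` for `λ > 1`. -/
noncomputable def dnpl (n : ℕ) (p lam : ℝ) : ℝ :=
  anpl n p lam * bnpl n p lam * (n : ℝ) ^ (-p)

open scoped ENNReal NNReal Pointwise

/-- Volume-preserving coordinates on Euclidean space adapted to lines in a unit direction. -/
theorem exists_line_coordinates {m : ℕ} (e : EuclideanSpace ℝ (Fin (m + 1))) (he : ‖e‖ = 1) :
    ∃ L : (Fin m → ℝ) →L[ℝ] EuclideanSpace ℝ (Fin (m + 1)), (∀ v, ⟪L v, e⟫ = 0) ∧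
      MeasurePreserving (fun q : ℝ × (Fin m → ℝ) => q.1 • e + L q.2) := by
  classical
  obtain ⟨b, hb⟩ := Orthonormal.exists_orthonormalBasis_extension_of_card_eq (𝕜 := ℝ)
    (E := EuclideanSpace ℝ (Fin (m + 1))) (ι := Fin (m + 1)) (by simp)
    (v := fun _ => e) (s := {0}) (by
      rw [orthonormal_iff_ite]
      rintro ⟨i, hi⟩ ⟨j, hj⟩
      simp only [Set.mem_singleton_iff] at hi hj
      subst hi; subst hj
      simp [he])
  have hb0 : b 0 = e := hb 0 rfl
  refine ⟨∑ i : Fin m, (ContinuousLinearMap.proj (R := ℝ) (φ := fun _ : Fin m => ℝ) i).smulRight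
    (b i.succ), ?_, ?_⟩
  · intro v
    rw [← hb0]
    simp [sum_inner, inner_smul_left, b.inner_eq_zero (Fin.succ_ne_zero _)]
  · have h1 := (volume_preserving_piFinSuccAbove (fun _ : Fin (m + 1) => ℝ) 0).symm
    have h2 := PiLp.volume_preserving_toLp (Fin (m + 1))
    have h3 := b.measurePreserving_repr_symm
    have h4 := h3.comp (h2.comp h1)
    have h5 : (fun q : ℝ × (Fin m → ℝ) => q.1 • e + (∑ i : Fin m,
        (ContinuousLinearMap.proj (R := ℝ) (φ := fun _ : Fin m => ℝ) i).smulRight (b i.succ)) q.2)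
        = fun q => b.repr.symm
          (WithLp.toLp 2 ((MeasurableEquiv.piFinSuccAbove (fun _ => ℝ) 0).symm q)) := by
      funext q
      rw [← b.sum_repr_symm, Fin.sum_univ_succ]
      simp [hb0, MeasurableEquiv.piFinSuccAbove]
    rw [h5]
    exact h4

/-- The one-dimensional Brunn–Minkowski inequality for midpoints. -/
theorem volume_add_le_of_midpoint_mem {A B C : Set ℝ} (hA : MeasurableSet A)
    (hB : MeasurableSet B) (hA0 : A.Nonempty) (hB0 : B.Nonempty)
    (h : ∀ a ∈ A, ∀ b ∈ B, (a + b) / 2 ∈ C) : volume A + volume B ≤ 2 * volume C := by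
  have hC : volume {x : ℝ | x / 2 ∈ C} = 2 * volume C := by
    have := Measure.addHaar_preimage_smul (volume : Measure ℝ) (r := (1 / 2 : ℝ)) (by norm_num) C
    simp only [Module.finrank_self] at this
    convert this using 2
    · ext x; simp [div_eq_inv_mul]
    · norm_num
  have key : ∀ K₁ ⊆ A, IsCompact K₁ → K₁.Nonempty → ∀ K₂ ⊆ B, IsCompact K₂ → K₂.Nonempty →
      volume K₁ + volume K₂ ≤ 2 * volume C := by
    intro K₁ h₁ c₁ n₁ K₂ h₂ c₂ n₂
    set a := sSup K₁
    set b := sInf K₂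
    have ha : a ∈ K₁ := c₁.sSup_mem n₁
    have hb : b ∈ K₂ := c₂.sInf_mem n₂
    have e1 : volume ((fun x => x - b) ⁻¹' K₁) = volume K₁ := by simp [sub_eq_add_neg]
    have e2 : volume ((fun x => x - a) ⁻¹' K₂) = volume K₂ := by simp [sub_eq_add_neg]
    have hd : AEDisjoint volume ((fun x => x - b) ⁻¹' K₁) ((fun x => x - a) ⁻¹' K₂) := by
      refine measure_mono_null (t := {a + b}) ?_ (by simp)
      rintro x ⟨hx1, hx2⟩
      have i1 := le_csSup c₁.bddAbove hx1
      have i2 := csInf_le c₂.bddBelow hx2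
      simp only [Set.mem_singleton_iff]
      apply le_antisymm <;> grind
    rw [← e1, ← e2, ← measure_union₀ ?_ hd, ← hC]
    · refine measure_mono ?_
      rintro x (hx | hx)
      · have := h _ (h₁ hx) _ (h₂ hb)
        simpa using this
      · have := h _ (h₁ ha) _ (h₂ hx)
        simpa using this
    · exact (c₂.measurableSet.preimage (by fun_prop)).nullMeasurableSet
  obtain ⟨a₀, ha₀⟩ := hA0
  obtain ⟨b₀, hb₀⟩ := hB0
  rw [hA.measure_eq_iSup_isCompact, hB.measure_eq_iSup_isCompact]
  simp only [iSup_and', iSup_subtype']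
  have : Nonempty {i : Set ℝ // i ⊆ A ∧ IsCompact i} :=
    ⟨⟨∅, Set.empty_subset _, isCompact_empty⟩⟩
  have : Nonempty {i : Set ℝ // i ⊆ B ∧ IsCompact i} :=
    ⟨⟨∅, Set.empty_subset _, isCompact_empty⟩⟩
  refine ENNReal.iSup_add_iSup_le ?_
  rintro ⟨K₁, h₁, c₁⟩ ⟨K₂, h₂, c₂⟩
  refine le_trans (add_le_add (measure_mono (Set.subset_insert a₀ K₁))
    (measure_mono (Set.subset_insert b₀ K₂))) ?_
  exact key _ (Set.insert_subset ha₀ h₁) (c₁.insert _) (Set.insert_nonempty _ _)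
    _ (Set.insert_subset hb₀ h₂) (c₂.insert _) (Set.insert_nonempty _ _)

theorem lintegral_rpow_neg_eq {q : ℝ} (hq : 0 < q) (u : ℝ → ℝ≥0∞) (hu : Measurable u) :
    ∫⁻ s, u s ^ (-q) =
      ∫⁻ r in Set.Ioi (0 : ℝ), volume {s | u s < ENNReal.ofReal r} *
        ENNReal.ofReal (q * r ^ (-q - 1)) := by
  have h1 : ∀ s, u s ^ (-q) = ∫⁻ r in Set.Ioi (0 : ℝ),
      Set.indicator {s | u s < ENNReal.ofReal r} (fun _ => ENNReal.ofReal (q * r ^ (-q - 1))) s := by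
    intro s
    rcases eq_or_ne (u s) ⊤ with h | h
    · simp [h, hq]
    · lift u s to ℝ≥0 using h with t ht
      have e : ∀ r ∈ Set.Ioi (0 : ℝ), Set.indicator {s | u s < ENNReal.ofReal r}
          (fun _ => ENNReal.ofReal (q * r ^ (-q - 1))) s =
          Set.indicator (Set.Ioi (t : ℝ)) (fun r => ENNReal.ofReal (q * r ^ (-q - 1))) r := by
        intro r hr
        simp only [Set.indicator, Set.mem_ofPred_eq, ← ht, Set.mem_Ioi]
        congr 1
        rw [← ENNReal.ofReal_coe_nnreal, ENNReal.ofReal_lt_ofReal_iff hr]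
      rw [setLIntegral_congr_fun measurableSet_Ioi e, lintegral_indicator measurableSet_Ioi,
        Measure.restrict_restrict measurableSet_Ioi]
      have : Set.Ioi (t : ℝ) ∩ Set.Ioi 0 = Set.Ioi (t : ℝ) := by
        ext x; simp only [Set.mem_inter_iff, Set.mem_Ioi, and_iff_left_iff_imp]
        intro hx; exact lt_of_le_of_lt t.2 hx
      rw [this]
      rcases eq_or_ne t 0 with h0 | h0
      · subst h0
        rw [ENNReal.coe_zero, ENNReal.zero_rpow_of_neg (by linarith)]
        symm
        by_contra hne
        have h_int : IntegrableOn (fun r : ℝ => r ^ (-q - 1)) (Set.Ioi 0) := by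
          have : IntegrableOn (fun r : ℝ => q * r ^ (-q - 1)) (Set.Ioi 0) := by
            refine ⟨by fun_prop, ?_⟩
            rw [hasFiniteIntegral_iff_ofReal]
            · exact lt_top_iff_ne_top.2 (by simpa using hne)
            · filter_upwards [ae_restrict_mem measurableSet_Ioi] with r hr
              have : 0 < r := hr
              positivity
          simpa [← mul_assoc, hq.ne', IntegrableOn] using this.const_mul q⁻¹
        exact not_integrableOn_Ioi_rpow _ h_int
      · have ht0 : (0 : ℝ) < t := by positivity
        rw [← ofReal_integral_eq_lintegral_ofReal]
        · rw [integral_const_mul, integral_Ioi_rpow_of_lt (by linarith) ht0]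
          have : q * (-(t : ℝ) ^ (-q - 1 + 1) / (-q - 1 + 1)) = (t : ℝ) ^ (-q) := by
            rw [sub_add_cancel]; field_simp
          rw [this, ← NNReal.coe_rpow, ENNReal.ofReal_coe_nnreal, ENNReal.coe_rpow_of_ne_zero h0]
        · exact (integrableOn_Ioi_rpow_of_lt (by linarith) ht0).const_mul _
        · filter_upwards [ae_restrict_mem measurableSet_Ioi] with r hr
          have : 0 < r := lt_trans ht0 hr
          positivity
  simp_rw [h1]
  rw [lintegral_lintegral_swap]
  · refine lintegral_congr fun r => ?_
    rw [lintegral_indicator (measurableSet_lt hu measurable_const), setLIntegral_const, mul_comm]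
  · have : Measurable (fun z : ℝ × ℝ => Set.indicator {z : ℝ × ℝ | u z.1 < ENNReal.ofReal z.2}
        (fun z => ENNReal.ofReal (q * z.2 ^ (-q - 1))) z) := by
      refine Measurable.indicator (by fun_prop) (measurableSet_lt (by fun_prop) (by fun_prop))
    exact this.aemeasurable

theorem lintegral_rpow_neg_add_le {q : ℝ} (hq : 0 < q) {u v w : ℝ → ℝ≥0∞} (hu : Measurable u)
    (hv : Measurable v) (hw : Measurable w) (hu1 : ⨅ s, u s = 1) (hv1 : ⨅ s, v s = 1)
    (h : ∀ r, ∀ s t, u s < r → v t < r → w ((s + t) / 2) < r) :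
    (∫⁻ s, u s ^ (-q)) + (∫⁻ s, v s ^ (-q)) ≤ 2 * ∫⁻ s, w s ^ (-q) := by
  rw [lintegral_rpow_neg_eq hq u hu, lintegral_rpow_neg_eq hq v hv, lintegral_rpow_neg_eq hq w hw,
    ← lintegral_const_mul' _ _ (by simp), ← lintegral_add_left']
  · refine setLIntegral_mono' measurableSet_Ioi fun r hr => ?_
    rw [← add_mul, ← mul_assoc]
    refine mul_le_mul_left ?_ _
    rcases le_or_gt (ENNReal.ofReal r) 1 with hr1 | hr1
    · have e1 : {s | u s < ENNReal.ofReal r} = ∅ := by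
        ext s
        simpa using hr1.trans (hu1 ▸ iInf_le u s)
      have e2 : {s | v s < ENNReal.ofReal r} = ∅ := by
        ext s
        simpa using hr1.trans (hv1 ▸ iInf_le v s)
      simp [e1, e2]
    · refine volume_add_le_of_midpoint_mem (measurableSet_lt hu measurable_const)
        (measurableSet_lt hv measurable_const) ?_ ?_ fun a ha b hb => h _ _ _ ha hb
      · exact iInf_lt_iff.1 (hu1.trans_lt hr1)
      · exact iInf_lt_iff.1 (hv1.trans_lt hr1)
  · have : Measurable fun r : ℝ => volume {s | u s < ENNReal.ofReal r} := by
      refine Monotone.measurable fun a b hab => measure_mono fun s hs => ?_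
      exact lt_of_lt_of_le hs (ENNReal.ofReal_le_ofReal hab)
    exact (this.mul (by fun_prop)).aemeasurable

theorem add_rpow_div_le {q a b c d : ℝ} (hq : 1 ≤ q) (ha : 0 < a) (hb : 0 < b) (hc : 0 < c)
    (hd : 0 < d) :
    (a + b) ^ q * (c + d) ^ (1 - q) ≤ a ^ q * c ^ (1 - q) + b ^ q * d ^ (1 - q) := by
  have h := (convexOn_rpow hq).2 (show a / c ∈ Set.Ici 0 from Set.mem_Ici.2 (by positivity))
    (show b / d ∈ Set.Ici 0 from Set.mem_Ici.2 (by positivity)) (show 0 ≤ c / (c + d) by positivity)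
    (show 0 ≤ d / (c + d) by positivity) (by field_simp)
  have e : c / (c + d) * (a / c) + d / (c + d) * (b / d) = (a + b) / (c + d) := by
    field_simp
  simp only [smul_eq_mul] at h
  rw [e, div_rpow (by positivity) (by positivity), div_rpow ha.le hc.le, div_rpow hb.le hd.le] at h
  rw [rpow_sub (by positivity), rpow_sub hc, rpow_sub hd, rpow_one, rpow_one, rpow_one]
  have := mul_le_mul_of_nonneg_left h (show 0 ≤ c + d by positivity)
  calc _ = (c + d) * ((a + b) ^ q / (c + d) ^ q) := by ring
    _ ≤ _ := this
    _ = _ := by field_simp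

theorem rpow_neg_le_of_add_le {q : ℝ} (hq : 1 < q) {a b I J K : ℝ≥0∞} (ha0 : a ≠ 0) (ha : a ≠ ⊤)
    (hb0 : b ≠ 0) (hb : b ≠ ⊤)
    (h : a ^ q * I + b ^ q * J ≤ 2 * (((a + b) / 2) ^ q * K)) :
    K ^ (-(1 / (q - 1))) ≤ (I ^ (-(1 / (q - 1))) + J ^ (-(1 / (q - 1)))) / 2 := by
  have hq1 : 0 < q - 1 := by linarith
  have hneg : -(1 / (q - 1)) < 0 := by simp [hq]
  rcases eq_or_ne I 0 with hI | hI
  · rw [hI, ENNReal.zero_rpow_of_neg hneg]; simp [ENNReal.top_div]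
  rcases eq_or_ne J 0 with hJ | hJ
  · rw [hJ, ENNReal.zero_rpow_of_neg hneg]; simp [ENNReal.top_div]
  rcases eq_or_ne K ⊤ with hK | hK
  · rw [hK, ENNReal.top_rpow_of_neg hneg]; exact zero_le
  have hab0 : (a + b) / 2 ≠ 0 := by simp [ha0]
  have habt : (a + b) / 2 ≠ ⊤ := ENNReal.div_ne_top (by simp [ha, hb]) (by simp)
  have hR : 2 * (((a + b) / 2) ^ q * K) ≠ ⊤ := ENNReal.mul_ne_top (by simp)
    (ENNReal.mul_ne_top (ENNReal.rpow_ne_top_of_nonneg (by linarith) habt) hK)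
  have hIt : I ≠ ⊤ := by
    rintro rfl
    rw [ENNReal.mul_top (by simp [ha0, ha])] at h
    exact hR (top_le_iff.1 (le_trans le_self_add h))
  have hJt : J ≠ ⊤ := by
    rintro rfl
    rw [ENNReal.mul_top (by simp [hb0, hb])] at h
    exact hR (top_le_iff.1 (le_trans le_add_self h))
  have hK0 : K ≠ 0 := by
    rintro rfl
    simp [ha0, ha, hI] at h
  have real : ∀ x : ℝ≥0∞, x ≠ 0 → x ≠ ⊤ → ∃ y : ℝ, 0 < y ∧ x = ENNReal.ofReal y := fun x h0 h1 =>
    ⟨x.toReal, ENNReal.toReal_pos h0 h1, (ENNReal.ofReal_toReal h1).symm⟩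
  obtain ⟨a, pa, rfl⟩ := real a ha0 ha
  obtain ⟨b, pb, rfl⟩ := real b hb0 hb
  obtain ⟨I, pI, rfl⟩ := real I hI hIt
  obtain ⟨J, pJ, rfl⟩ := real J hJ hJt
  obtain ⟨K, pK, rfl⟩ := real K hK0 hK
  have two : (2 : ℝ≥0∞) = ENNReal.ofReal 2 := by simp
  rw [two, ← ENNReal.ofReal_add pa.le pb.le, ← ENNReal.ofReal_div_of_pos (by norm_num),
    ENNReal.ofReal_rpow_of_pos pa, ENNReal.ofReal_rpow_of_pos pb,
    ENNReal.ofReal_rpow_of_pos (by positivity), ← ENNReal.ofReal_mul (by positivity),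
    ← ENNReal.ofReal_mul (by positivity), ← ENNReal.ofReal_mul (by positivity),
    ← ENNReal.ofReal_mul (by positivity), ← ENNReal.ofReal_add (by positivity) (by positivity),
    ENNReal.ofReal_le_ofReal_iff (by positivity)] at h
  rw [two, ENNReal.ofReal_rpow_of_pos pI, ENNReal.ofReal_rpow_of_pos pJ,
    ENNReal.ofReal_rpow_of_pos pK, ← ENNReal.ofReal_add (by positivity) (by positivity),
    ← ENNReal.ofReal_div_of_pos (by norm_num), ENNReal.ofReal_le_ofReal_iff (by positivity)]
  have inv : ∀ x : ℝ, 0 < x → (x ^ (-(1 / (q - 1)))) ^ (1 - q) = x := by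
    intro x hx
    rw [← rpow_mul hx.le]
    convert rpow_one x using 2
    field_simp
    ring
  have inv' : ∀ x : ℝ, 0 < x → (x ^ (1 - q)) ^ (-(1 / (q - 1))) = x := by
    intro x hx
    rw [← rpow_mul hx.le]
    convert rpow_one x using 2
    field_simp
    ring
  set c := I ^ (-(1 / (q - 1))) with hc
  set d := J ^ (-(1 / (q - 1))) with hd
  have pc : 0 < c := by positivity
  have pd : 0 < d := by positivity
  have k := add_rpow_div_le hq.le pa pb pc pd
  rw [hc, hd, inv I pI, inv J pJ, ← hc, ← hd] at k
  have k2 := k.trans h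
  have k3 : ((c + d) / 2) ^ (1 - q) ≤ K := by
    rw [div_rpow (by positivity) (by norm_num), div_le_iff₀ (by positivity),
      rpow_sub (show (0 : ℝ) < 2 by norm_num)]
    rw [div_rpow (by positivity) (by norm_num)] at k2
    have : 0 < (a + b) ^ q := by positivity
    refine le_of_mul_le_mul_left ?_ this
    refine k2.trans_eq ?_
    rw [rpow_one]
    ring
  rw [← inv' ((c + d) / 2) (by positivity)]
  exact rpow_le_rpow_of_nonpos (by positivity) k3 hneg.le

theorem lintegral_rpow_midpoint_le_of_iInf_ne_zero {q : ℝ} (hq : 1 < q) {u v w : ℝ → ℝ≥0∞}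
    (hu : Measurable u) (hv : Measurable v) (hw : Measurable w) (hu0 : ⨅ s, u s ≠ 0)
    (hv0 : ⨅ s, v s ≠ 0) (h : ∀ s t, w ((s + t) / 2) ≤ (u s + v t) / 2) :
    (∫⁻ s, w s ^ (-q)) ^ (-(1 / (q - 1))) ≤
      ((∫⁻ s, u s ^ (-q)) ^ (-(1 / (q - 1))) + (∫⁻ s, v s ^ (-q)) ^ (-(1 / (q - 1)))) / 2 := by
  have hneg : -(1 / (q - 1)) < 0 := by simp [hq]
  have hq0 : 0 < q := by linarith
  have top : ∀ u : ℝ → ℝ≥0∞, ⨅ s, u s = ⊤ → (∫⁻ s, u s ^ (-q)) ^ (-(1 / (q - 1))) = ⊤ := by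
    intro u hu
    rw [iInf_eq_top] at hu
    simp only [hu, ENNReal.top_rpow_of_neg (neg_neg_of_pos hq0), lintegral_zero,
      ENNReal.zero_rpow_of_neg hneg]
  rcases eq_or_ne (⨅ s, u s) ⊤ with hut | hut
  · rw [top u hut]; simp [ENNReal.top_div]
  rcases eq_or_ne (⨅ s, v s) ⊤ with hvt | hvt
  · rw [top v hvt]; simp [ENNReal.top_div]
  have scale : ∀ (u : ℝ → ℝ≥0∞) (a : ℝ≥0∞), Measurable u → a ≠ 0 → a ≠ ⊤ →
      ∫⁻ s, (u s / a) ^ (-q) = a ^ q * ∫⁻ s, u s ^ (-q) := by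
    intro u a hu h0 ht
    rw [← lintegral_const_mul _ (by fun_prop)]
    refine lintegral_congr fun s => ?_
    rw [ENNReal.rpow_neg, ENNReal.rpow_neg, ENNReal.div_rpow_of_nonneg _ _ hq0.le,
      ENNReal.inv_div (Or.inl (ENNReal.rpow_ne_top_of_nonneg hq0.le ht))
        (Or.inl (by simp [h0, ht])), div_eq_mul_inv]
  set a := ⨅ s, u s with ha
  set b := ⨅ s, v s with hb
  have hab0 : (a + b) / 2 ≠ 0 := by simp [hu0]
  have habt : (a + b) / 2 ≠ ⊤ := ENNReal.div_ne_top (by simp [hut, hvt]) (by simp)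
  have main := lintegral_rpow_neg_add_le hq0 (u := fun s => u s / a) (v := fun s => v s / b)
    (w := fun s => w s / ((a + b) / 2)) (by fun_prop) (by fun_prop) (by fun_prop)
    (by rw [← ENNReal.iInf_div_of_ne hu0 hut]; exact ENNReal.div_self hu0 hut)
    (by rw [← ENNReal.iInf_div_of_ne hv0 hvt]; exact ENNReal.div_self hv0 hvt)
    (by
      intro r s t hs ht
      rw [ENNReal.div_lt_iff (Or.inl hu0) (Or.inl hut)] at hs
      rw [ENNReal.div_lt_iff (Or.inl hv0) (Or.inl hvt)] at ht
      rw [ENNReal.div_lt_iff (Or.inl hab0) (Or.inl habt)]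
      refine (h s t).trans_lt ?_
      rw [← mul_div_assoc, mul_add]
      exact ENNReal.div_lt_div_right (by simp) (by simp) (ENNReal.add_lt_add hs ht))
  rw [scale u a hu hu0 hut, scale v b hv hv0 hvt, scale w _ hw hab0 habt] at main
  exact rpow_neg_le_of_add_le hq hu0 hut hv0 hvt main

theorem lintegral_rpow_midpoint_le {q : ℝ} (hq : 1 < q) {u v w : ℝ → ℝ≥0∞} (hu : Measurable u)
    (hv : Measurable v) (hw : Measurable w) (h : ∀ s t, w ((s + t) / 2) ≤ (u s + v t) / 2) :
    (∫⁻ s, w s ^ (-q)) ^ (-(1 / (q - 1))) ≤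
      ((∫⁻ s, u s ^ (-q)) ^ (-(1 / (q - 1))) + (∫⁻ s, v s ^ (-q)) ^ (-(1 / (q - 1)))) / 2 := by
  have key : ∀ δ : ℝ≥0∞, δ ≠ 0 → δ ≠ ⊤ → (∫⁻ s, (w s ⊔ δ) ^ (-q)) ^ (-(1 / (q - 1))) ≤
      ((∫⁻ s, (u s ⊔ δ) ^ (-q)) ^ (-(1 / (q - 1))) +
        (∫⁻ s, (v s ⊔ δ) ^ (-q)) ^ (-(1 / (q - 1)))) / 2 := by
    intro δ hδ0 hδt
    have hδ : ∀ s t, w ((s + t) / 2) ⊔ δ ≤ (u s ⊔ δ + v t ⊔ δ) / 2 := by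
      intro s t
      refine sup_le ((h s t).trans ?_) ?_
      · gcongr <;> exact le_sup_left
      · calc δ = (δ + δ) / 2 := by
              rw [← two_mul, mul_comm, ENNReal.mul_div_cancel_right] <;> simp
          _ ≤ _ := by gcongr <;> exact le_sup_right
    have mu : Measurable fun s => u s ⊔ δ := hu.sup_const δ
    have mv : Measurable fun s => v s ⊔ δ := hv.sup_const δ
    have mw : Measurable fun s => w s ⊔ δ := hw.sup_const δ
    have du : δ ≤ ⨅ s, u s ⊔ δ := le_iInf fun _ => le_sup_right
    have dv : δ ≤ ⨅ s, v s ⊔ δ := le_iInf fun _ => le_sup_right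
    refine lintegral_rpow_midpoint_le_of_iInf_ne_zero hq mu mv mw ?_ ?_ hδ
    · exact (pos_of_ne_zero hδ0 |>.trans_le du).ne'
    · exact (pos_of_ne_zero hδ0 |>.trans_le dv).ne'
  have lim : ∀ u : ℝ → ℝ≥0∞, Measurable u → Filter.Tendsto (fun k : ℕ =>
      (∫⁻ s, (u s ⊔ ((k : ℝ≥0∞) + 1)⁻¹) ^ (-q)) ^ (-(1 / (q - 1)))) Filter.atTop
      (nhds ((∫⁻ s, u s ^ (-q)) ^ (-(1 / (q - 1))))) := by
    intro u hu
    refine (ENNReal.continuous_rpow_const.tendsto _).comp ?_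
    refine lintegral_tendsto_of_tendsto_of_monotone (fun k => by fun_prop) ?_ ?_
    · refine Filter.Eventually.of_forall fun s k l hkl => ?_
      simp only [ENNReal.rpow_neg]
      gcongr
    · refine Filter.Eventually.of_forall fun s => ?_
      refine (ENNReal.continuous_rpow_const.tendsto _).comp ?_
      have : Filter.Tendsto (fun k : ℕ => ((k : ℝ≥0∞) + 1)⁻¹) Filter.atTop (nhds 0) := by
        have := (Filter.tendsto_add_atTop_iff_nat 1).2 ENNReal.tendsto_inv_nat_nhds_zero
        simpa using this
      simpa using Filter.Tendsto.sup_nhds (tendsto_const_nhds (x := u s)) this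
  refine le_of_tendsto_of_tendsto' (lim w hw) ?_ fun k => key ((k : ℝ≥0∞) + 1)⁻¹ (by simp)
    (by simp)
  exact ENNReal.Tendsto.div_const ((lim u hu).add (lim v hv)) (by simp)

theorem lintegral_rpow_neg_inv_midpoint_le (m : ℕ) {N₁ N₂ N : (Fin m → ℝ) → ℝ≥0∞}
    (h₁ : Measurable N₁) (h₂ : Measurable N₂) (hN : Measurable N)
    (h : ∀ v w, N ((1 / 2 : ℝ) • (v + w)) ≤ (N₁ v + N₂ w) / 2) :
    (∫⁻ v, N v ^ (-((m : ℝ) + 1)))⁻¹ ≤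
      ((∫⁻ v, N₁ v ^ (-((m : ℝ) + 1)))⁻¹ + (∫⁻ v, N₂ v ^ (-((m : ℝ) + 1)))⁻¹) / 2 := by
  induction m with
  | zero =>
    simp only [Nat.cast_zero, zero_add, ENNReal.rpow_neg_one, lintegral_unique]
    have : (volume : Measure (Fin 0 → ℝ)) Set.univ = 1 := by
      rw [volume_pi, Measure.pi_of_empty]; simp
    simp only [this, mul_one, inv_inv]
    convert h default default
  | succ m ih =>
    have hm : 0 < (m : ℝ) + 1 := by positivity
    have e := (volume_preserving_piFinSuccAbove (fun _ : Fin (m + 1) => ℝ) 0).symm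
    set T := (MeasurableEquiv.piFinSuccAbove (fun _ : Fin (m + 1) => ℝ) 0).symm with hT
    have split : ∀ F : (Fin (m + 1) → ℝ) → ℝ≥0∞, Measurable F →
        ∫⁻ v, F v = ∫⁻ z : Fin m → ℝ, ∫⁻ s : ℝ, F (T (s, z)) := by
      intro F hF
      rw [← e.lintegral_comp hF]
      exact lintegral_prod_symm _ (hF.comp T.measurable).aemeasurable
    have mid : ∀ s t z w, T ((s + t) / 2, (1 / 2 : ℝ) • (z + w)) =
        (1 / 2 : ℝ) • (T (s, z) + T (t, w)) := by
      intro s t z w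
      ext i
      refine Fin.cases ?_ (fun j => ?_) i
      · simp [hT, MeasurableEquiv.piFinSuccAbove]; ring
      · simp [hT, MeasurableEquiv.piFinSuccAbove]; ring
    let R : ((Fin (m + 1) → ℝ) → ℝ≥0∞) → (Fin m → ℝ) → ℝ≥0∞ := fun F z =>
      (∫⁻ s : ℝ, F (T (s, z)) ^ (-((m : ℝ) + 2))) ^ (-(1 / ((m : ℝ) + 2 - 1)))
    have hR : ∀ F, Measurable F → Measurable (R F) := by
      intro F hF
      have : Measurable fun q : (Fin m → ℝ) × ℝ => F (T (q.2, q.1)) ^ (-((m : ℝ) + 2)) :=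
        (hF.comp (T.measurable.comp measurable_swap)).pow_const _
      exact this.lintegral_prod_right'.pow_const _
    have hRi : ∀ F, Measurable F → ∫⁻ z, R F z ^ (-((m : ℝ) + 1)) =
        ∫⁻ v, F v ^ (-(((m + 1 : ℕ) : ℝ) + 1)) := by
      intro F hF
      rw [split _ (hF.pow_const _)]
      refine lintegral_congr fun z => ?_
      simp only [R]
      rw [← ENNReal.rpow_mul]
      have e1 : -(1 / ((m : ℝ) + 2 - 1)) * -((m : ℝ) + 1) = 1 := by
        rw [show (m : ℝ) + 2 - 1 = m + 1 by ring]; field_simp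
      rw [e1, ENNReal.rpow_one]
      push_cast
      ring_nf
    have key := ih (hR _ h₁) (hR _ h₂) (hR _ hN) (fun z w => by
      refine lintegral_rpow_midpoint_le (q := (m : ℝ) + 2) (by linarith) ?_ ?_ ?_ fun s t => ?_
      · exact h₁.comp (T.measurable.comp (by fun_prop))
      · exact h₂.comp (T.measurable.comp (by fun_prop))
      · exact hN.comp (T.measurable.comp (by fun_prop))
      · rw [mid]
        exact h _ _)
    rwa [hRi _ h₁, hRi _ h₂, hRi _ hN] at key

theorem min_lintegral_rpow_neg_le (m : ℕ) {N₁ N₂ N : (Fin m → ℝ) → ℝ≥0∞}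
    (h₁ : Measurable N₁) (h₂ : Measurable N₂) (hN : Measurable N)
    (h : ∀ v w, N ((1 / 2 : ℝ) • (v + w)) ≤ (N₁ v + N₂ w) / 2) :
    ∫⁻ v, N₁ v ^ (-((m : ℝ) + 1)) ≤ ∫⁻ v, N v ^ (-((m : ℝ) + 1)) ∨
      ∫⁻ v, N₂ v ^ (-((m : ℝ) + 1)) ≤ ∫⁻ v, N v ^ (-((m : ℝ) + 1)) := by
  by_contra hc
  push Not at hc
  have key := lintegral_rpow_neg_inv_midpoint_le m h₁ h₂ hN h
  refine absurd key (not_le.2 ?_)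
  have k1 := ENNReal.inv_lt_inv.2 hc.1
  have k2 := ENNReal.inv_lt_inv.2 hc.2
  refine (ENNReal.div_lt_div_right (by simp) (by simp) (ENNReal.add_lt_add k1 k2)).trans_eq ?_
  rw [← two_mul, mul_comm, ENNReal.mul_div_cancel_right] <;> simp

theorem setLIntegral_Ioi_pow_mul_indicator (m : ℕ) (a : ℝ≥0∞) :
    ∫⁻ t in Set.Ioi (0 : ℝ), ENNReal.ofReal (t ^ m) *
      {t : ℝ | ENNReal.ofReal t * a ≤ 1}.indicator 1 t =
      ((m : ℝ≥0∞) + 1)⁻¹ * a ^ (-((m : ℝ) + 1)) := by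
  have hm : 0 < (m : ℝ) + 1 := by positivity
  rcases eq_or_ne a 0 with rfl | h0
  · rw [ENNReal.zero_rpow_of_neg (by linarith), ENNReal.mul_top (by simp), eq_top_iff]
    calc ⊤ = ∫⁻ t in Set.Ioi (1 : ℝ), 1 := by simp
      _ ≤ ∫⁻ t in Set.Ioi (1 : ℝ), ENNReal.ofReal (t ^ m) *
            {t : ℝ | ENNReal.ofReal t * 0 ≤ 1}.indicator 1 t := by
          refine setLIntegral_mono' measurableSet_Ioi fun t ht => ?_
          simp only [mul_zero, zero_le, Set.ofPred_true, Set.indicator_univ, Pi.one_apply, mul_one,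
            ENNReal.one_le_ofReal]
          exact one_le_pow₀ (le_of_lt ht)
      _ ≤ _ := lintegral_mono_set (Set.Ioi_subset_Ioi zero_le_one)
  rcases eq_or_ne a ⊤ with rfl | ht
  · rw [ENNReal.top_rpow_of_neg (by linarith), mul_zero]
    refine (setLIntegral_congr_fun measurableSet_Ioi fun t ht => ?_).trans lintegral_zero
    have : ENNReal.ofReal t * ⊤ = ⊤ := ENNReal.mul_top (by simpa using ht)
    simp [Set.indicator, this]
  obtain ⟨b, hb, rfl⟩ : ∃ b : ℝ, 0 < b ∧ a = ENNReal.ofReal b :=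
    ⟨a.toReal, ENNReal.toReal_pos h0 ht, (ENNReal.ofReal_toReal ht).symm⟩
  have e1 : ∫⁻ t in Set.Ioi (0 : ℝ), ENNReal.ofReal (t ^ m) *
      {t : ℝ | ENNReal.ofReal t * ENNReal.ofReal b ≤ 1}.indicator 1 t =
      ∫⁻ t in Set.Ioi (0 : ℝ), (Set.Ioc 0 (1 / b)).indicator (fun t => ENNReal.ofReal (t ^ m)) t := by
    refine setLIntegral_congr_fun measurableSet_Ioi fun t ht => ?_
    have ht' : (0 : ℝ) < t := ht
    have : ENNReal.ofReal t * ENNReal.ofReal b ≤ 1 ↔ t ≤ 1 / b := by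
      rw [← ENNReal.ofReal_mul ht'.le, ENNReal.ofReal_le_one, le_div_iff₀ hb]
    simp [Set.indicator, this, ht']
  rw [e1, setLIntegral_indicator measurableSet_Ioc, Set.inter_eq_left.2 Set.Ioc_subset_Ioi_self,
    ← ofReal_integral_eq_lintegral_ofReal, ← intervalIntegral.integral_of_le (by positivity),
    integral_pow, ENNReal.ofReal_rpow_of_pos hb]
  · have : ((m : ℝ≥0∞) + 1)⁻¹ = ENNReal.ofReal (((m : ℝ) + 1)⁻¹) := by
      rw [ENNReal.ofReal_inv_of_pos hm]; simp [ENNReal.ofReal_add]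
    rw [this, ← ENNReal.ofReal_mul (by positivity)]
    congr 1
    rw [rpow_neg hb.le]
    norm_cast
    simp
    field_simp
  · exact ((continuous_pow m).integrableOn_Icc (a := 0) (b := 1 / b)).mono_set Set.Ioc_subset_Icc_self
  · exact (ae_restrict_iff' measurableSet_Ioc).2 (.of_forall fun t ht => pow_nonneg ht.1.le _)

theorem volume_homogeneous_halfspace {m : ℕ} {e : EuclideanSpace ℝ (Fin (m + 1))} (he : ‖e‖ = 1)
    {L : (Fin m → ℝ) →L[ℝ] EuclideanSpace ℝ (Fin (m + 1))} (hL : ∀ v, ⟪L v, e⟫ = 0)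
    (hmp : MeasurePreserving (fun q : ℝ × (Fin m → ℝ) => q.1 • e + L q.2))
    {N : EuclideanSpace ℝ (Fin (m + 1)) → ℝ≥0∞} (hN : Measurable N)
    (hom : ∀ (c : ℝ) y, 0 < c → N (c • y) = ENNReal.ofReal c * N y) :
    volume {y | N y ≤ 1 ∧ 0 < ⟪y, e⟫} =
      ((m : ℝ≥0∞) + 1)⁻¹ * ∫⁻ z, N (L z + e) ^ (-((m : ℝ) + 1)) := by
  have hA : MeasurableSet {y | N y ≤ 1 ∧ 0 < ⟪y, e⟫} :=
    (measurableSet_le hN measurable_const).inter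
      (measurableSet_lt measurable_const
        (show Measurable fun y : EuclideanSpace ℝ (Fin (m + 1)) => ⟪y, e⟫ by fun_prop))
  have hNL : Measurable fun z => N (L z + e) :=
    hN.comp (show Measurable fun z => L z + e by fun_prop)
  rw [← hmp.measure_preimage hA.nullMeasurableSet, Measure.volume_eq_prod,
    Measure.prod_apply (hmp.measurable hA)]
  have e1 : ∀ t : ℝ, volume (Prod.mk t ⁻¹' ((fun q : ℝ × (Fin m → ℝ) => q.1 • e + L q.2) ⁻¹'
      {y | N y ≤ 1 ∧ 0 < ⟪y, e⟫})) = (Set.Ioi (0 : ℝ)).indicator (fun t => ∫⁻ z,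
        ENNReal.ofReal (t ^ m) * {t : ℝ | ENNReal.ofReal t * N (L z + e) ≤ 1}.indicator 1 t) t := by
    intro t
    have hin : ∀ w, ⟪t • e + L w, e⟫ = t := by
      intro w; rw [inner_add_left, inner_smul_left, hL, real_inner_self_eq_norm_sq, he]; simp
    simp only [Set.preimage_ofPred_eq, hin]
    by_cases ht : 0 < t
    · have e2 : {w : Fin m → ℝ | N (t • e + L w) ≤ 1 ∧ 0 < t} =
          t • {z | ENNReal.ofReal t * N (L z + e) ≤ 1} := by
        ext w
        rw [Set.mem_smul_set_iff_inv_smul_mem₀ ht.ne']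
        simp only [Set.mem_ofPred_eq, ht, and_true]
        rw [← hom t _ ht, smul_add, map_smul, smul_inv_smul₀ ht.ne', add_comm]
      rw [Set.indicator_of_mem (show t ∈ Set.Ioi 0 from ht), e2, Measure.addHaar_smul,
        lintegral_const_mul' _ _ (by simp)]
      congr 1
      · simp [abs_of_pos (pow_pos ht m)]
      · rw [← lintegral_indicator_one]
        · rfl
        · exact measurableSet_le (hNL.const_mul _) measurable_const
    · rw [Set.indicator_of_notMem (show t ∉ Set.Ioi 0 from ht)]
      simp [ht]
  rw [lintegral_congr e1, lintegral_indicator measurableSet_Ioi, lintegral_lintegral_swap,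
    ← lintegral_const_mul _ (hNL.pow_const _)]
  · exact lintegral_congr fun z => setLIntegral_Ioi_pow_mul_indicator m _
  · have hS : MeasurableSet {q : ℝ × (Fin m → ℝ) | ENNReal.ofReal q.1 * N (L q.2 + e) ≤ 1} :=
      measurableSet_le (by
        exact (ENNReal.measurable_ofReal.comp measurable_fst).mul (hNL.comp measurable_snd))
        measurable_const
    have : Measurable fun q : ℝ × (Fin m → ℝ) => ENNReal.ofReal (q.1 ^ m) *
        {q : ℝ × (Fin m → ℝ) | ENNReal.ofReal q.1 * N (L q.2 + e) ≤ 1}.indicator 1 q :=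
      (by fun_prop : Measurable fun q : ℝ × (Fin m → ℝ) => ENNReal.ofReal (q.1 ^ m)).mul
        (measurable_one.indicator hS)
    exact this.aemeasurable

theorem volume_homogeneous_halfspace_neg {m : ℕ} {e : EuclideanSpace ℝ (Fin (m + 1))}
    (he : ‖e‖ = 1)
    {L : (Fin m → ℝ) →L[ℝ] EuclideanSpace ℝ (Fin (m + 1))} (hL : ∀ v, ⟪L v, e⟫ = 0)
    (hmp : MeasurePreserving (fun q : ℝ × (Fin m → ℝ) => q.1 • e + L q.2))
    {N : EuclideanSpace ℝ (Fin (m + 1)) → ℝ≥0∞} (hN : Measurable N)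
    (hom : ∀ (c : ℝ) y, 0 < c → N (c • y) = ENNReal.ofReal c * N y) :
    volume {y | N y ≤ 1 ∧ ⟪y, e⟫ < 0} =
      ((m : ℝ≥0∞) + 1)⁻¹ * ∫⁻ z, N (L z - e) ^ (-((m : ℝ) + 1)) := by
  have hmp' : MeasurePreserving (fun q : ℝ × (Fin m → ℝ) => q.1 • (-e) + L q.2) := by
    have := hmp.comp ((Measure.measurePreserving_neg (volume : Measure ℝ)).prod
      (MeasurePreserving.id (volume : Measure (Fin m → ℝ))))
    rw [← Measure.volume_eq_prod] at this
    convert this using 2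
    simp
  have := volume_homogeneous_halfspace (e := -e) (by simpa using he) (by simpa using hL) hmp' hN hom
  simpa [← sub_eq_add_neg] using this

/-- Nonnegative continuous functions with compact support. -/
structure IsDensity {n : ℕ} (f : EuclideanSpace ℝ (Fin n) → ℝ) : Prop where
  continuous : Continuous f
  nonneg : ∀ x, 0 ≤ f x
  hasCompactSupport : HasCompactSupport f

/-- The moment `∫ f(x) ⟨x, y⟩₊ᵖ dx`. -/
noncomputable def posMoment {n : ℕ} (p : ℝ) (f : EuclideanSpace ℝ (Fin n) → ℝ)
    (y : EuclideanSpace ℝ (Fin n)) : ℝ :=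
  ∫ x, f x * max ⟪x, y⟫ 0 ^ p

theorem continuous_max_rpow {p : ℝ} (hp : 1 ≤ p) : Continuous fun s : ℝ => max s 0 ^ p :=
  (continuous_id.max continuous_const).rpow_const fun _ => Or.inr (by linarith)

theorem convexOn_max_rpow {p : ℝ} (hp : 1 ≤ p) : ConvexOn ℝ Set.univ fun s : ℝ => max s 0 ^ p := by
  have h := convexOn_rpow hp
  refine ⟨convex_univ, fun x _ y _ a b ha hb hab => ?_⟩
  have h1 : max (a • x + b • y) 0 ≤ a • max x 0 + b • max y 0 := by
    simp only [smul_eq_mul]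
    refine max_le ?_ (by positivity)
    gcongr <;> exact le_max_left _ _
  exact (rpow_le_rpow (le_max_right _ _) h1 (by linarith)).trans
    (h.2 (Set.mem_Ici.2 (le_max_right x 0)) (Set.mem_Ici.2 (le_max_right y 0)) ha hb hab)

section
variable {n : ℕ} {f : EuclideanSpace ℝ (Fin n) → ℝ} {p : ℝ}

theorem IsDensity.comp_sub (hf : IsDensity f) (c : EuclideanSpace ℝ (Fin n)) :
    IsDensity fun x => f (x - c) :=
  ⟨hf.continuous.comp (by fun_prop), fun _ => hf.nonneg _,
    hf.hasCompactSupport.comp_homeomorph (Homeomorph.subRight c)⟩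

theorem posMoment_nonneg (hf : ∀ x, 0 ≤ f x) (y : EuclideanSpace ℝ (Fin n)) :
    0 ≤ posMoment p f y :=
  integral_nonneg fun x => mul_nonneg (hf x) (by positivity)

theorem IsDensity.integrable_mul (hf : IsDensity f) {g : EuclideanSpace ℝ (Fin n) → ℝ}
    (hg : Continuous g) : Integrable fun x => f x * g x :=
  (hf.continuous.mul hg).integrable_of_hasCompactSupport hf.hasCompactSupport.mul_right

theorem IsDensity.integrable (hf : IsDensity f) : Integrable f :=
  hf.continuous.integrable_of_hasCompactSupport hf.hasCompactSupport

theorem IsDensity.integrable_posMoment (hp : 1 ≤ p) (hf : IsDensity f)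
    (y : EuclideanSpace ℝ (Fin n)) : Integrable fun x => f x * max ⟪x, y⟫ 0 ^ p :=
  hf.integrable_mul ((continuous_max_rpow hp).comp (by fun_prop))

theorem ofReal_posMoment (hp : 1 ≤ p) (hf : IsDensity f) (y : EuclideanSpace ℝ (Fin n)) :
    ENNReal.ofReal (posMoment p f y) =
      ∫⁻ x, ENNReal.ofReal (f x) * ENNReal.ofReal (max ⟪x, y⟫ 0 ^ p) := by
  rw [posMoment, ofReal_integral_eq_lintegral_ofReal (hf.integrable_posMoment hp y)
    (.of_forall fun x => mul_nonneg (hf.nonneg x) (by positivity))]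
  exact lintegral_congr fun x => ENNReal.ofReal_mul (hf.nonneg x)

theorem posMoment_smul {c : ℝ} (hc : 0 ≤ c) (y : EuclideanSpace ℝ (Fin n)) :
    posMoment p f (c • y) = c ^ p * posMoment p f y := by
  rw [posMoment, posMoment, ← integral_const_mul]
  congr 1 with x
  rw [inner_smul_right, ← mul_zero c, ← mul_max_of_nonneg _ _ hc, mul_zero,
    mul_rpow hc (le_max_right _ _)]
  ring

theorem posMoment_comp_sub (c y : EuclideanSpace ℝ (Fin n)) :
    posMoment p (fun x => f (x - c)) y = ∫ x, f x * max ⟪x + c, y⟫ 0 ^ p := by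
  rw [posMoment, ← integral_sub_right_eq_self (fun x => f x * max ⟪x + c, y⟫ 0 ^ p) c]
  simp

theorem posMoment_neg_of_even (hf : ∀ x, f (-x) = f x) (y : EuclideanSpace ℝ (Fin n)) :
    posMoment p f (-y) = posMoment p f y := by
  rw [posMoment, ← integral_neg_eq_self]
  simp [hf, posMoment]

theorem continuous_posMoment_comp_sub (hp : 1 ≤ p) (hf : IsDensity f) :
    Continuous fun q : EuclideanSpace ℝ (Fin n) × EuclideanSpace ℝ (Fin n) =>
      posMoment p (fun x => f (x - q.1)) q.2 := by
  simp only [posMoment_comp_sub]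
  have h := continuous_parametric_integral_of_continuous (μ := volume)
    (f := fun (q : EuclideanSpace ℝ (Fin n) × EuclideanSpace ℝ (Fin n)) x =>
      f x * max ⟪x + q.1, q.2⟫ 0 ^ p)
    ((hf.continuous.comp continuous_snd).mul
      ((continuous_max_rpow hp).comp (by fun_prop))) hf.hasCompactSupport
  convert h using 2 with q
  rw [setIntegral_eq_integral_of_forall_compl_eq_zero]
  intro x hx
  simp [image_eq_zero_of_notMem_tsupport hx]

theorem continuous_posMoment (hp : 1 ≤ p) (hf : IsDensity f) : Continuous (posMoment p f) := by
  have := (continuous_posMoment_comp_sub hp hf).comp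
    (Continuous.prodMk (continuous_const (y := (0 : EuclideanSpace ℝ (Fin n)))) continuous_id)
  simpa [Function.comp_def] using this

/-- The volume of the polar set `{y | ∫ f(x) ⟨x, y⟩₊ᵖ dx ≤ 1}`. -/
noncomputable def polarVolume (p : ℝ) (f : EuclideanSpace ℝ (Fin n) → ℝ) : ℝ≥0∞ :=
  volume {y | posMoment p f y ≤ 1}

/-- The volume of the half of the polar set on the positive side of `e`. -/
noncomputable def halfPolarVolume (p : ℝ) (f : EuclideanSpace ℝ (Fin n) → ℝ)
    (e : EuclideanSpace ℝ (Fin n)) : ℝ≥0∞ :=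
  volume {y | posMoment p f y ≤ 1 ∧ 0 < ⟪y, e⟫}

theorem volume_inner_eq_zero {e : EuclideanSpace ℝ (Fin n)} (he : e ≠ 0) :
    volume {y : EuclideanSpace ℝ (Fin n) | ⟪y, e⟫ = 0} = 0 := by
  have h := Measure.addHaar_submodule volume (LinearMap.ker (innerSL ℝ e).toLinearMap) (by
    intro h
    have : e ∈ LinearMap.ker (innerSL ℝ e).toLinearMap := h ▸ Submodule.mem_top
    simp at this
    exact he this)
  convert h using 2
  ext y
  simp [real_inner_comm]

theorem polarVolume_eq_add (hp : 1 ≤ p) (hf : IsDensity f) {e : EuclideanSpace ℝ (Fin n)}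
    (he : e ≠ 0) : polarVolume p f = halfPolarVolume p f e + halfPolarVolume p f (-e) := by
  have hm : Measurable (posMoment p f) := (continuous_posMoment hp hf).measurable
  have hi : Measurable fun y : EuclideanSpace ℝ (Fin n) => ⟪y, -e⟫ := by fun_prop
  rw [halfPolarVolume, halfPolarVolume, polarVolume, ← measure_union]
  · refine measure_congr ?_
    have h0 : ∀ᵐ y : EuclideanSpace ℝ (Fin n), ⟪y, e⟫ ≠ 0 := by
      rw [ae_iff]; simpa using volume_inner_eq_zero he
    filter_upwards [h0] with y hy
    have : 0 < ⟪y, e⟫ ∨ 0 < ⟪y, -e⟫ := by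
      rcases lt_or_gt_of_ne hy with h | h
      · right; simpa using h
      · left; exact h
    refine propext ?_
    change _ ≤ _ ↔ (_ ∧ _) ∨ (_ ∧ _)
    tauto
  · refine Set.disjoint_left.2 fun y h1 h2 => ?_
    have h1 := h1.2
    have h2 := h2.2
    rw [inner_neg_right] at h2
    linarith
  · exact (measurableSet_le hm measurable_const).inter (measurableSet_lt measurable_const hi)

theorem halfPolarVolume_neg_of_even (hf : ∀ x, f (-x) = f x) (e : EuclideanSpace ℝ (Fin n)) :
    halfPolarVolume p f (-e) = halfPolarVolume p f e := by
  have h : {y | posMoment p f y ≤ 1 ∧ 0 < ⟪y, -e⟫} =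
      -{y | posMoment p f y ≤ 1 ∧ 0 < ⟪y, e⟫} := by
    ext y
    simp [posMoment_neg_of_even hf]
  rw [halfPolarVolume, h, Measure.measure_neg, halfPolarVolume]

end

theorem setLIntegral_Ioo_le_of_convexOn {ψ : ℝ → ℝ} (hψ : ConvexOn ℝ Set.univ ψ) {A : Set ℝ}
    (hA : MeasurableSet A) {l x : ℝ} (hAl : volume A = ENNReal.ofReal (2 * l))
    (hx : ψ (x - l) = ψ (x + l)) :
    ∫⁻ s in Set.Ioo (x - l) (x + l), ENNReal.ofReal (ψ s) ≤ ∫⁻ s in A, ENNReal.ofReal (ψ s) := by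
  rcases le_or_gt l 0 with hl | hl
  · rw [Set.Ioo_eq_empty (by linarith)]; simp
  set J := Set.Ioo (x - l) (x + l) with hJ
  have mJ : MeasurableSet J := measurableSet_Ioo
  have vJ : volume J = ENNReal.ofReal (2 * l) := by rw [hJ, Real.volume_Ioo]; ring_nf
  have hin : ∀ s ∈ J, ψ s ≤ ψ (x + l) := fun s hs => by
    have := hψ.le_max_of_mem_Icc (Set.mem_univ (x - l)) (Set.mem_univ (x + l))
      (Set.Ioo_subset_Icc_self hs)
    rwa [hx, max_self] at this
  have hout : ∀ s, s ∉ J → ψ (x + l) ≤ ψ s := by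
    intro s hs
    by_contra hc
    push Not at hc
    rcases le_or_gt s (x - l) with h | h
    · have hs' : s < x - l := lt_of_le_of_ne h (by rintro rfl; rw [hx] at hc; exact lt_irrefl _ hc)
      have := hψ.lt_right_of_left_lt (Set.mem_univ s) (Set.mem_univ (x + l))
        (z := x - l) (by rw [openSegment_eq_Ioo (by linarith)]; exact ⟨hs', by linarith⟩)
        (by rw [hx]; exact hc)
      rw [hx] at this
      exact lt_irrefl _ this
    · have h' : x + l ≤ s := by
        by_contra h'; exact hs ⟨h, by linarith⟩
      have hs' : x + l < s := lt_of_le_of_ne h' (by rintro rfl; exact lt_irrefl _ hc)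
      have := hψ.lt_left_of_right_lt (Set.mem_univ (x - l)) (Set.mem_univ s)
        (z := x + l) (by rw [openSegment_eq_Ioo (by linarith)]; exact ⟨by linarith, hs'⟩) hc
      rw [hx] at this
      exact lt_irrefl _ this
  have hfin : volume (A ∩ J) ≠ ⊤ := (measure_mono Set.inter_subset_right |>.trans_lt
    (by rw [vJ]; exact ENNReal.ofReal_lt_top)).ne
  have hdiff : volume (A \ J) = volume (J \ A) := by
    have h1 := measure_inter_add_sdiff (μ := volume) A mJ
    have h2 := measure_inter_add_sdiff (μ := volume) J hA
    rw [hAl] at h1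
    rw [vJ, Set.inter_comm, ← h1] at h2
    exact ((ENNReal.add_right_inj hfin).1 h2).symm
  rw [← lintegral_inter_add_sdiff (fun s => ENNReal.ofReal (ψ s)) A mJ,
    ← lintegral_inter_add_sdiff (fun s => ENNReal.ofReal (ψ s)) J hA, Set.inter_comm J A]
  refine add_le_add le_rfl ?_
  calc ∫⁻ s in J \ A, ENNReal.ofReal (ψ s) ≤ ∫⁻ _ in J \ A, ENNReal.ofReal (ψ (x + l)) :=
        setLIntegral_mono' (mJ.diff hA) fun s hs => ENNReal.ofReal_le_ofReal (hin s hs.1)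
    _ = ∫⁻ _ in A \ J, ENNReal.ofReal (ψ (x + l)) := by
        rw [setLIntegral_const, setLIntegral_const, hdiff]
    _ ≤ _ := setLIntegral_mono' (hA.diff mJ) fun s hs => ENNReal.ofReal_le_ofReal (hout s hs.2)

theorem setLIntegral_Ioo_max_rpow_le {p : ℝ} (hp : 1 ≤ p) {A : Set ℝ} (hA : MeasurableSet A)
    {l a b α β : ℝ} (hAl : volume A = ENNReal.ofReal (2 * l)) (ha : 0 < a) (hb : 0 < b) :
    ∫⁻ s in Set.Ioo (-l) l, ENNReal.ofReal (max ((s + (α + β) / 2) / ((a + b) / 2)) 0 ^ p) ≤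
      ENNReal.ofReal (a / (a + b)) * (∫⁻ s in A, ENNReal.ofReal (max ((s + α) / a) 0 ^ p)) +
      ENNReal.ofReal (b / (a + b)) * (∫⁻ s in A, ENNReal.ofReal (max ((β - s) / b) 0 ^ p)) := by
  rcases le_or_gt l 0 with hl | hl
  · rw [Set.Ioo_eq_empty (by linarith)]; simp
  have hφ := continuous_max_rpow hp
  have hc := convexOn_max_rpow hp
  have ta : 0 ≤ a / (a + b) := by positivity
  have tb : 0 ≤ b / (a + b) := by positivity
  set ψ : ℝ → ℝ := fun s => a / (a + b) * max ((s + α) / a) 0 ^ p +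
    b / (a + b) * max ((β - s) / b) 0 ^ p with hψ
  have c1 : Continuous fun s : ℝ => max ((s + α) / a) 0 ^ p := hφ.comp (by fun_prop)
  have c2 : Continuous fun s : ℝ => max ((β - s) / b) 0 ^ p := hφ.comp (by fun_prop)
  have cψ : Continuous ψ := (c1.const_mul _).add (c2.const_mul _)
  have convψ : ConvexOn ℝ Set.univ ψ := by
    refine ConvexOn.add (ConvexOn.smul ta ?_) (ConvexOn.smul tb ?_)
    · refine ⟨convex_univ, fun s _ t _ u v hu hv huv => ?_⟩
      have := hc.2 (Set.mem_univ ((s + α) / a)) (Set.mem_univ ((t + α) / a)) hu hv huv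
      refine le_of_eq_of_le ?_ this
      have e : (u • s + v • t + α) / a = u • ((s + α) / a) + v • ((t + α) / a) := by
        simp only [smul_eq_mul]; field_simp; linear_combination -α * huv
      simp only [e]
    · refine ⟨convex_univ, fun s _ t _ u v hu hv huv => ?_⟩
      have := hc.2 (Set.mem_univ ((β - s) / b)) (Set.mem_univ ((β - t) / b)) hu hv huv
      refine le_of_eq_of_le ?_ this
      have e : (β - (u • s + v • t)) / b = u • ((β - s) / b) + v • ((β - t) / b) := by
        simp only [smul_eq_mul]; field_simp; linear_combination -β * huv
      simp only [e]
  obtain ⟨x, hx⟩ : ∃ x, ψ (x - l) = ψ (x + l) := by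
    have mono : ∀ s t : ℝ, s ≤ t → max s 0 ^ p ≤ max t 0 ^ p := fun s t hst =>
      rpow_le_rpow (le_max_right _ _) (max_le_max_right _ hst) (by linarith)
    refine mem_range_of_exists_le_of_exists_ge (c := 0)
      (f := fun x => ψ (x - l) - ψ (x + l)) ?_ ?_ ?_ |>.imp fun x hx => sub_eq_zero.1 hx
    · exact (cψ.comp (by fun_prop)).sub (cψ.comp (by fun_prop))
    · refine ⟨β + l, ?_⟩
      have e1 : max ((β - (β + l - l)) / b) 0 ^ p = 0 := by
        simp [zero_rpow (show p ≠ 0 by linarith)]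
      have e2 : max ((β - (β + l + l)) / b) 0 ^ p = 0 := by
        rw [max_eq_right, zero_rpow (by linarith)]
        exact div_nonpos_of_nonpos_of_nonneg (by linarith) hb.le
      simp only [hψ, e1, e2, mul_zero, add_zero, sub_nonpos]
      exact mul_le_mul_of_nonneg_left (mono _ _ (by gcongr; linarith)) ta
    · refine ⟨-α - l, ?_⟩
      have e1 : max ((-α - l - l + α) / a) 0 ^ p = 0 := by
        rw [max_eq_right, zero_rpow (by linarith)]
        exact div_nonpos_of_nonpos_of_nonneg (by linarith) ha.le
      have e2 : max ((-α - l + l + α) / a) 0 ^ p = 0 := by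
        simp [zero_rpow (show p ≠ 0 by linarith)]
      simp only [hψ, e1, e2, mul_zero, zero_add, sub_nonneg]
      exact mul_le_mul_of_nonneg_left (mono _ _ (by gcongr; linarith)) tb
  have split : ∀ B : Set ℝ, ∫⁻ s in B, ENNReal.ofReal (ψ s) =
      ENNReal.ofReal (a / (a + b)) * (∫⁻ s in B, ENNReal.ofReal (max ((s + α) / a) 0 ^ p)) +
      ENNReal.ofReal (b / (a + b)) * (∫⁻ s in B, ENNReal.ofReal (max ((β - s) / b) 0 ^ p)) := by
    intro B
    rw [← lintegral_const_mul _ (by fun_prop), ← lintegral_const_mul _ (by fun_prop),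
      ← lintegral_add_left (by fun_prop)]
    refine lintegral_congr fun s => ?_
    rw [← ENNReal.ofReal_mul ta, ← ENNReal.ofReal_mul tb, ← ENNReal.ofReal_add]
    · positivity
    · positivity
  rw [← split]
  refine le_trans ?_ (setLIntegral_Ioo_le_of_convexOn convψ hA hAl hx)
  have shift : ∀ F : ℝ → ℝ≥0∞, ∫⁻ s in Set.Ioo (x - l) (x + l), F s =
      ∫⁻ s in Set.Ioo (-l) l, F (x + s) := by
    intro F
    rw [(measurePreserving_add_left volume x).setLIntegral_comp_emb
      (measurableEmbedding_addLeft x) F (Set.Ioo (-l) l)]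
    simp [sub_eq_add_neg, add_comm]
  have flip : ∀ F : ℝ → ℝ≥0∞, ∫⁻ s in Set.Ioo (-l) l, F s = ∫⁻ s in Set.Ioo (-l) l, F (-s) := by
    intro F
    have := (Measure.measurePreserving_neg (volume : Measure ℝ)).setLIntegral_comp_emb
      (MeasurableEquiv.neg ℝ).measurableEmbedding F (Set.Ioo (-l) l)
    rw [this]
    simp
  rw [split, shift, shift, flip fun s => ENNReal.ofReal (max ((β - (x + s)) / b) 0 ^ p),
    ← lintegral_const_mul _ (by fun_prop), ← lintegral_const_mul _ (by fun_prop),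
      ← lintegral_add_left (by fun_prop)]
  refine lintegral_mono fun s => ?_
  rw [← ENNReal.ofReal_mul ta, ← ENNReal.ofReal_mul tb, ← ENNReal.ofReal_add]
  · refine ENNReal.ofReal_le_ofReal ?_
    have := hc.2 (Set.mem_univ ((x + s + α) / a)) (Set.mem_univ ((β - (x + -s)) / b)) ta tb
      (by field_simp)
    simp only [smul_eq_mul] at this
    refine le_of_eq_of_le ?_ this
    congr 2
    field_simp
    ring
  · positivity
  · positivity

section
variable {n : ℕ} {f g : EuclideanSpace ℝ (Fin n) → ℝ} {e : EuclideanSpace ℝ (Fin n)}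

/-- The length of the superlevel set `{f > r}` along the line through `x` with direction `e`. -/
noncomputable def fiberLength (e : EuclideanSpace ℝ (Fin n)) (f : EuclideanSpace ℝ (Fin n) → ℝ)
    (x : EuclideanSpace ℝ (Fin n)) (r : ℝ) : ℝ≥0∞ :=
  volume {s : ℝ | r < f (x + s • e)}

/-- The Steiner symmetrization of `f` in direction `e`. -/
noncomputable def steiner (e : EuclideanSpace ℝ (Fin n)) (f : EuclideanSpace ℝ (Fin n) → ℝ)
    (x : EuclideanSpace ℝ (Fin n)) : ℝ :=
  sSup {r | 0 ≤ r ∧ ENNReal.ofReal (2 * |⟪x, e⟫|) < fiberLength e f x r}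

theorem fiberLength_anti (x : EuclideanSpace ℝ (Fin n)) : Antitone (fiberLength e f x) :=
  fun _ _ h => measure_mono fun _ hs => lt_of_le_of_lt h hs

theorem fiberLength_add_smul (x : EuclideanSpace ℝ (Fin n)) (t r : ℝ) :
    fiberLength e f (x + t • e) r = fiberLength e f x r := by
  rw [fiberLength, fiberLength, ← measure_preimage_add volume t {s : ℝ | r < f (x + s • e)}]
  simp only [Set.preimage_ofPred_eq, add_smul, add_assoc]

theorem fiberLength_eq_zero {M r : ℝ} (hM : ∀ x, f x ≤ M) (hr : M ≤ r)
    (x : EuclideanSpace ℝ (Fin n)) : fiberLength e f x r = 0 := by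
  rw [fiberLength]
  convert measure_empty (μ := (volume : Measure ℝ))
  ext s
  simpa using (hM _).trans hr

theorem lt_steiner_iff {M : ℝ} (hM : ∀ x, f x ≤ M) {r : ℝ} (hr : 0 ≤ r)
    (x : EuclideanSpace ℝ (Fin n)) :
    r < steiner e f x ↔ ENNReal.ofReal (2 * |⟪x, e⟫|) < fiberLength e f x r := by
  constructor
  · intro h
    have hne : {r | 0 ≤ r ∧ ENNReal.ofReal (2 * |⟪x, e⟫|) < fiberLength e f x r}.Nonempty := by
      by_contra hc
      rw [Set.not_nonempty_iff_eq_empty] at hc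
      rw [steiner, hc, Real.sSup_empty] at h
      linarith
    obtain ⟨r', hr', hlt⟩ := exists_lt_of_lt_csSup hne h
    exact hr'.2.trans_le (fiberLength_anti x hlt.le)
  · intro h
    have hU : {s : ℝ | r < f (x + s • e)} =
        ⋃ k : ℕ, {s : ℝ | r + 1 / ((k : ℝ) + 1) < f (x + s • e)} := by
      ext s
      simp only [Set.mem_ofPred_eq, Set.mem_iUnion]
      constructor
      · intro hs
        obtain ⟨k, hk⟩ := exists_nat_one_div_lt (sub_pos.2 hs)
        exact ⟨k, by linarith⟩
      · rintro ⟨k, hk⟩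
        have : 0 < 1 / ((k : ℝ) + 1) := by positivity
        linarith
    have hmono : Monotone fun k : ℕ => {s : ℝ | r + 1 / ((k : ℝ) + 1) < f (x + s • e)} := by
      intro k l hkl s hs
      refine lt_of_le_of_lt (b := r + 1 / ((k : ℝ) + 1)) ?_ hs
      have : (k : ℝ) ≤ l := by exact_mod_cast hkl
      gcongr
    rw [fiberLength, hU, hmono.measure_iUnion, lt_iSup_iff] at h
    obtain ⟨k, hk⟩ := h
    have hpos : 0 < 1 / ((k : ℝ) + 1) := by positivity
    refine lt_of_lt_of_le (lt_add_of_pos_right r hpos) (le_csSup ⟨M, ?_⟩ ⟨by positivity, hk⟩)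
    intro r' hr'
    by_contra hc
    have h2 := hr'.2
    rw [fiberLength_eq_zero hM (le_of_not_ge hc)] at h2
    exact not_lt_zero h2

theorem steiner_nonneg (x : EuclideanSpace ℝ (Fin n)) : 0 ≤ steiner e f x :=
  Real.sSup_nonneg fun _ hr => hr.1

theorem steiner_le {M : ℝ} (hM0 : 0 ≤ M) (hM : ∀ x, f x ≤ M) (x : EuclideanSpace ℝ (Fin n)) :
    steiner e f x ≤ M := by
  by_contra hc
  rw [not_le, lt_steiner_iff hM hM0, fiberLength_eq_zero hM le_rfl] at hc
  exact not_lt_zero hc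

theorem steiner_eq_zero (he : ‖e‖ = 1) {M R : ℝ} (hM : ∀ x, f x ≤ M)
    (hR : ∀ x, R < ‖x‖ → f x = 0) (hR0 : 0 ≤ R) (x : EuclideanSpace ℝ (Fin n)) (hx : R < ‖x‖) :
    steiner e f x = 0 := by
  refine le_antisymm ?_ (steiner_nonneg x)
  by_contra hc
  rw [not_le, lt_steiner_iff hM le_rfl] at hc
  refine absurd hc (not_lt.2 ?_)
  set τ := ⟪x, e⟫ with hτ
  have hsub : {s : ℝ | 0 < f (x + s • e)} ⊆ Set.Ioo (-τ - |τ|) (-τ + |τ|) := by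
    intro s hs
    have h1 : ‖x + s • e‖ ≤ R := by
      by_contra h
      have := hR _ (not_le.1 h)
      simp [this] at hs
    have h2 : ‖x + s • e‖ ^ 2 = ‖x‖ ^ 2 + 2 * (s * τ) + s ^ 2 := by
      rw [norm_add_sq_real, inner_smul_right, norm_smul, he, mul_one, Real.norm_eq_abs, sq_abs]
    have h3 : (s + τ) ^ 2 < |τ| ^ 2 := by
      rw [sq_abs]
      have := pow_le_pow_left₀ (norm_nonneg _) h1 2
      have := pow_lt_pow_left₀ hx hR0 two_ne_zero
      nlinarith
    have := abs_lt_of_sq_lt_sq h3 (abs_nonneg _)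
    rw [abs_lt] at this
    constructor <;> linarith [this.1, this.2]
  refine (measure_mono hsub).trans ?_
  rw [Real.volume_Ioo]
  refine ENNReal.ofReal_le_ofReal ?_
  linarith

theorem steiner_le_add (he : ‖e‖ = 1) (hf : Continuous f) {M M' δ η : ℝ}
    (hM : ∀ x, f x ≤ M) (hM' : ∀ x, g x ≤ M') (hη : 0 ≤ η)
    (h : ∀ x y, ‖x - y‖ ≤ δ → f x ≤ g y + η) (x y : EuclideanSpace ℝ (Fin n))
    (hxy : ‖x - y‖ ≤ δ) : steiner e f x ≤ steiner e g y + η := by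
  refine le_of_forall_lt fun r hr => ?_
  rcases lt_or_ge r η with hr0 | hr0
  · linarith [steiner_nonneg (e := e) (f := g) y]
  rw [lt_steiner_iff hM (hη.trans hr0)] at hr
  rw [← sub_lt_iff_lt_add, lt_steiner_iff hM' (sub_nonneg.2 hr0)]
  set κ := ⟪y - x, e⟫ with hκ
  set w := y - x - κ • e with hw
  have hwe : ⟪w, e⟫ = 0 := by
    rw [hw, inner_sub_left, inner_smul_left, real_inner_self_eq_norm_sq, he, ← hκ]; simp
  have hy : y = x + w + κ • e := by rw [hw]; abel
  have hnorm : ∀ t : ℝ, ‖w + t • e‖ ^ 2 = ‖w‖ ^ 2 + t ^ 2 := by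
    intro t
    rw [norm_add_sq_real, inner_smul_right, hwe, norm_smul, he]
    simp
  have hfib : fiberLength e g y (r - η) = volume {s : ℝ | r - η < g (x + w + s • e)} := by
    rw [hy, fiberLength_add_smul]; rfl
  have mA : MeasurableSet {s : ℝ | r < f (x + s • e)} :=
    measurableSet_lt measurable_const (hf.comp (by fun_prop)).measurable
  have key := volume_add_le_of_midpoint_mem (A := {s : ℝ | s / 2 ∈ {s : ℝ | r < f (x + s • e)}})
    (B := Set.Icc (-(2 * |κ|)) (2 * |κ|)) (C := {s : ℝ | r - η < g (x + w + s • e)})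
    (mA.preimage (by fun_prop)) measurableSet_Icc (by
      have : {s : ℝ | r < f (x + s • e)}.Nonempty :=
        nonempty_of_measure_ne_zero (hr.trans_le' zero_le).ne'
      obtain ⟨s, hs⟩ := this
      refine ⟨2 * s, ?_⟩
      simpa using hs) ⟨0, by simp⟩ (by
      intro a ha b hb
      have hb' : |b / 2| ≤ |κ| := by
        rw [abs_le]; constructor <;> linarith [hb.1, hb.2]
      have h1 : ‖(x + (a / 2) • e) - (x + w + ((a + b) / 2) • e)‖ ≤ δ := by
        refine le_trans (le_of_sq_le_sq ?_ (norm_nonneg _)) hxy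
        have e1 : (x + (a / 2) • e) - (x + w + ((a + b) / 2) • e) = -(w + (b / 2) • e) := by
          rw [add_div, add_smul]; abel
        have e2 : x - y = -(w + κ • e) := by rw [hy]; abel
        rw [e1, e2, norm_neg, norm_neg, hnorm, hnorm, ← sq_abs (b / 2), ← sq_abs κ]
        gcongr
      have h2 := h _ _ h1
      have h3 : r < f (x + (a / 2) • e) := ha
      change r - η < g (x + w + ((a + b) / 2) • e)
      linarith)
  have hA2 : volume {s : ℝ | s / 2 ∈ {s : ℝ | r < f (x + s • e)}} = 2 * fiberLength e f x r := by
    have := Measure.addHaar_preimage_smul (volume : Measure ℝ) (r := (1 / 2 : ℝ)) (by norm_num)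
      {s : ℝ | r < f (x + s • e)}
    simp only [Module.finrank_self] at this
    rw [fiberLength]
    convert this using 2
    · ext x; simp [div_eq_inv_mul]
    · norm_num
  have hB2 : volume (Set.Icc (-(2 * |κ|)) (2 * |κ|)) = 2 * ENNReal.ofReal (2 * |κ|) := by
    rw [Real.volume_Icc, show (2 : ℝ≥0∞) = ENNReal.ofReal 2 by simp,
      ← ENNReal.ofReal_mul (by norm_num)]
    congr 1; ring
  rw [hA2, hB2, ← mul_add, ENNReal.mul_le_mul_iff_right (by simp) (by simp), ← hfib] at key
  refine lt_of_lt_of_le ?_ key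
  have h4 : |⟪y, e⟫| ≤ |⟪x, e⟫| + |κ| := by
    have : ⟪y, e⟫ = ⟪x, e⟫ + κ := by rw [hκ, inner_sub_left]; ring
    rw [this]
    exact abs_add_le _ _
  calc ENNReal.ofReal (2 * |⟪y, e⟫|) ≤
        ENNReal.ofReal (2 * |⟪x, e⟫|) + ENNReal.ofReal (2 * |κ|) := by
        rw [← ENNReal.ofReal_add (by positivity) (by positivity)]
        exact ENNReal.ofReal_le_ofReal (by linarith)
    _ < _ := ENNReal.add_lt_add_right ENNReal.ofReal_ne_top hr

theorem abs_steiner_sub_le (he : ‖e‖ = 1) (hf : Continuous f) (hg : Continuous g) {M M' η : ℝ}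
    (hM : ∀ x, f x ≤ M) (hM' : ∀ x, g x ≤ M') (hη : 0 ≤ η) (h : ∀ x, |f x - g x| ≤ η)
    (x : EuclideanSpace ℝ (Fin n)) : |steiner e f x - steiner e g x| ≤ η := by
  have eq : ∀ x y : EuclideanSpace ℝ (Fin n), ‖x - y‖ ≤ 0 → x = y := fun x y hxy =>
    sub_eq_zero.1 (norm_le_zero_iff.1 hxy)
  have h1 := steiner_le_add he hf hM hM' hη (δ := 0) (fun x y hxy => by
    rw [eq x y hxy]; linarith [(abs_le.1 (h y)).2]) x x (by simp)
  have h2 := steiner_le_add he hg hM' hM hη (δ := 0) (fun x y hxy => by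
    rw [eq x y hxy]; linarith [(abs_le.1 (h y)).1]) x x (by simp)
  rw [abs_le]
  constructor <;> linarith

theorem IsDensity.exists_bound (hf : IsDensity f) : ∃ M, 0 ≤ M ∧ ∀ x, f x ≤ M := by
  obtain ⟨M, hM⟩ := hf.hasCompactSupport.exists_bound_of_continuous hf.continuous
  exact ⟨M, (norm_nonneg _).trans (hM 0), fun x => (le_abs_self _).trans (hM x)⟩

theorem IsDensity.exists_radius (hf : IsDensity f) : ∃ R, 0 ≤ R ∧ ∀ x, R < ‖x‖ → f x = 0 := by
  obtain ⟨R, hR⟩ := hf.hasCompactSupport.isCompact.isBounded.subset_closedBall 0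
  refine ⟨max R 0, le_max_right _ _, fun x hx => ?_⟩
  by_contra hc
  have := hR (subset_tsupport f (Function.mem_support.2 hc))
  rw [mem_closedBall_zero_iff] at this
  exact absurd (this.trans (le_max_left _ _)) (not_le.2 hx)

theorem hasCompactSupport_of_eq_zero {R : ℝ} (h : ∀ x, R < ‖x‖ → f x = 0) :
    HasCompactSupport f :=
  HasCompactSupport.intro (isCompact_closedBall 0 R) fun x hx => h x (by simpa using hx)

theorem IsDensity.steiner (hf : IsDensity f) (he : ‖e‖ = 1) : IsDensity (steiner e f) := by
  obtain ⟨M, hM0, hM⟩ := hf.exists_bound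
  obtain ⟨R, hR0, hR⟩ := hf.exists_radius
  refine ⟨?_, steiner_nonneg, hasCompactSupport_of_eq_zero (steiner_eq_zero he hM hR hR0)⟩
  have huc := hf.hasCompactSupport.uniformContinuous_of_continuous hf.continuous
  refine UniformContinuous.continuous ?_
  rw [Metric.uniformContinuous_iff] at huc ⊢
  intro ε hε
  obtain ⟨δ, hδ, h⟩ := huc (ε / 2) (by positivity)
  refine ⟨δ / 2, by positivity, fun {x y} hxy => ?_⟩
  have key := steiner_le_add he hf.continuous hM hM (η := ε / 2) (δ := δ / 2)
    (by positivity) (fun x y hxy => by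
      have := h (show dist x y < δ by rw [dist_eq_norm]; linarith)
      rw [Real.dist_eq, abs_lt] at this
      linarith [this.2])
  rw [dist_eq_norm] at hxy
  have k1 := key x y hxy.le
  have k2 := key y x (by rw [norm_sub_rev]; exact hxy.le)
  rw [Real.dist_eq, abs_lt]
  constructor <;> linarith

end

section
variable {n : ℕ} {f : EuclideanSpace ℝ (Fin n) → ℝ} {e : EuclideanSpace ℝ (Fin n)}

theorem IsDensity.exists_fiberLength_eq (hf : IsDensity f) (he : ‖e‖ = 1)
    (x : EuclideanSpace ℝ (Fin n)) {r : ℝ} (hr : 0 ≤ r) :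
    ∃ l, 0 ≤ l ∧ fiberLength e f x r = ENNReal.ofReal (2 * l) := by
  obtain ⟨R, hR0, hR⟩ := hf.exists_radius
  have hfin : fiberLength e f x r ≠ ⊤ := by
    have hsub : {s : ℝ | r < f (x + s • e)} ⊆ Set.Icc (-(R + ‖x‖)) (R + ‖x‖) := by
      intro s hs
      have h1 : ‖x + s • e‖ ≤ R := by
        by_contra h
        have := hR _ (not_le.1 h)
        simp only [Set.mem_ofPred_eq, this] at hs
        linarith
      have h2 : ‖s • e‖ ≤ ‖x + s • e‖ + ‖x‖ := by
        have := norm_sub_le (x + s • e) x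
        simpa using this
      rw [norm_smul, he, mul_one, Real.norm_eq_abs] at h2
      exact abs_le.1 (by linarith)
    exact ((measure_mono hsub).trans_lt (by rw [Real.volume_Icc]; exact ENNReal.ofReal_lt_top)).ne
  refine ⟨(fiberLength e f x r).toReal / 2, by positivity, ?_⟩
  rw [mul_div_cancel₀ _ two_ne_zero, ENNReal.ofReal_toReal hfin]

theorem IsDensity.setOf_lt_steiner (hf : IsDensity f) (he : ‖e‖ = 1)
    {x : EuclideanSpace ℝ (Fin n)} (hx : ⟪x, e⟫ = 0) {r l : ℝ} (hr : 0 ≤ r)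
    (h : fiberLength e f x r = ENNReal.ofReal (2 * l)) :
    {s : ℝ | r < _root_.steiner e f (x + s • e)} = Set.Ioo (-l) l := by
  obtain ⟨M, hM0, hM⟩ := hf.exists_bound
  ext s
  simp only [Set.mem_ofPred_eq, Set.mem_Ioo]
  rw [lt_steiner_iff hM hr, fiberLength_add_smul, h, inner_add_left, hx, inner_smul_left,
    real_inner_self_eq_norm_sq, he, ENNReal.ofReal_lt_ofReal_iff_of_nonneg (by positivity)]
  simp [abs_lt]

end

section
variable {m : ℕ} {e : EuclideanSpace ℝ (Fin (m + 1))}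
  {L : (Fin m → ℝ) →L[ℝ] EuclideanSpace ℝ (Fin (m + 1))}
  {f : EuclideanSpace ℝ (Fin (m + 1)) → ℝ} {p : ℝ}

theorem lintegral_eq_lintegral_lines
    (hmp : MeasurePreserving (fun q : ℝ × (Fin m → ℝ) => q.1 • e + L q.2))
    {F : EuclideanSpace ℝ (Fin (m + 1)) → ℝ≥0∞} (hF : Measurable F) :
    ∫⁻ x, F x = ∫⁻ v : Fin m → ℝ, ∫⁻ s : ℝ, F (L v + s • e) := by
  rw [← hmp.lintegral_comp hF, Measure.volume_eq_prod]
  refine (lintegral_prod_symm _ (hF.comp hmp.measurable).aemeasurable).trans ?_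
  simp only [Function.comp_apply, add_comm]

theorem setLIntegral_eq_lintegral_lines
    (hmp : MeasurePreserving (fun q : ℝ × (Fin m → ℝ) => q.1 • e + L q.2))
    {F : EuclideanSpace ℝ (Fin (m + 1)) → ℝ≥0∞} (hF : Measurable F)
    {A : Set (EuclideanSpace ℝ (Fin (m + 1)))} (hA : MeasurableSet A) :
    ∫⁻ x in A, F x = ∫⁻ v : Fin m → ℝ, ∫⁻ s in {s : ℝ | L v + s • e ∈ A}, F (L v + s • e) := by
  rw [← lintegral_indicator hA, lintegral_eq_lintegral_lines hmp (hF.indicator hA)]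
  refine lintegral_congr fun v => ?_
  have : MeasurableSet {s : ℝ | L v + s • e ∈ A} :=
    hA.preimage (show Measurable fun s : ℝ => L v + s • e by fun_prop)
  rw [← lintegral_indicator this]
  rfl

theorem IsDensity.volume_lt_steiner (hf : IsDensity f) (he : ‖e‖ = 1) {r : ℝ} (hr : 0 ≤ r) :
    volume {x | r < _root_.steiner e f x} = volume {x | r < f x} := by
  obtain ⟨L, hL, hmp⟩ := exists_line_coordinates e he
  have h1 : MeasurableSet {x | r < f x} := measurableSet_lt measurable_const hf.continuous.measurable
  have h2 : MeasurableSet {x | r < _root_.steiner e f x} :=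
    measurableSet_lt measurable_const (hf.steiner he).continuous.measurable
  rw [← setLIntegral_one, ← setLIntegral_one,
    setLIntegral_eq_lintegral_lines hmp measurable_const h1,
    setLIntegral_eq_lintegral_lines hmp measurable_const h2]
  refine lintegral_congr fun v => ?_
  obtain ⟨l, hl, h⟩ := hf.exists_fiberLength_eq he (L v) hr
  have := hf.setOf_lt_steiner he (hL v) hr h
  simp only [Set.mem_ofPred_eq, setLIntegral_one]
  rw [this, Real.volume_Ioo]
  exact (h.trans (by ring_nf)).symm

theorem lintegral_ofReal_mul_eq {w : EuclideanSpace ℝ (Fin (m + 1)) → ℝ≥0∞} (hw : Measurable w)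
    (hf : IsDensity f) :
    ∫⁻ x, ENNReal.ofReal (f x) * w x = ∫⁻ r in Set.Ioi (0 : ℝ), ∫⁻ x in {x | r < f x}, w x := by
  have h := lintegral_eq_lintegral_meas_lt (volume.withDensity w) (f := f)
    (.of_forall hf.nonneg) hf.continuous.measurable.aemeasurable
  have hm : Measurable fun x => ENNReal.ofReal (f x) :=
    ENNReal.measurable_ofReal.comp hf.continuous.measurable
  rw [lintegral_withDensity_eq_lintegral_mul _ hw hm] at h
  calc _ = ∫⁻ x, (w * fun x => ENNReal.ofReal (f x)) x :=
        lintegral_congr fun x => mul_comm _ _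
    _ = _ := h
    _ = _ := lintegral_congr fun r => withDensity_apply _
        (measurableSet_lt measurable_const hf.continuous.measurable)

theorem ofReal_posMoment_eq_lines (hp : 1 ≤ p) (hf : IsDensity f)
    (hmp : MeasurePreserving (fun q : ℝ × (Fin m → ℝ) => q.1 • e + L q.2))
    (y : EuclideanSpace ℝ (Fin (m + 1))) :
    ENNReal.ofReal (posMoment p f y) = ∫⁻ r in Set.Ioi (0 : ℝ), ∫⁻ v : Fin m → ℝ,
      ∫⁻ s in {s : ℝ | r < f (L v + s • e)},
        ENNReal.ofReal (max ⟪L v + s • e, y⟫ 0 ^ p) := by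
  have hw : Measurable fun x : EuclideanSpace ℝ (Fin (m + 1)) =>
      ENNReal.ofReal (max ⟪x, y⟫ 0 ^ p) := by fun_prop
  rw [ofReal_posMoment hp hf, lintegral_ofReal_mul_eq hw hf]
  exact lintegral_congr fun r => setLIntegral_eq_lintegral_lines hmp hw
    (measurableSet_lt measurable_const hf.continuous.measurable)

theorem posMoment_steiner_le (hp : 1 ≤ p) (hf : IsDensity f) (he : ‖e‖ = 1)
    (hL : ∀ v, ⟪L v, e⟫ = 0)
    (hmp : MeasurePreserving (fun q : ℝ × (Fin m → ℝ) => q.1 • e + L q.2)) (z w : Fin m → ℝ)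
    {a b : ℝ} (ha : 0 < a) (hb : 0 < b) (hfa : posMoment p f (L z + e) ≤ a ^ p)
    (hfb : posMoment p f (L w - e) ≤ b ^ p) :
    posMoment p (steiner e f) (L ((1 / 2 : ℝ) • (z + w)) + e) ≤ ((a + b) / 2) ^ p := by
  set y := L ((1 / 2 : ℝ) • (z + w)) + e with hy
  have scaled : ∀ {h : EuclideanSpace ℝ (Fin (m + 1)) → ℝ} {c : ℝ} {u}, 0 < c →
      (posMoment p h (c⁻¹ • u) ≤ 1 ↔ posMoment p h u ≤ c ^ p) := by
    intro h c u hc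
    rw [posMoment_smul (by positivity), inv_rpow hc.le, inv_mul_le_iff₀ (by positivity), mul_one]
  rw [← scaled (by positivity), ← ENNReal.ofReal_le_one,
    ofReal_posMoment_eq_lines hp (hf.steiner he) hmp]
  rw [← scaled ha, ← ENNReal.ofReal_le_one, ofReal_posMoment_eq_lines hp hf hmp] at hfa
  rw [← scaled hb, ← ENNReal.ofReal_le_one, ofReal_posMoment_eq_lines hp hf hmp] at hfb
  have hmeas : ∀ u : EuclideanSpace ℝ (Fin (m + 1)), Measurable fun q : ℝ × (Fin m → ℝ) =>
      ∫⁻ s in {s : ℝ | q.1 < f (L q.2 + s • e)},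
        ENNReal.ofReal (max ⟪L q.2 + s • e, u⟫ 0 ^ p) := by
    intro u
    have hS : MeasurableSet {t : (ℝ × (Fin m → ℝ)) × ℝ | t.1.1 < f (L t.1.2 + t.2 • e)} :=
      measurableSet_lt (by fun_prop) (hf.continuous.measurable.comp (by fun_prop))
    have : Measurable ({t : (ℝ × (Fin m → ℝ)) × ℝ | t.1.1 < f (L t.1.2 + t.2 • e)}.indicator
        fun t => ENNReal.ofReal (max ⟪L t.1.2 + t.2 • e, u⟫ 0 ^ p)) :=
      Measurable.indicator (by fun_prop) hS
    convert this.lintegral_prod_right' (ν := volume) using 2 with q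
    rw [← lintegral_indicator]
    · rfl
    · exact measurableSet_lt measurable_const (hf.continuous.measurable.comp (by fun_prop))
  have ta : 0 ≤ a / (a + b) := by positivity
  have tb : 0 ≤ b / (a + b) := by positivity
  have key : ∀ r ∈ Set.Ioi (0 : ℝ), ∀ v : Fin m → ℝ,
      ∫⁻ s in {s : ℝ | r < steiner e f (L v + s • e)},
        ENNReal.ofReal (max ⟪L v + s • e, ((a + b) / 2)⁻¹ • y⟫ 0 ^ p) ≤
      ENNReal.ofReal (a / (a + b)) * (∫⁻ s in {s : ℝ | r < f (L v + s • e)},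
        ENNReal.ofReal (max ⟪L v + s • e, a⁻¹ • (L z + e)⟫ 0 ^ p)) +
      ENNReal.ofReal (b / (a + b)) * (∫⁻ s in {s : ℝ | r < f (L v + s • e)},
        ENNReal.ofReal (max ⟪L v + s • e, b⁻¹ • (L w - e)⟫ 0 ^ p)) := by
    intro r hr v
    have hr : 0 < r := hr
    obtain ⟨l, hl, h⟩ := hf.exists_fiberLength_eq he (L v) hr.le
    rw [hf.setOf_lt_steiner he (hL v) hr.le h]
    have key := setLIntegral_Ioo_max_rpow_le hp (A := {s : ℝ | r < f (L v + s • e)})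
      (measurableSet_lt measurable_const (hf.continuous.measurable.comp (by fun_prop))) h ha hb
      (α := ⟪L v, L z⟫) (β := ⟪L v, L w⟫)
    have hee : ⟪e, e⟫ = 1 := by rw [real_inner_self_eq_norm_sq, he]; norm_num
    have heL : ∀ v, ⟪e, L v⟫ = 0 := fun v => by rw [real_inner_comm]; exact hL v
    convert key using 6 with s s s
    · simp only [hy, inner_add_left, inner_add_right, inner_smul_left, inner_smul_right, map_smul,
        map_add, hee, heL, hL]
      simp; field_simp; ring
    · congr 1
      simp only [inner_add_left, inner_add_right, inner_smul_left, inner_smul_right, hee, heL, hL]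
      simp; field_simp; ring_nf
    · simp only [inner_add_left, inner_sub_right, inner_smul_left, inner_smul_right, hee, heL, hL]
      simp; field_simp
  refine (setLIntegral_mono' measurableSet_Ioi fun r hr => lintegral_mono (key r hr)).trans ?_
  have e1 : ∀ r, ∫⁻ v : Fin m → ℝ,
      (ENNReal.ofReal (a / (a + b)) * (∫⁻ s in {s : ℝ | r < f (L v + s • e)},
        ENNReal.ofReal (max ⟪L v + s • e, a⁻¹ • (L z + e)⟫ 0 ^ p)) +
      ENNReal.ofReal (b / (a + b)) * (∫⁻ s in {s : ℝ | r < f (L v + s • e)},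
        ENNReal.ofReal (max ⟪L v + s • e, b⁻¹ • (L w - e)⟫ 0 ^ p))) =
      ENNReal.ofReal (a / (a + b)) * (∫⁻ v : Fin m → ℝ, ∫⁻ s in {s : ℝ | r < f (L v + s • e)},
        ENNReal.ofReal (max ⟪L v + s • e, a⁻¹ • (L z + e)⟫ 0 ^ p)) +
      ENNReal.ofReal (b / (a + b)) * (∫⁻ v : Fin m → ℝ, ∫⁻ s in {s : ℝ | r < f (L v + s • e)},
        ENNReal.ofReal (max ⟪L v + s • e, b⁻¹ • (L w - e)⟫ 0 ^ p)) := by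
    intro r
    have m1 : Measurable fun v => _ :=
      (hmeas (a⁻¹ • (L z + e))).comp (measurable_prodMk_left (x := r))
    have m2 : Measurable fun v => _ :=
      (hmeas (b⁻¹ • (L w - e))).comp (measurable_prodMk_left (x := r))
    simp only [Function.comp_apply] at m1 m2
    rw [lintegral_add_left (m1.const_mul _), lintegral_const_mul _ m1, lintegral_const_mul _ m2]
  simp only [e1]
  have m1 := (hmeas (a⁻¹ • (L z + e))).lintegral_prod_right' (ν := volume)
  have m2 := (hmeas (b⁻¹ • (L w - e))).lintegral_prod_right' (ν := volume)
  simp only at m1 m2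
  rw [lintegral_add_left (m1.const_mul _), lintegral_const_mul _ m1, lintegral_const_mul _ m2]
  calc _ ≤ ENNReal.ofReal (a / (a + b)) * 1 + ENNReal.ofReal (b / (a + b)) * 1 := by gcongr
    _ = 1 := by
      rw [mul_one, mul_one, ← ENNReal.ofReal_add ta tb, ← add_div, div_self (by positivity)]
      simp

theorem halfPolarVolume_le_steiner_or (hp : 1 ≤ p) (hf : IsDensity f) (he : ‖e‖ = 1) :
    halfPolarVolume p f e ≤ halfPolarVolume p (steiner e f) e ∨
      halfPolarVolume p f (-e) ≤ halfPolarVolume p (steiner e f) e := by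
  obtain ⟨L, hL, hmp⟩ := exists_line_coordinates e he
  have hp0 : 0 < p := by linarith
  let N : (EuclideanSpace ℝ (Fin (m + 1)) → ℝ) → EuclideanSpace ℝ (Fin (m + 1)) → ℝ≥0∞ :=
    fun h y => ENNReal.ofReal (posMoment p h y ^ (1 / p))
  have hN : ∀ h, IsDensity h → Measurable (N h) := fun h hh => by
    have := (continuous_posMoment hp hh).measurable
    fun_prop
  have hom : ∀ h, IsDensity h → ∀ (c : ℝ) y, 0 < c → N h (c • y) = ENNReal.ofReal c * N h y := by
    intro h hh c y hc
    simp only [N]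
    rw [posMoment_smul hc.le, mul_rpow (by positivity) (posMoment_nonneg hh.nonneg y),
      ← rpow_mul hc.le, mul_one_div_cancel hp0.ne', rpow_one, ENNReal.ofReal_mul hc.le]
  have one : ∀ h, IsDensity h → ∀ y, N h y ≤ 1 ↔ posMoment p h y ≤ 1 := by
    intro h hh y
    simp only [N]
    have h0 := posMoment_nonneg (p := p) hh.nonneg y
    rw [ENNReal.ofReal_le_one]
    refine ⟨fun h => ?_, fun h => rpow_le_one h0 h (by positivity)⟩
    have := rpow_le_one (by positivity) h hp0.le
    rwa [← rpow_mul h0, one_div_mul_cancel hp0.ne', rpow_one] at this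
  have half : ∀ h, IsDensity h → halfPolarVolume p h e =
      ((m : ℝ≥0∞) + 1)⁻¹ * ∫⁻ z, N h (L z + e) ^ (-((m : ℝ) + 1)) := by
    intro h hh
    rw [← volume_homogeneous_halfspace he hL hmp (hN h hh) (hom h hh), halfPolarVolume]
    simp only [one h hh]
  have half' : ∀ h, IsDensity h → halfPolarVolume p h (-e) =
      ((m : ℝ≥0∞) + 1)⁻¹ * ∫⁻ z, N h (L z - e) ^ (-((m : ℝ) + 1)) := by
    intro h hh
    rw [← volume_homogeneous_halfspace_neg he hL hmp (hN h hh) (hom h hh), halfPolarVolume]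
    simp only [one h hh, inner_neg_right, Left.neg_pos_iff]
  have hS := hf.steiner he
  rw [half f hf, half' f hf, half _ hS]
  have key := min_lintegral_rpow_neg_le m (N₁ := fun z => N f (L z + e))
    (N₂ := fun z => N f (L z - e)) (N := fun z => N (steiner e f) (L z + e))
    ((hN f hf).comp (show Measurable fun z => L z + e by fun_prop))
    ((hN f hf).comp (show Measurable fun z => L z - e by fun_prop))
    ((hN _ hS).comp (show Measurable fun z => L z + e by fun_prop)) (by
      intro z w
      simp only [N]
      have n1 := posMoment_nonneg (p := p) hf.nonneg (L z + e)
      have n2 := posMoment_nonneg (p := p) hf.nonneg (L w - e)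
      have two : ∀ t : ℝ, ENNReal.ofReal t / 2 = ENNReal.ofReal (t / 2) := fun t => by
        rw [ENNReal.ofReal_div_of_pos two_pos, ENNReal.ofReal_ofNat]
      rw [← ENNReal.ofReal_add (by positivity) (by positivity), two]
      refine ENNReal.ofReal_le_ofReal (le_of_forall_pos_le_add fun δ hδ => ?_)
      have up : ∀ {c : ℝ}, 0 ≤ c → c ≤ (c ^ (1 / p) + δ) ^ p := by
        intro c hc
        calc c = (c ^ (1 / p)) ^ p := by
              rw [← rpow_mul hc, one_div_mul_cancel hp0.ne', rpow_one]
          _ ≤ _ := by gcongr; linarith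
      have := posMoment_steiner_le hp hf he hL hmp z w (add_pos_of_nonneg_of_pos
        (by positivity) hδ) (add_pos_of_nonneg_of_pos (by positivity) hδ) (up n1) (up n2)
      have := rpow_le_rpow (posMoment_nonneg hS.nonneg _) this (show 0 ≤ 1 / p by positivity)
      rw [← rpow_mul (by positivity), mul_one_div_cancel hp0.ne', rpow_one] at this
      linarith)
  rcases key with h | h
  · left; gcongr
  · right; gcongr

end

section
variable {n : ℕ} {f : EuclideanSpace ℝ (Fin n) → ℝ} {e : EuclideanSpace ℝ (Fin n)} {p : ℝ}

theorem fiberLength_neg_of_even (hf : ∀ x, f (-x) = f x) (x : EuclideanSpace ℝ (Fin n)) (r : ℝ) :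
    fiberLength e f (-x) r = fiberLength e f x r := by
  rw [fiberLength, fiberLength, ← Measure.measure_preimage_neg]
  congr 1
  ext s
  simp only [Set.mem_preimage, Set.mem_ofPred_eq]
  rw [← hf]
  simp [add_comm]

theorem steiner_neg_of_even (hf : ∀ x, f (-x) = f x) (x : EuclideanSpace ℝ (Fin n)) :
    steiner e f (-x) = steiner e f x := by
  simp only [steiner, fiberLength_neg_of_even hf, inner_neg_left, abs_neg]

theorem steiner_comp_sub_smul (a : ℝ) (x : EuclideanSpace ℝ (Fin n)) :
    steiner e (fun x => f (x - a • e)) x = steiner e f x := by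
  have h : ∀ r, fiberLength e (fun x => f (x - a • e)) x r = fiberLength e f x r := by
    intro r
    rw [← fiberLength_add_smul (f := f) x (-a) r, fiberLength, fiberLength]
    congr 1
    ext s
    simp only [Set.mem_ofPred_eq]
    rw [show x + s • e - a • e = x + -a • e + s • e by module]
  simp only [steiner, h]

theorem steiner_comp_sub_of_inner_eq_zero {v : EuclideanSpace ℝ (Fin n)} (hv : ⟪v, e⟫ = 0) :
    steiner e (fun x => f (x - v)) = fun x => steiner e f (x - v) := by
  funext x
  have h : ∀ r, fiberLength e (fun x => f (x - v)) x r = fiberLength e f (x - v) r := by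
    intro r
    simp only [fiberLength, add_sub_right_comm]
  simp only [steiner, h, inner_sub_left, hv, sub_zero]

theorem steiner_sub_two_smul (he : ‖e‖ = 1) (x : EuclideanSpace ℝ (Fin n)) :
    steiner e f (x - (2 * ⟪x, e⟫) • e) = steiner e f x := by
  have h : |⟪x - (2 * ⟪x, e⟫) • e, e⟫| = |⟪x, e⟫| := by
    rw [inner_sub_left, inner_smul_left, real_inner_self_eq_norm_sq, he, ← abs_neg]
    congr 1
    simp
    ring
  simp only [steiner, h]
  simp only [sub_eq_add_neg, ← neg_smul, fiberLength_add_smul]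

theorem posMoment_comp_isometry (U : EuclideanSpace ℝ (Fin n) ≃ₗᵢ[ℝ] EuclideanSpace ℝ (Fin n))
    (hU : ∀ x, f (U x) = f x) (y : EuclideanSpace ℝ (Fin n)) :
    posMoment p f (U y) = posMoment p f y := by
  rw [posMoment, ← U.measurePreserving.integral_comp U.toHomeomorph.measurableEmbedding]
  simp only [hU, LinearIsometryEquiv.inner_map_map, posMoment]

theorem reflection_orthogonal_singleton_apply (he : ‖e‖ = 1) (x : EuclideanSpace ℝ (Fin n)) :
    (ℝ ∙ e)ᗮ.reflection x = x - (2 * ⟪x, e⟫) • e := by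
  rw [Submodule.reflection_orthogonal_apply, Submodule.reflection_singleton_apply, he,
    real_inner_comm]
  simp
  module

theorem halfPolarVolume_steiner_neg (he : ‖e‖ = 1) :
    halfPolarVolume p (steiner e f) (-e) = halfPolarVolume p (steiner e f) e := by
  let U := (ℝ ∙ e)ᗮ.reflection
  have hU : ∀ x, U x = x - (2 * ⟪x, e⟫) • e := reflection_orthogonal_singleton_apply he
  rw [halfPolarVolume, halfPolarVolume,
    ← U.measurePreserving.measure_preimage_emb U.toHomeomorph.measurableEmbedding]
  congr 1
  ext y
  simp only [Set.mem_preimage, Set.mem_ofPred_eq]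
  rw [posMoment_comp_isometry U (fun x => by rw [hU, steiner_sub_two_smul he]), hU,
    inner_neg_right, inner_sub_left, inner_smul_left,
    real_inner_self_eq_norm_sq, he]
  simp only [map_mul, conj_trivial, one_pow, mul_one]
  rw [show -(⟪y, e⟫ - 2 * ⟪y, e⟫) = ⟪y, e⟫ by ring]

theorem isOpen_lt_halfPolarVolume (hp : 1 ≤ p) (hf : IsDensity f) (S : ℝ≥0∞) :
    IsOpen {c : EuclideanSpace ℝ (Fin n) | S < halfPolarVolume p (fun x => f (x - c)) e} := by
  rw [isOpen_iff_mem_nhds]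
  intro c hc
  simp only [Set.mem_ofPred_eq] at hc
  have hcont := continuous_posMoment_comp_sub hp hf
  set Φ := fun y => posMoment p (fun x => f (x - c)) y with hΦ
  have hΦc : Continuous Φ := continuous_posMoment hp (hf.comp_sub c)
  set W : Set (EuclideanSpace ℝ (Fin n)) := {y | Φ y < 1 ∧ 0 < ⟪y, e⟫} with hW
  have hWo : IsOpen W := (isOpen_lt hΦc continuous_const).inter
    (isOpen_lt continuous_const (show Continuous fun y => ⟪y, e⟫ by fun_prop))
  have hlt : S < volume W := by
    have htend : Filter.Tendsto (fun t : ℝ => ENNReal.ofReal (t ^ n) *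
        halfPolarVolume p (fun x => f (x - c)) e) (nhdsWithin 1 (Set.Iio 1))
        (nhds (ENNReal.ofReal (1 ^ n) * halfPolarVolume p (fun x => f (x - c)) e)) := by
      refine ENNReal.Tendsto.mul_const ?_ (Or.inl (by simp))
      exact ((ENNReal.continuous_ofReal.comp (continuous_pow n)).tendsto 1).mono_left
        nhdsWithin_le_nhds
    rw [one_pow, ENNReal.ofReal_one, one_mul] at htend
    have h01 : ∀ᶠ t : ℝ in nhdsWithin 1 (Set.Iio 1), t ∈ Set.Ioo (0 : ℝ) 1 :=
      Ioo_mem_nhdsLT one_pos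
    obtain ⟨t, ht, ht0, ht1⟩ := ((htend.eventually (lt_mem_nhds hc)).and h01).exists
    refine ht.trans_le ?_
    have := Measure.addHaar_smul (volume : Measure (EuclideanSpace ℝ (Fin n))) t
      {y | posMoment p (fun x => f (x - c)) y ≤ 1 ∧ 0 < ⟪y, e⟫}
    rw [finrank_euclideanSpace_fin, abs_of_pos (by positivity)] at this
    rw [halfPolarVolume, ← this]
    refine measure_mono ?_
    rintro _ ⟨y, ⟨hy1, hy2⟩, rfl⟩
    refine ⟨?_, ?_⟩
    · simp only [hΦ]
      rw [posMoment_smul ht0.le]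
      have h1 : t ^ p < 1 := rpow_lt_one ht0.le ht1 (by linarith)
      have h2 : 0 ≤ t ^ p := by positivity
      nlinarith
    · simp only [inner_smul_left]
      exact mul_pos ht0 hy2
  obtain ⟨K, hKW, hK, hSK⟩ := hWo.exists_lt_isCompact hlt
  have hev : ∀ᶠ c' in nhds c, ∀ y ∈ K, posMoment p (fun x => f (x - c')) y < 1 := by
    refine hK.eventually_forall_of_forall_eventually fun y hy => ?_
    exact hcont.continuousAt.eventually (gt_mem_nhds (hKW hy).1)
  filter_upwards [hev] with c' hc'
  exact hSK.trans_le (measure_mono fun y hy => ⟨(hc' y hy).le, (hKW hy).2⟩)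

theorem exists_halfPolarVolume_eq_top (hf : IsDensity f) (he : ‖e‖ = 1) (hn : n ≠ 0)
    (hp : 1 ≤ p) : ∃ a : ℝ, halfPolarVolume p (fun x => f (x - a • e)) e = ⊤ := by
  obtain ⟨R, hR0, hR⟩ := hf.exists_radius
  refine ⟨-(3 * R), ?_⟩
  have hball : ∀ t : ℝ, 0 < t → Metric.ball (t • e) (t / 2) ⊆
      {y | posMoment p (fun x => f (x - (-(3 * R)) • e)) y ≤ 1 ∧ 0 < ⟪y, e⟫} := by
    intro t ht y hy
    rw [mem_ball_iff_norm] at hy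
    have hye : t / 2 ≤ ⟪y, e⟫ := by
      have h1 := abs_real_inner_le_norm (y - t • e) e
      rw [he, mul_one, inner_sub_left, inner_smul_left, real_inner_self_eq_norm_sq, he] at h1
      simp only [conj_trivial, one_pow, mul_one] at h1
      linarith [(abs_le.1 h1).1]
    have hyn : ‖y‖ ≤ 3 * t / 2 := by
      have h1 := norm_add_le (y - t • e) (t • e)
      rw [sub_add_cancel, norm_smul, he, mul_one, norm_of_nonneg ht.le] at h1
      linarith
    refine ⟨?_, by linarith⟩
    rw [posMoment_comp_sub]
    refine le_of_eq_of_le ?_ zero_le_one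
    refine integral_eq_zero_of_ae (.of_forall fun x => ?_)
    by_cases hx : R < ‖x‖
    · simp [hR x hx]
    have h1 := (real_inner_le_norm x y).trans
      (mul_le_mul (not_lt.1 hx) hyn (norm_nonneg _) hR0)
    have h2 : ⟪x + (-(3 * R)) • e, y⟫ ≤ 0 := by
      rw [inner_add_left, inner_smul_left, real_inner_comm]
      simp only [conj_trivial]
      rw [real_inner_comm] at h1
      rw [real_inner_comm y e]
      nlinarith
    simp only [Pi.zero_apply]
    rw [max_eq_right h2, zero_rpow (by linarith), mul_zero]
  have hNe : Nonempty (Fin n) := ⟨⟨0, Nat.pos_of_ne_zero hn⟩⟩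
  by_contra hfin
  have hc0 : (volume (Metric.ball (0 : EuclideanSpace ℝ (Fin n)) 1)).toReal ≠ 0 :=
    (ENNReal.toReal_pos (Metric.measure_ball_pos _ _ one_pos).ne' measure_ball_lt_top.ne).ne'
  set c := (volume (Metric.ball (0 : EuclideanSpace ℝ (Fin n)) 1)).toReal with hc
  have hcpos : 0 < c := lt_of_le_of_ne ENNReal.toReal_nonneg hc0.symm
  set V := (halfPolarVolume p (fun x => f (x - (-(3 * R)) • e)) e).toReal with hV
  have hle : ∀ u : ℝ, 1 ≤ u → u * c ≤ V := by
    intro u hu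
    have h1 := ENNReal.toReal_mono hfin (measure_mono (μ := volume) (hball (2 * u) (by linarith)))
    rw [mul_div_cancel_left₀ _ two_ne_zero, Measure.addHaar_ball _ _ (by linarith),
      finrank_euclideanSpace_fin, ENNReal.toReal_mul, ENNReal.toReal_ofReal (by positivity)] at h1
    refine le_trans ?_ h1
    gcongr
    exact le_self_pow₀ hu hn
  have hV0 : 0 ≤ V := ENNReal.toReal_nonneg
  have := hle (V / c + 1) (by linarith [div_nonneg hV0 hcpos.le])
  rw [add_mul, div_mul_cancel₀ _ hcpos.ne'] at this
  linarith

end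

section
variable {m : ℕ} {e : EuclideanSpace ℝ (Fin (m + 1))}
  {f : EuclideanSpace ℝ (Fin (m + 1)) → ℝ} {p : ℝ}

theorem exists_polarVolume_le_steiner (hp : 1 ≤ p) (hf : IsDensity f) (he : ‖e‖ = 1) :
    ∃ a : ℝ, polarVolume p (fun x => f (x - a • e)) ≤ polarVolume p (steiner e f) := by
  have he0 : e ≠ 0 := by rintro rfl; simp at he
  set S := halfPolarVolume p (steiner e f) e with hS
  have hV : polarVolume p (steiner e f) = S + S := by
    rw [polarVolume_eq_add hp (hf.steiner he) he0, halfPolarVolume_steiner_neg he]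
  suffices h : ∃ a : ℝ, halfPolarVolume p (fun x => f (x - a • e)) e ≤ S ∧
      halfPolarVolume p (fun x => f (x - a • e)) (-e) ≤ S by
    obtain ⟨a, h1, h2⟩ := h
    refine ⟨a, ?_⟩
    rw [hV, polarVolume_eq_add hp (hf.comp_sub _) he0]
    exact add_le_add h1 h2
  by_contra! hcon
  have hor : ∀ a : ℝ, halfPolarVolume p (fun x => f (x - a • e)) e ≤ S ∨
      halfPolarVolume p (fun x => f (x - a • e)) (-e) ≤ S := by
    intro a
    have := halfPolarVolume_le_steiner_or hp (hf.comp_sub (a • e)) he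
    rwa [show steiner e (fun x => f (x - a • e)) = steiner e f from
      funext (steiner_comp_sub_smul a)] at this
  have hStop : S ≠ ⊤ := fun h => by
    have := hcon 0 (by rw [h]; exact le_top)
    rw [h] at this
    exact not_top_lt this
  have hopen : ∀ v, IsOpen {a : ℝ | S < halfPolarVolume p (fun x => f (x - a • e)) v} := fun v =>
    (isOpen_lt_halfPolarVolume hp hf S (e := v)).preimage
      (show Continuous fun a : ℝ => a • e by fun_prop)
  obtain ⟨a, ha⟩ := exists_halfPolarVolume_eq_top hf he m.succ_ne_zero hp
  obtain ⟨b, hb⟩ := exists_halfPolarVolume_eq_top hf (e := -e) (by rwa [norm_neg])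
    m.succ_ne_zero hp
  have hconn := isPreconnected_univ (α := ℝ) _ _ (hopen e) (hopen (-e))
    (fun x _ => by
      by_contra h
      simp only [Set.mem_union, Set.mem_ofPred_eq, not_or, not_lt] at h
      exact (hcon x h.1).not_ge h.2)
    ⟨a, trivial, by simpa [ha] using hStop.lt_top⟩
    ⟨-b, trivial, by
      simp only [smul_neg, ← neg_smul] at hb
      simp only [Set.mem_ofPred_eq, hb]
      exact hStop.lt_top⟩
  obtain ⟨x, -, h1, h2⟩ := hconn
  rcases hor x with h | h
  · exact h1.not_ge h
  · exact h2.not_ge h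

theorem polarVolume_le_steiner_of_even (hp : 1 ≤ p) (hf : IsDensity f) (he : ‖e‖ = 1)
    (hev : ∀ x, f (-x) = f x) : polarVolume p f ≤ polarVolume p (steiner e f) := by
  have he0 : e ≠ 0 := by rintro rfl; simp at he
  rw [polarVolume_eq_add hp (hf.steiner he) he0, halfPolarVolume_steiner_neg he,
    polarVolume_eq_add hp hf he0, halfPolarVolume_neg_of_even hev]
  have := halfPolarVolume_le_steiner_or hp hf he
  rw [halfPolarVolume_neg_of_even hev, or_self] at this
  gcongr

theorem IsDensity.integral_rpow_steiner (hf : IsDensity f) (he : ‖e‖ = 1) {q : ℝ} (hq : 0 < q) :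
    ∫ x, _root_.steiner e f x ^ q = ∫ x, f x ^ q := by
  have hS := hf.steiner he
  rw [integral_eq_lintegral_of_nonneg_ae
      (.of_forall fun x => rpow_nonneg (hS.nonneg x) q)
      (hS.continuous.rpow_const fun _ => Or.inr hq.le).aestronglyMeasurable,
    integral_eq_lintegral_of_nonneg_ae
      (.of_forall fun x => rpow_nonneg (hf.nonneg x) q)
      (hf.continuous.rpow_const fun _ => Or.inr hq.le).aestronglyMeasurable,
    lintegral_rpow_eq_lintegral_meas_lt_mul _ (.of_forall hS.nonneg)
      hS.continuous.measurable.aemeasurable hq,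
    lintegral_rpow_eq_lintegral_meas_lt_mul _ (.of_forall hf.nonneg)
      hf.continuous.measurable.aemeasurable hq]
  congr 2
  refine setLIntegral_congr_fun measurableSet_Ioi fun r hr => ?_
  beta_reduce
  rw [hf.volume_lt_steiner he (le_of_lt hr)]

theorem IsDensity.integral_steiner (hf : IsDensity f) (he : ‖e‖ = 1) :
    ∫ x, _root_.steiner e f x = ∫ x, f x := by
  simpa using hf.integral_rpow_steiner he one_pos

theorem exists_even_polarVolume_le (hp : 1 ≤ p) (hf : IsDensity f) {q : ℝ} (hq : 0 < q) :
    ∃ h : EuclideanSpace ℝ (Fin (m + 1)) → ℝ, IsDensity h ∧ (∀ x, h (-x) = h x) ∧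
      ∫ x, h x = ∫ x, f x ∧ ∫ x, h x ^ q = ∫ x, f x ^ q ∧
      ∃ c, polarVolume p (fun x => f (x - c)) ≤ polarVolume p h := by
  have main : ∀ s : Finset (Fin (m + 1)), ∃ h : EuclideanSpace ℝ (Fin (m + 1)) → ℝ,
      IsDensity h ∧ (∀ x y : EuclideanSpace ℝ (Fin (m + 1)), (∀ i, |x i| = |y i|) →
        (∀ i, i ∉ s → x i = y i) → h x = h y) ∧
      ∫ x, h x = ∫ x, f x ∧ ∫ x, h x ^ q = ∫ x, f x ^ q ∧
      ∀ v : EuclideanSpace ℝ (Fin (m + 1)), (∀ i ∈ s, v i = 0) →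
        ∃ c, polarVolume p (fun x => f (x - c)) ≤ polarVolume p (fun x => h (x - v)) := by
    intro s
    induction s using Finset.induction_on with
    | empty =>
      refine ⟨f, hf, fun x y _ h => ?_, rfl, rfl, fun v _ => ⟨v, le_rfl⟩⟩
      congr 1
      ext i
      exact h i (by simp)
    | insert k s hk ih =>
      obtain ⟨h, hd, hsym, h1, h2, hc⟩ := ih
      have he : ‖EuclideanSpace.single k (1 : ℝ)‖ = 1 := by simp
      refine ⟨steiner (EuclideanSpace.single k 1) h, hd.steiner he, fun x y hxy hxy' => ?_,
        (hd.integral_steiner he).trans h1, (hd.integral_rpow_steiner he hq).trans h2,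
        fun v hv => ?_⟩
      · have hin : |⟪x, EuclideanSpace.single k (1 : ℝ)⟫| =
            |⟪y, EuclideanSpace.single k (1 : ℝ)⟫| := by
          simpa [EuclideanSpace.inner_single_right] using hxy k
        have hfib : ∀ r, fiberLength (EuclideanSpace.single k 1) h x r =
            fiberLength (EuclideanSpace.single k 1) h y r := by
          intro r
          rw [← fiberLength_add_smul x (-x k), ← fiberLength_add_smul y (-y k),
            fiberLength, fiberLength]
          congr 1
          ext s'
          simp only [Set.mem_ofPred_eq]
          rw [hsym]
          · intro i
            by_cases hi : i = k
            · subst hi; simp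
            · simp [hi, hxy i]
          · intro i his
            by_cases hi : i = k
            · subst hi; simp
            · simp [hi, hxy' i (by simp [hi, his])]
        simp only [steiner, hin, hfib]
      · have hve : ⟪v, EuclideanSpace.single k (1 : ℝ)⟫ = 0 := by
          simp [EuclideanSpace.inner_single_right, hv k (by simp)]
        obtain ⟨a, ha⟩ := exists_polarVolume_le_steiner hp (hd.comp_sub v) he
        obtain ⟨c, hc⟩ := hc (v + a • EuclideanSpace.single k (1 : ℝ)) (by
          intro i hi
          have hik : i ≠ k := fun h => hk (h ▸ hi)
          simp [hik, hv i (by simp [hi])])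
        refine ⟨c, hc.trans ?_⟩
        rw [steiner_comp_sub_of_inner_eq_zero hve] at ha
        simpa only [sub_sub, add_comm v] using ha
  obtain ⟨h, hd, hsym, h1, h2, hc⟩ := main Finset.univ
  refine ⟨h, hd, fun x => hsym _ _ (by simp) (by simp), h1, h2, ?_⟩
  simpa using hc 0 (by simp)

end

theorem setLIntegral_Ioo_add_sq_le {A : Set ℝ} (hA : MeasurableSet A) {l c : ℝ}
    (hl0 : 0 ≤ l) (hl : volume A = ENNReal.ofReal (2 * l)) (hc : 0 ≤ c) :
    (∫⁻ s in Set.Ioo (-l) l, ENNReal.ofReal (c + s ^ 2)) ≤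
        ∫⁻ s in A, ENNReal.ofReal (c + s ^ 2) ∧
      ((∫⁻ s in A, ENNReal.ofReal (c + s ^ 2)) ≤
        (∫⁻ s in Set.Ioo (-l) l, ENNReal.ofReal (c + s ^ 2)) →
          A =ᵐ[volume] Set.Ioo (-l) l) := by
  set I := Set.Ioo (-l) l with hI
  have hIm : MeasurableSet I := measurableSet_Ioo
  have hvI : volume I = ENNReal.ofReal (2 * l) := by rw [hI, Real.volume_Ioo]; ring_nf
  set w : ℝ → ℝ≥0∞ := fun s => ENNReal.ofReal (c + s ^ 2) with hw
  set κ := ENNReal.ofReal (c + l ^ 2) with hκ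
  have hfin : volume (A ∩ I) ≠ ⊤ :=
    (measure_mono Set.inter_subset_right |>.trans_lt (by rw [hvI]; exact ENNReal.ofReal_lt_top)).ne
  have hPQ : volume (A \ I) = volume (I \ A) := by
    have h1 := measure_inter_add_sdiff (μ := volume) A hIm
    have h2 := measure_inter_add_sdiff (μ := volume) I hA
    rw [Set.inter_comm I A, hvI, ← hl, ← h1] at h2
    exact ((ENNReal.add_right_inj hfin).1 h2).symm
  have hAe := lintegral_inter_add_sdiff (μ := volume) w A hIm
  have hIe := lintegral_inter_add_sdiff (μ := volume) w I hA
  rw [Set.inter_comm I A] at hIe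
  have hlt : ∀ s ∈ I \ A, w s < κ := fun s hs => by
    have h1 : s ^ 2 < l ^ 2 := sq_lt_sq' hs.1.1 hs.1.2
    exact (ENNReal.ofReal_lt_ofReal_iff_of_nonneg (by positivity)).2 (by linarith)
  have hQ : (∫⁻ s in I \ A, w s) ≤ κ * volume (I \ A) := by
    rw [← setLIntegral_const]
    exact setLIntegral_mono' (hIm.diff hA) fun s hs => (hlt s hs).le
  have hP : κ * volume (A \ I) ≤ ∫⁻ s in A \ I, w s := by
    rw [← setLIntegral_const]
    refine setLIntegral_mono' (hA.diff hIm) fun s hs => ENNReal.ofReal_le_ofReal ?_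
    have h1 : |l| ≤ |s| := by
      rw [abs_of_nonneg hl0]
      by_contra h
      exact hs.2 (abs_lt.1 (not_le.1 h))
    linarith [sq_le_sq.2 h1]
  refine ⟨?_, fun h => ?_⟩
  · rw [← hAe, ← hIe]
    exact add_le_add_right (hQ.trans (hPQ ▸ hP)) _
  · have hQfin : κ * volume (I \ A) ≠ ⊤ := ENNReal.mul_ne_top ENNReal.ofReal_ne_top
      (measure_mono Set.sdiff_subset |>.trans_lt (by rw [hvI]; exact ENNReal.ofReal_lt_top)).ne
    have hXfin : (∫⁻ s in A ∩ I, w s) ≠ ⊤ := by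
      refine ne_top_of_le_ne_top (ENNReal.mul_ne_top (ENNReal.ofReal_ne_top (r := c + l ^ 2)) hfin)
        ?_
      rw [← setLIntegral_const]
      refine setLIntegral_mono' (hA.inter hIm) fun s hs => ENNReal.ofReal_le_ofReal ?_
      linarith [sq_lt_sq' hs.2.1 hs.2.2]
    rw [← hAe, ← hIe] at h
    have h3 := (ENNReal.add_le_add_iff_left hXfin).1 h
    have hQ0 : volume (I \ A) = 0 := by
      by_contra hne
      have := setLIntegral_strict_mono (hIm.diff hA) hne measurable_const
        (ne_top_of_le_ne_top hQfin hQ) (.of_forall hlt)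
      rw [setLIntegral_const, ← hPQ] at this
      exact (this.trans_le hP).not_ge h3
    have hP0 : volume (A \ I) = 0 := hPQ.trans hQ0
    exact (ae_le_set.2 hP0).antisymm (ae_le_set.2 hQ0)

section
variable {m : ℕ} {e : EuclideanSpace ℝ (Fin (m + 1))}
  {L : (Fin m → ℝ) →L[ℝ] EuclideanSpace ℝ (Fin (m + 1))}
  {f : EuclideanSpace ℝ (Fin (m + 1)) → ℝ} {p : ℝ}

theorem measurable_setLIntegral_line (hf : Continuous f)
    {w : EuclideanSpace ℝ (Fin (m + 1)) → ℝ≥0∞} (hw : Measurable w) :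
    Measurable fun q : ℝ × (Fin m → ℝ) =>
      ∫⁻ s in {s : ℝ | q.1 < f (L q.2 + s • e)}, w (L q.2 + s • e) := by
  have hS : MeasurableSet {t : (ℝ × (Fin m → ℝ)) × ℝ | t.1.1 < f (L t.1.2 + t.2 • e)} :=
    measurableSet_lt (by fun_prop) (hf.measurable.comp (by fun_prop))
  have : Measurable ({t : (ℝ × (Fin m → ℝ)) × ℝ | t.1.1 < f (L t.1.2 + t.2 • e)}.indicator
      fun t => w (L t.1.2 + t.2 • e)) :=
    Measurable.indicator (hw.comp (by fun_prop)) hS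
  convert this.lintegral_prod_right' (ν := volume) using 2 with q
  rw [← lintegral_indicator]
  · rfl
  · exact measurableSet_lt measurable_const (hf.measurable.comp (by fun_prop))

theorem IsDensity.lintegral_mul_eq_lines (hf : IsDensity f)
    (hmp : MeasurePreserving (fun q : ℝ × (Fin m → ℝ) => q.1 • e + L q.2))
    {w : EuclideanSpace ℝ (Fin (m + 1)) → ℝ≥0∞} (hw : Measurable w) :
    ∫⁻ x, ENNReal.ofReal (f x) * w x = ∫⁻ q : ℝ × (Fin m → ℝ) in Set.Ioi 0 ×ˢ Set.univ,
      (∫⁻ s in {s : ℝ | q.1 < f (L q.2 + s • e)}, w (L q.2 + s • e)) := by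
  rw [lintegral_ofReal_mul_eq hw hf, Measure.volume_eq_prod, ← Measure.prod_restrict,
    Measure.restrict_univ, lintegral_prod _ (measurable_setLIntegral_line hf.continuous hw).aemeasurable]
  exact lintegral_congr fun r => setLIntegral_eq_lintegral_lines hmp hw
    (measurableSet_lt measurable_const hf.continuous.measurable)

theorem IsDensity.second_moment_steiner (hf : IsDensity f) (he : ‖e‖ = 1) :
    (∫ x, _root_.steiner e f x * ‖x‖ ^ 2) ≤ ∫ x, f x * ‖x‖ ^ 2 ∧
      ((∫ x, f x * ‖x‖ ^ 2) ≤ (∫ x, _root_.steiner e f x * ‖x‖ ^ 2) → _root_.steiner e f = f) := by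
  obtain ⟨L, hL, hmp⟩ := exists_line_coordinates e he
  have hS := hf.steiner he
  have hw : Measurable fun x : EuclideanSpace ℝ (Fin (m + 1)) => ENNReal.ofReal (‖x‖ ^ 2) := by
    fun_prop
  have hconv : ∀ h : EuclideanSpace ℝ (Fin (m + 1)) → ℝ, IsDensity h →
      ENNReal.ofReal (∫ x, h x * ‖x‖ ^ 2) =
        ∫⁻ x, ENNReal.ofReal (h x) * ENNReal.ofReal (‖x‖ ^ 2) := by
    intro h hh
    rw [ofReal_integral_eq_lintegral_ofReal (hh.integrable_mul (by fun_prop))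
      (.of_forall fun x => mul_nonneg (hh.nonneg x) (by positivity))]
    exact lintegral_congr fun x => ENNReal.ofReal_mul (hh.nonneg x)
  have hnorm : ∀ v s, ‖L v + s • e‖ ^ 2 = ‖L v‖ ^ 2 + s ^ 2 := by
    intro v s
    rw [norm_add_sq_real, inner_smul_right, hL, norm_smul, he]
    simp
  have hm2 : ∀ h : EuclideanSpace ℝ (Fin (m + 1)) → ℝ, IsDensity h →
      0 ≤ ∫ x, h x * ‖x‖ ^ 2 := fun h hh =>
    integral_nonneg fun x => mul_nonneg (hh.nonneg x) (by positivity)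
  have hbath : ∀ q ∈ Set.Ioi (0 : ℝ) ×ˢ (Set.univ : Set (Fin m → ℝ)),
      (∫⁻ s in {s : ℝ | q.1 < _root_.steiner e f (L q.2 + s • e)},
        ENNReal.ofReal (‖L q.2 + s • e‖ ^ 2)) ≤
      (∫⁻ s in {s : ℝ | q.1 < f (L q.2 + s • e)}, ENNReal.ofReal (‖L q.2 + s • e‖ ^ 2)) ∧
      ((∫⁻ s in {s : ℝ | q.1 < f (L q.2 + s • e)}, ENNReal.ofReal (‖L q.2 + s • e‖ ^ 2)) ≤
        (∫⁻ s in {s : ℝ | q.1 < _root_.steiner e f (L q.2 + s • e)},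
          ENNReal.ofReal (‖L q.2 + s • e‖ ^ 2)) →
        {s : ℝ | q.1 < f (L q.2 + s • e)} =ᵐ[volume]
          {s : ℝ | q.1 < _root_.steiner e f (L q.2 + s • e)}) := by
    intro q hq
    have hq0 : 0 < q.1 := hq.1
    obtain ⟨l, hl0, hl⟩ := hf.exists_fiberLength_eq he (L q.2) hq0.le
    rw [hf.setOf_lt_steiner he (hL _) hq0.le hl]
    simp only [hnorm]
    exact setLIntegral_Ioo_add_sq_le (measurableSet_lt measurable_const
      (hf.continuous.measurable.comp (by fun_prop))) hl0 hl (by positivity)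
  have hIoi : MeasurableSet (Set.Ioi (0 : ℝ) ×ˢ (Set.univ : Set (Fin m → ℝ))) :=
    measurableSet_Ioi.prod MeasurableSet.univ
  refine ⟨?_, fun hle => ?_⟩
  · rw [← ENNReal.ofReal_le_ofReal_iff (hm2 _ hf), hconv _ hS, hconv _ hf,
      hS.lintegral_mul_eq_lines hmp hw, hf.lintegral_mul_eq_lines hmp hw]
    exact setLIntegral_mono' hIoi fun q hq => (hbath q hq).1
  · have hfin : (∫⁻ x, ENNReal.ofReal (_root_.steiner e f x) * ENNReal.ofReal (‖x‖ ^ 2)) ≠ ⊤ := by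
      rw [← hconv _ hS]
      exact ENNReal.ofReal_ne_top
    rw [← ENNReal.ofReal_le_ofReal_iff (hm2 _ hS), hconv _ hS, hconv _ hf,
      hS.lintegral_mul_eq_lines hmp hw, hf.lintegral_mul_eq_lines hmp hw] at hle
    rw [hS.lintegral_mul_eq_lines hmp hw] at hfin
    have hae := ae_eq_of_ae_le_of_lintegral_le
      (ae_restrict_of_forall_mem hIoi fun q hq => (hbath q hq).1) hfin
      (measurable_setLIntegral_line hf.continuous hw).aemeasurable hle
    have hset : ∀ᵐ q : ℝ × (Fin m → ℝ) ∂(volume.restrict (Set.Ioi 0 ×ˢ Set.univ)),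
        {s : ℝ | q.1 < f (L q.2 + s • e)} =ᵐ[volume]
          {s : ℝ | q.1 < _root_.steiner e f (L q.2 + s • e)} := by
      filter_upwards [hae, ae_restrict_mem hIoi] with q h1 h2
      exact (hbath q h2).2 h1.ge
    have hfS : (fun x => ENNReal.ofReal (f x)) =ᵐ[volume]
        fun x => ENNReal.ofReal (_root_.steiner e f x) := by
      refine ae_eq_of_forall_setLIntegral_eq_of_sigmaFinite
        (ENNReal.measurable_ofReal.comp hf.continuous.measurable)
        (ENNReal.measurable_ofReal.comp hS.continuous.measurable) fun B hB _ => ?_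
      have hind : ∀ h : EuclideanSpace ℝ (Fin (m + 1)) → ℝ,
          ∫⁻ x in B, ENNReal.ofReal (h x) =
            ∫⁻ x, ENNReal.ofReal (h x) * B.indicator (fun _ => 1) x := by
        intro h
        rw [← lintegral_indicator hB]
        refine lintegral_congr fun x => ?_
        by_cases hx : x ∈ B <;> simp [hx]
      have hBm : Measurable (B.indicator fun _ => (1 : ℝ≥0∞)) := measurable_const.indicator hB
      rw [hind, hind, hf.lintegral_mul_eq_lines hmp hBm, hS.lintegral_mul_eq_lines hmp hBm]
      refine lintegral_congr_ae ?_
      filter_upwards [hset] with q hq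
      exact setLIntegral_congr hq
    have hfS' : f =ᵐ[volume] _root_.steiner e f := by
      filter_upwards [hfS] with x hx
      exact (ENNReal.ofReal_eq_ofReal_iff (hf.nonneg x) (hS.nonneg x)).1 hx
    exact ((hf.continuous.ae_eq_iff_eq volume hS.continuous).1 hfS').symm

end

section
variable {n : ℕ}

theorem exists_tendstoUniformly_subseq {F : ℕ → EuclideanSpace ℝ (Fin n) → ℝ} {M R : ℝ}
    (hM : ∀ k x, |F k x| ≤ M) (hR : ∀ k x, R < ‖x‖ → F k x = 0) (hF : UniformEquicontinuous F) :
    ∃ (h : EuclideanSpace ℝ (Fin n) → ℝ) (φ : ℕ → ℕ), StrictMono φ ∧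
      TendstoUniformly (fun k => F (φ k)) h Filter.atTop := by
  let B := Metric.closedBall (0 : EuclideanSpace ℝ (Fin n)) R
  have hB : CompactSpace B := isCompact_iff_compactSpace.1 (isCompact_closedBall 0 R)
  let G : ℕ → BoundedContinuousFunction B ℝ := fun k =>
    BoundedContinuousFunction.mkOfCompact
      ⟨fun x => F k x, (hF.equicontinuous.continuous k).comp continuous_subtype_val⟩
  have hc : IsCompact (closure (Set.range G)) := by
    refine BoundedContinuousFunction.arzela_ascoli (Set.Icc (-M) M) isCompact_Icc _ ?_ ?_
    · rintro _ x ⟨k, rfl⟩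
      exact abs_le.1 (hM k x)
    · have h1 : Equicontinuous fun (k : ℕ) (x : B) => F k x := fun x => by
        intro U hU
        exact continuous_subtype_val.continuousAt.eventually (hF.equicontinuous x U hU)
      intro x U hU
      filter_upwards [h1 x U hU] with y hy
      rintro ⟨_, k, rfl⟩
      exact hy k
  obtain ⟨a, -, φ, hφ, ha⟩ := hc.tendsto_subseq (x := G) fun k => subset_closure ⟨k, rfl⟩
  classical
  refine ⟨fun x => if hx : x ∈ B then a ⟨x, hx⟩ else 0, φ, hφ, ?_⟩
  rw [Metric.tendstoUniformly_iff]
  intro ε hε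
  filter_upwards [(Metric.tendsto_atTop'.1 ha ε hε).choose_spec |> fun h =>
    Filter.eventually_gt_atTop _ |>.mono h] with k hk x
  by_cases hx : x ∈ B
  · rw [dif_pos hx, dist_comm]
    exact (BoundedContinuousFunction.dist_coe_le_dist (f := G (φ k)) (g := a) ⟨x, hx⟩).trans_lt hk
  · rw [dif_neg hx, hR _ _ (by simpa [B] using hx), dist_self]
    exact hε

theorem tendsto_integral_mul_of_bounded {F : ℕ → EuclideanSpace ℝ (Fin n) → ℝ}
    {h w : EuclideanSpace ℝ (Fin n) → ℝ} {M R : ℝ} (hF : ∀ k, Continuous (F k))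
    (hM : ∀ k x, |F k x| ≤ M) (hR : ∀ k x, R < ‖x‖ → F k x = 0)
    (hlim : ∀ x, Filter.Tendsto (fun k => F k x) Filter.atTop (nhds (h x))) (hw : Continuous w) :
    Filter.Tendsto (fun k => ∫ x, F k x * w x) Filter.atTop (nhds (∫ x, h x * w x)) := by
  refine tendsto_integral_of_dominated_convergence
    ((Metric.closedBall 0 R).indicator fun x => M * |w x|) (fun k => ?_) ?_ (fun k => ?_) ?_
  · exact ((hF k).mul hw).aestronglyMeasurable
  · rw [integrable_indicator_iff Metric.isClosed_closedBall.measurableSet]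
    exact (continuous_const.mul hw.abs).continuousOn.integrableOn_compact (isCompact_closedBall 0 R)
  · refine .of_forall fun x => ?_
    by_cases hx : R < ‖x‖
    · rw [hR k x hx, zero_mul, norm_zero, Set.indicator_of_notMem]
      simpa using hx
    · rw [Set.indicator_of_mem (by simpa using hx), norm_mul, norm_eq_abs, norm_eq_abs]
      exact mul_le_mul_of_nonneg_right (hM k x) (abs_nonneg _)
  · exact .of_forall fun x => (hlim x).mul_const _

theorem abs_posMoment_sub_le {p R η : ℝ} (hp : 1 ≤ p) {f g : EuclideanSpace ℝ (Fin n) → ℝ}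
    (hf : IsDensity f) (hg : IsDensity g) (hR0 : 0 ≤ R) (hRf : ∀ x, R < ‖x‖ → f x = 0)
    (hRg : ∀ x, R < ‖x‖ → g x = 0) (hη : 0 ≤ η) (h : ∀ x, |f x - g x| ≤ η)
    (y : EuclideanSpace ℝ (Fin n)) :
    |posMoment p f y - posMoment p g y| ≤
      η * R ^ p * volume.real (Metric.closedBall (0 : EuclideanSpace ℝ (Fin n)) R) * ‖y‖ ^ p := by
  rw [posMoment, posMoment, ← integral_sub (hf.integrable_posMoment hp y)
    (hg.integrable_posMoment hp y), ← norm_eq_abs]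
  have hsupp : ∀ x, x ∉ Metric.closedBall (0 : EuclideanSpace ℝ (Fin n)) R →
      f x * max ⟪x, y⟫ 0 ^ p - g x * max ⟪x, y⟫ 0 ^ p = 0 := by
    intro x hx
    have : R < ‖x‖ := by simpa using hx
    rw [hRf x this, hRg x this, sub_self]
  rw [← setIntegral_eq_integral_of_forall_compl_eq_zero hsupp]
  refine (norm_setIntegral_le_of_norm_le_const (C := η * R ^ p * ‖y‖ ^ p)
    (isCompact_closedBall _ _).measure_lt_top fun x hx => ?_).trans (le_of_eq (by ring))
  have hx : ‖x‖ ≤ R := by simpa using hx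
  rw [← sub_mul, norm_mul, norm_eq_abs, norm_of_nonneg (by positivity), mul_assoc,
    ← mul_rpow hR0 (norm_nonneg _)]
  refine mul_le_mul (h x) ?_ (by positivity) hη
  refine rpow_le_rpow (le_max_right _ _) (max_le ?_ (by positivity)) (by linarith)
  exact (real_inner_le_norm x y).trans (by gcongr)

end

section
variable {m : ℕ} {h : EuclideanSpace ℝ (Fin (m + 1)) → ℝ} {p q : ℝ}

theorem posMoment_eq_of_steiner_eq (hS : ∀ e, ‖e‖ = 1 → steiner e h = h)
    {u v : EuclideanSpace ℝ (Fin (m + 1))} (huv : ‖u‖ = ‖v‖) :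
    posMoment p h u = posMoment p h v := by
  by_cases hne : u = v
  · rw [hne]
  have h0 : ‖u - v‖ ≠ 0 := norm_ne_zero_iff.2 (sub_ne_zero.2 hne)
  set e := ‖u - v‖⁻¹ • (u - v) with he
  have he1 : ‖e‖ = 1 := by rw [he, norm_smul, norm_inv, norm_norm, inv_mul_cancel₀ h0]
  have hspan : (ℝ ∙ e) = ℝ ∙ (u - v) :=
    Submodule.span_singleton_smul_eq (IsUnit.mk0 _ (inv_ne_zero h0)) _
  have hr := Submodule.reflection_sub huv
  rw [← hr, posMoment_comp_isometry]
  intro x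
  have : (ℝ ∙ (u - v))ᗮ.reflection x = x - (2 * ⟪x, e⟫) • e := by
    rw [← reflection_orthogonal_singleton_apply he1]
    congr 3
    exact hspan.symm
  rw [this]
  conv_lhs => rw [← hS e he1]
  rw [steiner_sub_two_smul he1, hS e he1]

theorem IsDensity.exists_posMoment_pos (hp : 1 ≤ p) (hh : IsDensity h) (hne : 0 < ∫ x, h x) :
    ∃ y, 0 < posMoment p h y := by
  obtain ⟨x, hx0, hx⟩ : ∃ x, x ≠ 0 ∧ h x ≠ 0 := by
    by_contra! hc
    refine hne.ne' (integral_eq_zero_of_ae ?_)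
    have : ∀ᵐ x : EuclideanSpace ℝ (Fin (m + 1)), x ≠ 0 := by
      simp [ae_iff]
    filter_upwards [this] with x hx using hc x hx
  refine ⟨x, ?_⟩
  have hc : Continuous fun z => h z * max ⟪z, x⟫ 0 ^ p :=
    hh.continuous.mul ((continuous_max_rpow hp).comp (by fun_prop))
  refine hc.integral_pos_of_hasCompactSupport_nonneg_nonzero hh.hasCompactSupport.mul_right
    (fun z => mul_nonneg (hh.nonneg z) (by positivity)) (x := x) (mul_ne_zero hx ?_)
  have : 0 < ⟪x, x⟫ := real_inner_self_pos.2 hx0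
  rw [max_eq_left this.le]
  positivity

theorem IsDensity.exists_radial (hp : 1 ≤ p) (hq : 0 < q) (hh : IsDensity h)
    (hev : ∀ x, h (-x) = h x) (hne : 0 < ∫ x, h x) :
    ∃ (g : EuclideanSpace ℝ (Fin (m + 1)) → ℝ) (K : ℝ), IsDensity g ∧ ∫ x, g x = ∫ x, h x ∧
      ∫ x, g x ^ q = ∫ x, h x ^ q ∧ 0 < K ∧ (∀ y, posMoment p g y = K * ‖y‖ ^ p) ∧
      polarVolume p h ≤ polarVolume p g := by
  obtain ⟨M, hM0, hM⟩ := hh.exists_bound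
  obtain ⟨R, hR0, hR⟩ := hh.exists_radius
  let C : Set (EuclideanSpace ℝ (Fin (m + 1)) → ℝ) := {g | (∀ x, 0 ≤ g x) ∧ (∀ x, g x ≤ M) ∧
    (∀ x, R < ‖x‖ → g x = 0) ∧ (∀ δ η : ℝ, 0 ≤ η → (∀ x y, ‖x - y‖ ≤ δ → h x ≤ h y + η) →
      ∀ x y, ‖x - y‖ ≤ δ → g x ≤ g y + η)}
  have hCuc : ∀ F : ℕ → EuclideanSpace ℝ (Fin (m + 1)) → ℝ, (∀ k, F k ∈ C) →
      UniformEquicontinuous F := by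
    intro F hF
    rw [Metric.uniformEquicontinuous_iff]
    intro ε hε
    have huc := hh.hasCompactSupport.uniformContinuous_of_continuous hh.continuous
    obtain ⟨δ, hδ, hd⟩ := Metric.uniformContinuous_iff.1 huc (ε / 2) (by positivity)
    have hmod : ∀ x y, ‖x - y‖ ≤ δ / 2 → h x ≤ h y + ε / 2 := by
      intro x y hxy
      have := hd (a := x) (b := y) (by rw [dist_eq_norm]; linarith)
      rw [Real.dist_eq] at this
      linarith [(abs_lt.1 this).2]
    refine ⟨δ / 2, by positivity, fun x y hxy k => ?_⟩
    rw [dist_eq_norm] at hxy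
    have h1 := (hF k).2.2.2 _ _ (by positivity) hmod x y hxy.le
    have h2 := (hF k).2.2.2 _ _ (by positivity) hmod y x (by rw [norm_sub_rev]; exact hxy.le)
    rw [Real.dist_eq, abs_lt]
    constructor <;> linarith
  have hCd : ∀ g ∈ C, IsDensity g := fun g hg =>
    ⟨((hCuc (fun _ => g) fun _ => hg).equicontinuous.continuous 0), hg.1,
      hasCompactSupport_of_eq_zero hg.2.2.1⟩
  have hCS : ∀ g ∈ C, ∀ e, ‖e‖ = 1 → _root_.steiner e g ∈ C := fun g hg e he =>
    ⟨steiner_nonneg, steiner_le hM0 hg.2.1, steiner_eq_zero he hg.2.1 hg.2.2.1 hR0,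
      fun δ η hη hmod => steiner_le_add he (hCd g hg).continuous hg.2.1 hg.2.1 hη
        (hg.2.2.2 δ η hη hmod)⟩
  let G : Set (EuclideanSpace ℝ (Fin (m + 1)) → ℝ) := {g | g ∈ C ∧ (∀ x, g (-x) = g x) ∧
    ∫ x, g x = ∫ x, h x ∧ ∫ x, g x ^ q = ∫ x, h x ^ q ∧ polarVolume p h ≤ polarVolume p g}
  have hGS : ∀ g ∈ G, ∀ e, ‖e‖ = 1 → _root_.steiner e g ∈ G := fun g ⟨hg, h1, h2, h3, h4⟩ e he =>
    ⟨hCS g hg e he, steiner_neg_of_even h1, ((hCd g hg).integral_steiner he).trans h2,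
      ((hCd g hg).integral_rpow_steiner he hq).trans h3,
      h4.trans (polarVolume_le_steiner_of_even hp (hCd g hg) he h1)⟩
  have hhG : h ∈ G := ⟨⟨hh.nonneg, hM, hR, fun _ _ _ hmod => hmod⟩, hev, rfl, rfl, le_rfl⟩
  let μ : (EuclideanSpace ℝ (Fin (m + 1)) → ℝ) → ℝ := fun g => ∫ x, g x * ‖x‖ ^ 2
  have hμ0 : ∀ g ∈ G, 0 ≤ μ g := fun g hg =>
    integral_nonneg fun x => mul_nonneg (hg.1.1 x) (by positivity)
  have hbdd : BddBelow (μ '' G) := ⟨0, by rintro _ ⟨g, hg, rfl⟩; exact hμ0 g hg⟩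
  obtain ⟨a, -, hlim, ha⟩ := exists_seq_tendsto_sInf (⟨_, h, hhG, rfl⟩ : (μ '' G).Nonempty) hbdd
  choose F hFG hFa using ha
  have habs : ∀ g ∈ C, ∀ x, |g x| ≤ M := fun g hg x => by
    rw [abs_of_nonneg (hg.1 x)]; exact hg.2.1 x
  obtain ⟨g, φ, hφ, hunif⟩ := exists_tendstoUniformly_subseq (F := F) (M := M) (R := R)
    (fun k => habs _ (hFG k).1) (fun k => (hFG k).1.2.2.1) (hCuc F fun k => (hFG k).1)
  have hpt : ∀ x, Filter.Tendsto (fun k => F (φ k) x) Filter.atTop (nhds (g x)) :=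
    hunif.tendsto_at
  have hgC : g ∈ C := by
    refine ⟨fun x => ge_of_tendsto' (hpt x) fun k => (hFG _).1.1 x,
      fun x => le_of_tendsto' (hpt x) fun k => (hFG _).1.2.1 x, fun x hx => ?_,
      fun δ η hη hmod x y hxy => ?_⟩
    · refine tendsto_nhds_unique (hpt x) ?_
      simp only [fun k => (hFG (φ k)).1.2.2.1 x hx]
      exact tendsto_const_nhds
    · exact le_of_tendsto_of_tendsto' (hpt x) ((hpt y).add_const η) fun k =>
        (hFG _).1.2.2.2 δ η hη hmod x y hxy
  have hgd := hCd g hgC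
  have hFd : ∀ k, IsDensity (F k) := fun k => hCd _ (hFG k).1
  have h_int : ∀ (H : ℕ → EuclideanSpace ℝ (Fin (m + 1)) → ℝ)
      (g' : EuclideanSpace ℝ (Fin (m + 1)) → ℝ), (∀ k, H k ∈ C) →
      (∀ x, Filter.Tendsto (fun k => H k x) Filter.atTop (nhds (g' x))) →
      ∀ w : EuclideanSpace ℝ (Fin (m + 1)) → ℝ, Continuous w →
      Filter.Tendsto (fun k => ∫ x, H k x * w x) Filter.atTop (nhds (∫ x, g' x * w x)) :=
    fun H g' hH hl w hw => tendsto_integral_mul_of_bounded (fun k => (hCd _ (hH k)).continuous)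
      (fun k => habs _ (hH k)) (fun k => (hH k).2.2.1) hl hw
  have hsmall : ∀ η : ℝ, 0 < η → ∀ᶠ k in Filter.atTop, ∀ x, |F (φ k) x - g x| ≤ η := by
    intro η hη
    filter_upwards [Metric.tendstoUniformly_iff.1 hunif η hη] with k hk x
    have := hk x
    rw [dist_comm, Real.dist_eq] at this
    exact this.le
  have hμg : μ g = sInf (μ '' G) := by
    refine tendsto_nhds_unique (h_int _ _ (fun k => (hFG (φ k)).1) hpt _ (by fun_prop)) ?_
    exact (hlim.comp hφ.tendsto_atTop).congr fun k => (hFa (φ k)).symm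
  have hsteiner : ∀ e, ‖e‖ = 1 → _root_.steiner e g = g := by
    intro e he
    refine (hgd.second_moment_steiner he).2 ?_
    have hl : ∀ x, Filter.Tendsto (fun k => _root_.steiner e (F (φ k)) x) Filter.atTop
        (nhds (_root_.steiner e g x)) := by
      intro x
      rw [Metric.tendsto_nhds]
      intro ε hε
      filter_upwards [hsmall (ε / 2) (by positivity)] with k hk
      rw [Real.dist_eq]
      have := abs_steiner_sub_le he (hFd _).continuous hgd.continuous (hFG (φ k)).1.2.1 hgC.2.1
        (by positivity) hk x
      linarith
    have h1 := h_int _ _ (fun k => hCS _ (hFG (φ k)).1 e he) hl (fun x => ‖x‖ ^ 2) (by fun_prop)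
    change μ g ≤ _
    rw [hμg]
    exact ge_of_tendsto' h1 fun k => csInf_le hbdd ⟨_, hGS _ (hFG _) e he, rfl⟩
  have hg1 : ∫ x, g x = ∫ x, h x := by
    have h1 := h_int _ _ (fun k => (hFG (φ k)).1) hpt (fun _ => 1) continuous_const
    simp only [mul_one, (hFG _).2.2.1] at h1
    exact tendsto_nhds_unique h1 tendsto_const_nhds
  have hgq : ∫ x, g x ^ q = ∫ x, h x ^ q := by
    have h1 := tendsto_integral_mul_of_bounded (F := fun k x => F (φ k) x ^ q)
      (h := fun x => g x ^ q) (w := fun _ => 1) (M := M ^ q) (R := R)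
      (fun k => (hFd _).continuous.rpow_const fun _ => Or.inr hq.le)
      (fun k x => by
        rw [abs_of_nonneg (rpow_nonneg ((hFd _).nonneg x) q)]
        exact rpow_le_rpow ((hFd _).nonneg x) ((hFG _).1.2.1 x) hq.le)
      (fun k x hx => by rw [(hFG _).1.2.2.1 x hx, zero_rpow hq.ne'])
      (fun x => (hpt x).rpow_const (Or.inr hq.le)) continuous_const
    simp only [mul_one, (hFG _).2.2.2.1] at h1
    exact tendsto_nhds_unique tendsto_const_nhds h1 |>.symm
  obtain ⟨y₀, hy₀⟩ := hgd.exists_posMoment_pos hp (hg1 ▸ hne)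
  have hp0 : 0 < p := by linarith
  have hy₀n : 0 < ‖y₀‖ := by
    rw [norm_pos_iff]
    rintro rfl
    simp [posMoment, zero_rpow hp0.ne'] at hy₀
  set K := posMoment p g y₀ / ‖y₀‖ ^ p with hK
  have hK0 : 0 < K := by positivity
  have hrad : ∀ y, posMoment p g y = K * ‖y‖ ^ p := by
    intro y
    rw [posMoment_eq_of_steiner_eq hsteiner (v := (‖y‖ / ‖y₀‖) • y₀)
      (by rw [norm_smul, norm_of_nonneg (by positivity), div_mul_cancel₀ _ hy₀n.ne']),
      posMoment_smul (by positivity), div_rpow (norm_nonneg _) (norm_nonneg _), hK]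
    ring
  refine ⟨g, K, hgd, hg1, hgq, hK0, hrad, ?_⟩
  have hscale : ∀ t : ℝ, 1 < t →
      polarVolume p h ≤ ENNReal.ofReal (t ^ (m + 1)) * polarVolume p g := by
    intro t ht
    have ht0 : 0 < t := by linarith
    set D := R ^ p * volume.real (Metric.closedBall (0 : EuclideanSpace ℝ (Fin (m + 1))) R) with hD
    have hD0 : 0 ≤ D := by positivity
    have htp : 1 < t ^ p := one_lt_rpow ht hp0
    have hgap : 0 < K - K / t ^ p := by
      rw [sub_pos, div_lt_iff₀ (by positivity)]
      nlinarith
    obtain ⟨k, hk⟩ := (hsmall ((K - K / t ^ p) / (D + 1)) (by positivity)).exists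
    have hcmp := abs_posMoment_sub_le hp (hFd (φ k)) hgd hR0 (hFG _).1.2.2.1 hgC.2.2.1
      (by positivity) hk
    have hvol := Measure.addHaar_smul (volume : Measure (EuclideanSpace ℝ (Fin (m + 1)))) t
      {y | posMoment p g y ≤ 1}
    rw [finrank_euclideanSpace_fin, abs_of_pos (by positivity)] at hvol
    refine (hFG (φ k)).2.2.2.2.trans ?_
    rw [polarVolume, polarVolume, ← hvol]
    refine measure_mono fun y hy => ⟨t⁻¹ • y, ?_, by
      simp only [smul_smul, mul_inv_cancel₀ ht0.ne', one_smul]⟩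
    have hy : posMoment p (F (φ k)) y ≤ 1 := hy
    change posMoment p g (t⁻¹ • y) ≤ 1
    rw [posMoment_smul (by positivity), inv_rpow ht0.le]
    have h1 := (abs_le.1 (hcmp y)).1
    rw [hrad] at h1 ⊢
    have h2 : (K - K / t ^ p) / (D + 1) * R ^ p *
        volume.real (Metric.closedBall (0 : EuclideanSpace ℝ (Fin (m + 1))) R) * ‖y‖ ^ p ≤
        (K - K / t ^ p) * ‖y‖ ^ p := by
      refine mul_le_mul_of_nonneg_right ?_ (by positivity)
      rw [mul_assoc, ← hD, div_mul_eq_mul_div, div_le_iff₀ (by positivity)]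
      nlinarith
    have h3 : (t ^ p)⁻¹ * (K * ‖y‖ ^ p) = K / t ^ p * ‖y‖ ^ p := by ring
    rw [h3]
    nlinarith
  have htend : Filter.Tendsto (fun t : ℝ => ENNReal.ofReal (t ^ (m + 1)) * polarVolume p g)
      (nhdsWithin 1 (Set.Ioi 1)) (nhds (ENNReal.ofReal (1 ^ (m + 1)) * polarVolume p g)) := by
    refine ENNReal.Tendsto.mul_const ?_ (Or.inl (by simp))
    exact ((ENNReal.continuous_ofReal.comp (continuous_pow (m + 1))).tendsto 1).mono_left
      nhdsWithin_le_nhds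
  rw [one_pow, ENNReal.ofReal_one, one_mul] at htend
  exact ge_of_tendsto htend (eventually_mem_nhdsWithin.mono hscale)

end

theorem lintegral_Ioo_rpow_mul_one_sub_rpow {a b : ℝ} (ha : 0 < a) (hb : 0 < b) :
    ∫⁻ t in Set.Ioo (0 : ℝ) 1, ENNReal.ofReal (t ^ (a - 1) * (1 - t) ^ (b - 1)) =
      ENNReal.ofReal (ProbabilityTheory.beta a b) := by
  have hB := ProbabilityTheory.beta_pos ha hb
  have h := ProbabilityTheory.lintegral_betaPDF_eq_one ha hb
  rw [ProbabilityTheory.lintegral_betaPDF] at h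
  simp only [mul_assoc] at h
  rw [← mul_one (ENNReal.ofReal _), ← h, ← lintegral_const_mul' _ _ ENNReal.ofReal_ne_top]
  refine setLIntegral_congr_fun measurableSet_Ioo fun t ht => ?_
  rw [← ENNReal.ofReal_mul hB.le, ← mul_assoc, mul_one_div_cancel hB.ne', one_mul]

/-- If the sublevel sets of `u ≥ 0` have volume `r ^ s * V`, the truncations `(1 - u / τ)₊` have
explicit `L^q` norms. -/
theorem lintegral_max_one_sub_div_rpow {α : Type*} [MeasurableSpace α] {μ : Measure α}
    {u : α → ℝ} (hu : Measurable u) (hu0 : ∀ x, 0 ≤ u x) {s q τ : ℝ} (hs : 0 < s) (hq : 0 < q) (hτ : 0 < τ)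
    {V : ℝ≥0∞} (hV : ∀ r, 0 < r → μ {x | u x ≤ r} = ENNReal.ofReal (r ^ s) * V) :
    ∫⁻ x, ENNReal.ofReal (max (1 - u x / τ) 0 ^ q) ∂μ =
      ENNReal.ofReal (τ ^ s * (s * q / (s + q) * ProbabilityTheory.beta s q)) * V := by
  rw [lintegral_rpow_eq_lintegral_meas_le_mul (f := fun x => max (1 - u x / τ) 0) _ (Filter.Eventually.of_forall fun x => le_max_right _ _)
    (by fun_prop) hq, ← Set.Ioo_union_Ici_eq_Ioi (zero_lt_one' ℝ),
    lintegral_union measurableSet_Ici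
      (Set.disjoint_left.2 fun x hx hx' => absurd hx.2 (not_lt.2 hx'))]
  have hset : ∀ t : ℝ, 0 < t → {x | t ≤ max (1 - u x / τ) 0} = {x | u x ≤ τ * (1 - t)} := by
    intro t ht
    ext x
    simp only [Set.mem_ofPred_eq, le_max_iff, ht.not_ge, or_false]
    rw [le_sub_comm, div_le_iff₀' hτ]
  have hzero : ∫⁻ t in Set.Ici (1 : ℝ), μ {x | t ≤ max (1 - u x / τ) 0} *
      ENNReal.ofReal (t ^ (q - 1)) = 0 := by
    rw [setLIntegral_congr Ioi_ae_eq_Ici.symm]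
    refine setLIntegral_eq_zero measurableSet_Ioi fun t ht => ?_
    have ht : 1 < t := ht
    have : {x | u x ≤ τ * (1 - t)} = ∅ :=
      Set.eq_empty_of_forall_notMem fun x hx =>
        absurd (hx.trans_lt (mul_neg_of_pos_of_neg hτ (by linarith))) (hu0 x).not_gt
    rw [hset t (by linarith), this, measure_empty, zero_mul]
    rfl
  rw [hzero, add_zero]
  have hmain : ∀ t ∈ Set.Ioo (0 : ℝ) 1, μ {x | t ≤ max (1 - u x / τ) 0} *
      ENNReal.ofReal (t ^ (q - 1)) =
      ENNReal.ofReal (τ ^ s) * V * ENNReal.ofReal (t ^ (q - 1) * (1 - t) ^ (s + 1 - 1)) := by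
    intro t ht
    have h1 : 0 < 1 - t := by linarith [ht.2]
    rw [hset t ht.1, hV _ (by positivity), mul_rpow hτ.le h1.le, ENNReal.ofReal_mul (by positivity),
      ENNReal.ofReal_mul (rpow_nonneg ht.1.le _), add_sub_cancel_right]
    ring
  rw [setLIntegral_congr_fun measurableSet_Ioo hmain, lintegral_const_mul _ (by fun_prop),
    lintegral_Ioo_rpow_mul_one_sub_rpow hq (by linarith)]
  have hB : q * ProbabilityTheory.beta q (s + 1) =
      s * q / (s + q) * ProbabilityTheory.beta s q := by
    unfold ProbabilityTheory.beta
    rw [Gamma_add_one hs.ne', ← add_assoc, Gamma_add_one (by positivity), add_comm q s]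
    have := Gamma_pos_of_pos (add_pos hs hq)
    field_simp
  rw [← hB, ENNReal.ofReal_mul (by positivity), ENNReal.ofReal_mul hq.le]
  ring

theorem volume_sublevel_eq {n : ℕ} {u : EuclideanSpace ℝ (Fin n) → ℝ} {p : ℝ}
    (hp : 0 < p) (hom : ∀ c : ℝ, 0 ≤ c → ∀ y, u (c • y) = c ^ p * u y) {r : ℝ} (hr : 0 < r) :
    volume {y | u y ≤ r} = ENNReal.ofReal (r ^ ((n : ℝ) / p)) * volume {y | u y ≤ 1} := by
  have ht : 0 < r ^ (1 / p) := by positivity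
  have hset : {y | u y ≤ r} = r ^ (1 / p) • {y | u y ≤ 1} := by
    ext y
    rw [Set.mem_smul_set_iff_inv_smul_mem₀ ht.ne', Set.mem_ofPred_eq, Set.mem_ofPred_eq,
      hom _ (by positivity), inv_rpow ht.le, ← rpow_mul hr.le, one_div_mul_cancel hp.ne', rpow_one,
      inv_mul_le_iff₀ hr, mul_one]
  rw [hset, Measure.addHaar_smul, finrank_euclideanSpace_fin, abs_of_pos (by positivity),
    ← rpow_natCast, ← rpow_mul hr.le]
  congr 3
  ring

theorem IsDensity.sub_div_le_mul_rpow {n : ℕ} (hn : n ≠ 0) {u g : EuclideanSpace ℝ (Fin n) → ℝ}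
    {p lam q : ℝ} (hp : 0 < p) (hlq : lam.HolderConjugate q) (hu : Continuous u)
    (hu0 : ∀ x, 0 ≤ u x) (hom : ∀ c : ℝ, 0 ≤ c → ∀ y, u (c • y) = c ^ p * u y)
    (hV : volume {y | u y ≤ 1} ≠ ∞) (hg : IsDensity g) {τ : ℝ} (hτ : 0 < τ) :
    (∫ x, g x) - (∫ x, g x * u x) / τ ≤ (∫ x, g x ^ lam) ^ (1 / lam) *
      (τ ^ ((n : ℝ) / p) * ((n : ℝ) / p * q / ((n : ℝ) / p + q) *
        ProbabilityTheory.beta ((n : ℝ) / p) q) * volume.real {y | u y ≤ 1}) ^ (1 / q) := by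
  have hs : 0 < (n : ℝ) / p := by positivity
  have hq := hlq.symm.pos
  have hlam := hlq.pos
  set w : EuclideanSpace ℝ (Fin n) → ℝ := fun x => max (1 - u x / τ) 0 with hw
  have hwc : Continuous w := by fun_prop
  have hw0 : ∀ x, 0 ≤ w x := fun x => le_max_right _ _
  have hL := lintegral_max_one_sub_div_rpow hu.measurable hu0 hs hq hτ
    (fun r hr => volume_sublevel_eq hp hom hr)
  have hBpos := ProbabilityTheory.beta_pos hs hq
  have hwq : ∫ x, w x ^ q = τ ^ ((n : ℝ) / p) * ((n : ℝ) / p * q / ((n : ℝ) / p + q) *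
        ProbabilityTheory.beta ((n : ℝ) / p) q) * volume.real {y | u y ≤ 1} := by
    rw [integral_eq_lintegral_of_nonneg_ae
      (Filter.Eventually.of_forall fun x => rpow_nonneg (hw0 x) q)
      (hwc.rpow_const fun _ => Or.inr hq.le).aestronglyMeasurable, hL, ENNReal.toReal_mul,
      ENNReal.toReal_ofReal (by positivity)]
    rfl
  have hwmem : MemLp w (ENNReal.ofReal q) := by
    refine ⟨hwc.aestronglyMeasurable, ?_⟩
    rw [eLpNorm_lt_top_iff_lintegral_rpow_enorm_lt_top (by simpa using hq) (by simp),
      ENNReal.toReal_ofReal hq.le]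
    have : ∀ x, ‖w x‖ₑ ^ q = ENNReal.ofReal (w x ^ q) := fun x => by
      rw [Real.enorm_of_nonneg (hw0 x), ENNReal.ofReal_rpow_of_nonneg (hw0 x) hq.le]
    simp only [this]
    rw [hL]
    exact ENNReal.mul_lt_top ENNReal.ofReal_lt_top hV.lt_top
  have hgmem : MemLp g (ENNReal.ofReal lam) :=
    hg.continuous.memLp_of_hasCompactSupport hg.hasCompactSupport
  have hH := integral_mul_le_Lp_mul_Lq_of_nonneg hlq (Filter.Eventually.of_forall hg.nonneg)
    (Filter.Eventually.of_forall hw0) hgmem hwmem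
  rw [hwq] at hH
  refine le_trans ?_ hH
  rw [← integral_div, ← integral_sub hg.integrable ((hg.integrable_mul hu).div_const τ)]
  refine integral_mono (hg.integrable.sub ((hg.integrable_mul hu).div_const τ))
    (hg.integrable_mul hwc) fun x => ?_
  have := mul_le_mul_of_nonneg_left (le_max_left (1 - u x / τ) 0) (hg.nonneg x)
  simp only [hw]
  linarith [mul_div_assoc (g x) (u x) τ]

/-- Optimising `N - M / τ ≤ L (τ ^ s C V) ^ (1 / q)` over `τ > 0`. -/
theorem rpow_add_le_of_forall_sub_div_le {s q B N M L V : ℝ} (hs : 0 < s) (hq : 0 < q) (hB : 0 < B)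
    (hN : 0 < N) (hL : 0 ≤ L) (hV : 0 ≤ V) (hM : 0 ≤ M)
    (h : ∀ τ, 0 < τ → N - M / τ ≤ L * (τ ^ s * (s * q / (s + q) * B) * V) ^ (1 / q)) :
    N ^ (s + q) ≤ s * (s / q + 1) ^ (q - 1) * (q / s + 1) ^ s * B * L ^ q * M ^ s * V := by
  have hpos : ∀ M', M < M' →
      N ^ (s + q) ≤ s * (s / q + 1) ^ (q - 1) * (q / s + 1) ^ s * B * L ^ q * M' ^ s * V := by
    intro M' hM'
    have hM0 : 0 < M' := hM.trans_lt hM'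
    have hk : 0 < s + q := by positivity
    set τ := M' * (s + q) / (s * N) with hτ
    have hτ0 : 0 < τ := by positivity
    have h1 : q * N / (s + q) ≤ L * (τ ^ s * (s * q / (s + q) * B) * V) ^ (1 / q) := by
      refine le_trans ?_ (h τ hτ0)
      have h2 : M / τ ≤ M' / τ := by gcongr
      have h3 : M' / τ = s * N / (s + q) := by rw [hτ]; field_simp
      have h4 : q * N / (s + q) = N - s * N / (s + q) := by field_simp; ring
      linarith
    have h5 := rpow_le_rpow (by positivity) h1 hq.le
    rw [mul_rpow hL (by positivity), ← rpow_mul (by positivity), one_div_mul_cancel hq.ne',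
      rpow_one] at h5
    have h6 : s / q + 1 = (s + q) / q := by field_simp
    have h7 : q / s + 1 = (s + q) / s := by field_simp; ring
    calc N ^ (s + q) = N ^ s * ((s + q) / q) ^ q * (q * N / (s + q)) ^ q := by
          rw [mul_assoc, ← mul_rpow (by positivity) (by positivity), rpow_add hN]
          congr 2
          field_simp
      _ ≤ N ^ s * ((s + q) / q) ^ q * (L ^ q * (τ ^ s * (s * q / (s + q) * B) * V)) := by gcongr
      _ = _ := by
          rw [h6, h7, rpow_sub_one (by positivity), hτ,
            div_rpow (x := M' * (s + q)) (by positivity) (by positivity),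
            mul_rpow hM0.le hk.le, mul_rpow hs.le hN.le, div_rpow hk.le hs.le]
          have : 0 < N ^ s := by positivity
          have : 0 < s ^ s := by positivity
          field_simp
  have hcont : Continuous fun M' : ℝ =>
      s * (s / q + 1) ^ (q - 1) * (q / s + 1) ^ s * B * L ^ q * M' ^ s * V :=
    ((continuous_id.rpow_const fun _ => Or.inr hs.le).const_mul _).mul_const _
  exact ge_of_tendsto (hcont.continuousWithinAt (s := Set.Ioi M) (x := M))
    (Filter.eventually_of_mem self_mem_nhdsWithin fun M' hM' => hpos M' hM')

theorem anpl_eq (n : ℕ) (p lam : ℝ) :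
    anpl n p lam = (((n : ℝ) / p) * ((n : ℝ) / p / (lam / (lam - 1)) + 1) ^ (lam / (lam - 1) - 1) *
      ((lam / (lam - 1)) / ((n : ℝ) / p) + 1) ^ ((n : ℝ) / p) *
      ProbabilityTheory.beta ((n : ℝ) / p) (lam / (lam - 1))) ^ p := by
  rw [anpl, ProbabilityTheory.beta, div_div, mul_comm p, div_div_eq_mul_div]

theorem IsDensity.rpow_integral_le {n : ℕ} (hn : n ≠ 0) {u g : EuclideanSpace ℝ (Fin n) → ℝ}
    {p lam : ℝ} (hp : 0 < p) (hlam : 1 < lam) (hu : Continuous u)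
    (hu0 : ∀ x, 0 ≤ u x) (hom : ∀ c : ℝ, 0 ≤ c → ∀ y, u (c • y) = c ^ p * u y)
    (hV : volume {y | u y ≤ 1} ≠ ∞) (hg : IsDensity g) (hg0 : 0 < ∫ x, g x) :
    (∫ x, g x) ^ ((n : ℝ) + (lam / (lam - 1)) * p) ≤
      anpl n p lam * ((∫ x, g x ^ lam) ^ (1 / lam)) ^ ((lam / (lam - 1)) * p) *
        (∫ x, g x * u x) ^ (n : ℝ) * volume.real {y | u y ≤ 1} ^ p := by
  have hlq : lam.HolderConjugate (lam / (lam - 1)) := Real.HolderConjugate.conjExponent hlam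
  have hs : 0 < (n : ℝ) / p := by positivity
  have hq := hlq.symm.pos
  have hB := ProbabilityTheory.beta_pos hs hq
  have hL : 0 ≤ (∫ x, g x ^ lam) ^ (1 / lam) :=
    rpow_nonneg (integral_nonneg fun x => rpow_nonneg (hg.nonneg x) _) _
  have hM : 0 ≤ ∫ x, g x * u x := integral_nonneg fun x => mul_nonneg (hg.nonneg x) (hu0 x)
  have h := rpow_add_le_of_forall_sub_div_le hs hq hB hg0 hL measureReal_nonneg hM
    fun τ hτ => hg.sub_div_le_mul_rpow hn hp hlq hu hu0 hom hV hτ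
  have h := rpow_le_rpow (by positivity) h hp.le
  rw [← rpow_mul hg0.le, add_mul, div_mul_cancel₀ _ hp.ne'] at h
  refine h.trans_eq ?_
  rw [anpl_eq, mul_rpow (by positivity) measureReal_nonneg, mul_rpow (by positivity) (by positivity),
    mul_rpow (by positivity) (by positivity), ← rpow_mul hL, ← rpow_mul hM, div_mul_cancel₀ _ hp.ne']

theorem integral_Ioi_rpow_mul_exp_neg_sq {a : ℝ} (ha : -1 < a) :
    ∫ t in Set.Ioi (0 : ℝ), t ^ a * exp (-t ^ 2) = Gamma ((a + 1) / 2) / 2 := by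
  have h := integral_rpow_mul_exp_neg_rpow (p := 2) two_pos ha
  simp only [rpow_two] at h
  rw [h]
  ring

theorem integral_norm_rpow_mul_exp_neg_sq {m : ℕ} {p : ℝ} (hp : 0 < p) :
    ∫ y : EuclideanSpace ℝ (Fin (m + 1)), ‖y‖ ^ p * exp (-‖y‖ ^ 2) =
      ((m + 1 : ℕ) : ℝ) * volume.real (Metric.ball (0 : EuclideanSpace ℝ (Fin (m + 1))) 1) *
        (Gamma (((m + 1 : ℕ) + p) / 2) / 2) := by
  rw [integral_fun_norm_addHaar volume (fun t => t ^ p * exp (-t ^ 2)), finrank_euclideanSpace_fin,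
    nsmul_eq_mul, smul_eq_mul, mul_assoc]
  congr 2
  rw [show ((m + 1 : ℕ) + p) / 2 = ((m + p) + 1) / 2 by push_cast; ring,
    ← integral_Ioi_rpow_mul_exp_neg_sq (by linarith [m.cast_nonneg (α := ℝ)] : -1 < (m : ℝ) + p)]
  refine setIntegral_congr_fun measurableSet_Ioi fun t ht => ?_
  have ht : 0 < t := ht
  simp only [Nat.add_sub_cancel, smul_eq_mul]
  rw [rpow_add ht, rpow_natCast]
  ring

theorem integral_max_rpow_mul_exp_neg_sq {p : ℝ} (hp : 0 < p) :
    ∫ t : ℝ, max t 0 ^ p * exp (-t ^ 2) = Gamma ((p + 1) / 2) / 2 := by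
  rw [← integral_Ioi_rpow_mul_exp_neg_sq (by linarith), ← integral_indicator measurableSet_Ioi]
  congr 1 with t
  rw [Set.indicator_apply]
  split_ifs with h
  · rw [max_eq_left (le_of_lt h)]
  · rw [max_eq_right (not_lt.1 h), zero_rpow hp.ne', zero_mul]

theorem integral_max_coord_rpow_mul_exp_neg_sq {m : ℕ} {p : ℝ} (hp : 0 < p) :
    ∫ y : EuclideanSpace ℝ (Fin (m + 1)), max (y 0) 0 ^ p * exp (-‖y‖ ^ 2) =
      Gamma ((p + 1) / 2) / 2 * √π ^ m := by
  have h := integral_fintype_prod_volume_eq_prod (𝕜 := ℝ) (ι := Fin (m + 1)) (E := fun _ => ℝ)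
    (fun i t => (if i = 0 then max t 0 ^ p else 1) * exp (-t ^ 2))
  rw [Fin.prod_univ_succ] at h
  have hg : ∫ t : ℝ, exp (-t ^ 2) = √π := by simpa using integral_gaussian 1
  simp only [if_true, Fin.succ_ne_zero, if_false, one_mul, Finset.prod_const, Finset.card_univ,
    Fintype.card_fin, hg, integral_max_rpow_mul_exp_neg_sq hp] at h
  rw [← h, ← (EuclideanSpace.volume_preserving_symm_measurableEquiv_toLp (Fin (m + 1))).integral_comp'
    (fun x : Fin (m + 1) → ℝ => ∏ i, (if i = 0 then max (x i) 0 ^ p else 1) * exp (-x i ^ 2))]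
  congr 1 with y
  rw [Finset.prod_mul_distrib, ← exp_sum, Finset.sum_neg_distrib, EuclideanSpace.norm_sq_eq,
    Finset.prod_ite_eq']
  simp

theorem lintegral_max_coord_rpow_mul_exp_neg_sq {m : ℕ} {p : ℝ} (hp : 0 < p) :
    ∫⁻ y : EuclideanSpace ℝ (Fin (m + 1)), ENNReal.ofReal (max (y 0) 0 ^ p * exp (-‖y‖ ^ 2)) =
      ENNReal.ofReal (Gamma ((p + 1) / 2) / 2 * √π ^ m) := by
  have hΓ := Gamma_pos_of_pos (show 0 < (p + 1) / 2 by positivity)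
  have h := integral_max_coord_rpow_mul_exp_neg_sq (m := m) hp
  rw [← h, ofReal_integral_eq_lintegral_ofReal
    (Integrable.of_integral_ne_zero (h.trans_ne (by positivity)))
    (.of_forall fun y => by positivity)]

theorem lintegral_norm_rpow_mul_exp_neg_sq {m : ℕ} {p : ℝ} (hp : 0 < p) :
    ∫⁻ y : EuclideanSpace ℝ (Fin (m + 1)), ENNReal.ofReal (‖y‖ ^ p * exp (-‖y‖ ^ 2)) =
      ENNReal.ofReal (((m + 1 : ℕ) : ℝ) *
        volume.real (Metric.ball (0 : EuclideanSpace ℝ (Fin (m + 1))) 1) *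
        (Gamma (((m + 1 : ℕ) + p) / 2) / 2)) := by
  have hΓ := Gamma_pos_of_pos (show 0 < ((m + 1 : ℕ) + p) / 2 by positivity)
  have hω : 0 < volume.real (Metric.ball (0 : EuclideanSpace ℝ (Fin (m + 1))) 1) :=
    ENNReal.toReal_pos (Metric.measure_ball_pos _ _ one_pos).ne' measure_ball_lt_top.ne
  have h := integral_norm_rpow_mul_exp_neg_sq (m := m) hp
  rw [← h, ofReal_integral_eq_lintegral_ofReal
    (Integrable.of_integral_ne_zero (h.trans_ne (by positivity)))
    (.of_forall fun y => by positivity)]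

theorem lintegral_max_inner_rpow_mul_exp_neg_sq {m : ℕ} {p : ℝ} (hp : 0 < p)
    (x : EuclideanSpace ℝ (Fin (m + 1))) :
    ∫⁻ y : EuclideanSpace ℝ (Fin (m + 1)), ENNReal.ofReal (max ⟪x, y⟫ 0 ^ p * exp (-‖y‖ ^ 2)) =
      ENNReal.ofReal (‖x‖ ^ p * (Gamma ((p + 1) / 2) / 2 * √π ^ m)) := by
  set v : EuclideanSpace ℝ (Fin (m + 1)) := EuclideanSpace.single 0 ‖x‖ with hv
  have hρ := Submodule.reflection_sub (v := x) (w := v) (by simp [hv])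
  set ρ := (ℝ ∙ (x - v))ᗮ.reflection
  rw [ENNReal.ofReal_mul (by positivity), ← lintegral_max_coord_rpow_mul_exp_neg_sq hp,
    ← lintegral_const_mul' _ _ ENNReal.ofReal_ne_top,
    ← ρ.measurePreserving.lintegral_comp (f := fun y => ENNReal.ofReal
      (max ⟪x, y⟫ 0 ^ p * exp (-‖y‖ ^ 2))) (by fun_prop)]
  refine lintegral_congr fun y => ?_
  rw [← ENNReal.ofReal_mul (by positivity), ← mul_assoc, ρ.norm_map,
    ← mul_rpow (norm_nonneg x) (le_max_right _ _), mul_max_of_nonneg _ _ (norm_nonneg x), mul_zero]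
  have : ⟪x, ρ y⟫ = ‖x‖ * y 0 := by
    rw [← ρ.inner_map_map x, Submodule.reflection_reflection, hρ, hv,
      EuclideanSpace.inner_single_left]
    simp
  rw [this]

/-- Integrating `⟪x, y⟫₊ ^ p` against `g x` and a Gaussian in `y` computes the ratio between a
rotation invariant moment function and the `p`-th absolute moment. -/
theorem IsDensity.posMoment_const_eq {m : ℕ} {p K : ℝ} (hp : 1 ≤ p) (hK : 0 < K)
    {g : EuclideanSpace ℝ (Fin (m + 1)) → ℝ} (hg : IsDensity g)
    (h : ∀ y, posMoment p g y = K * ‖y‖ ^ p) :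
    K * (((m + 1 : ℕ) : ℝ) * volume.real (Metric.ball (0 : EuclideanSpace ℝ (Fin (m + 1))) 1) *
        (Gamma (((m + 1 : ℕ) + p) / 2) / 2)) =
      (∫ x, g x * ‖x‖ ^ p) * (Gamma ((p + 1) / 2) / 2 * √π ^ m) := by
  have hp0 : 0 < p := by linarith
  have hΓ := Gamma_pos_of_pos (show 0 < (p + 1) / 2 by positivity)
  have hΓ' := Gamma_pos_of_pos (show 0 < ((m + 1 : ℕ) + p) / 2 by positivity)
  have hM0 : 0 ≤ ∫ x, g x * ‖x‖ ^ p :=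
    integral_nonneg fun x => mul_nonneg (hg.nonneg x) (by positivity)
  have hcp : Continuous fun x : EuclideanSpace ℝ (Fin (m + 1)) => ‖x‖ ^ p :=
    continuous_norm.rpow_const fun _ => Or.inr hp0.le
  have hgm := hg.continuous.measurable
  rw [← ENNReal.ofReal_eq_ofReal_iff (by positivity) (by positivity), ENNReal.ofReal_mul hK.le,
    ENNReal.ofReal_mul hM0, ← lintegral_norm_rpow_mul_exp_neg_sq hp0,
    ← lintegral_const_mul' _ _ ENNReal.ofReal_ne_top,
    ofReal_integral_eq_lintegral_ofReal (hg.integrable_mul hcp)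
      (.of_forall fun x => mul_nonneg (hg.nonneg x) (by positivity)),
    ← lintegral_mul_const _ (by fun_prop)]
  have h1 : ∀ y, ENNReal.ofReal K * ENNReal.ofReal (‖y‖ ^ p * exp (-‖y‖ ^ 2)) =
      ∫⁻ x, ENNReal.ofReal (g x) * ENNReal.ofReal (max ⟪x, y⟫ 0 ^ p * exp (-‖y‖ ^ 2)) := by
    intro y
    rw [← ENNReal.ofReal_mul hK.le, ← mul_assoc, ← h, ENNReal.ofReal_mul
      (posMoment_nonneg hg.nonneg y), ofReal_posMoment hp hg, ← lintegral_mul_const _ (by fun_prop)]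
    refine lintegral_congr fun x => ?_
    rw [mul_assoc, ENNReal.ofReal_mul (by positivity)]
  have h2 : ∀ x, ENNReal.ofReal (g x * ‖x‖ ^ p) *
      ENNReal.ofReal (Gamma ((p + 1) / 2) / 2 * √π ^ m) =
      ∫⁻ y, ENNReal.ofReal (g x) * ENNReal.ofReal (max ⟪x, y⟫ 0 ^ p * exp (-‖y‖ ^ 2)) := by
    intro x
    rw [lintegral_const_mul' _ _ ENNReal.ofReal_ne_top, lintegral_max_inner_rpow_mul_exp_neg_sq hp0,
      ENNReal.ofReal_mul (hg.nonneg x), ENNReal.ofReal_mul (p := ‖x‖ ^ p) (by positivity),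
      mul_assoc]
  simp only [h1, h2]
  exact lintegral_lintegral_swap (by fun_prop)

theorem volume_real_ball_zero_one (n : ℕ) (hn : n ≠ 0) :
    volume.real (Metric.ball (0 : EuclideanSpace ℝ (Fin n)) 1) =
      √π ^ n / Gamma ((n : ℝ) / 2 + 1) := by
  have : Nonempty (Fin n) := ⟨⟨0, Nat.pos_of_ne_zero hn⟩⟩
  have hΓ := Gamma_pos_of_pos (show 0 < (n : ℝ) / 2 + 1 by positivity)
  rw [measureReal_def, EuclideanSpace.volume_ball, ENNReal.ofReal_one, one_pow, one_mul,
    Fintype.card_fin, ENNReal.toReal_ofReal (by positivity)]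

theorem dnpl_eq {m : ℕ} {p : ℝ} (hp : 0 < p) (lam : ℝ) :
    dnpl (m + 1) p lam = anpl (m + 1) p lam ^ 2 *
      (volume.real (Metric.ball (0 : EuclideanSpace ℝ (Fin (m + 1))) 1) ^ p) ^ 2 *
      ((((m + 1 : ℕ) : ℝ) * volume.real (Metric.ball (0 : EuclideanSpace ℝ (Fin (m + 1))) 1) *
        (Gamma (((m + 1 : ℕ) + p) / 2) / 2)) / (Gamma ((p + 1) / 2) / 2 * √π ^ m)) ^
          ((m + 1 : ℕ) : ℝ) := by
  have hΓ := Gamma_pos_of_pos (show 0 < (p + 1) / 2 by positivity)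
  have hΓ' := Gamma_pos_of_pos (show 0 < ((m + 1 : ℕ) + p) / 2 by positivity)
  have hΓ'' := Gamma_pos_of_pos (show 0 < ((m + 1 : ℕ) : ℝ) / 2 + 1 by positivity)
  rw [dnpl, bnpl, Rnp, volume_real_ball_zero_one (m + 1) m.succ_ne_zero]
  set n := m + 1 with hn
  have hn0 : (0 : ℝ) < n := by positivity
  rw [show ((n : ℝ) + 2) / 2 = n / 2 + 1 by ring,
    show ((n : ℝ) + p + 2) / 2 = (n + p) / 2 + 1 by ring,
    Gamma_add_one (s := (n + p) / 2) (by positivity)]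
  set A := Gamma ((n : ℝ) / 2 + 1)
  set B := Gamma ((p + 1) / 2)
  set C := Gamma (((n : ℝ) + p) / 2)
  have hbase : (n * (√π ^ n / A) * (C / 2)) / (B / 2 * √π ^ m) =
      √π * (n / (n + p) * (2 * ((n + p) / 2 * C) / (A * B))) := by
    rw [hn, pow_succ]
    field_simp
  have hR : (π ^ ((n : ℝ) / (2 * p) + n) / A ^ 2 *
      (2 * ((n + p) / 2 * C) / (A * B)) ^ ((n : ℝ) / p)) ^ p =
      ((√π ^ n / A) ^ p) ^ 2 * √π ^ (n : ℝ) * (2 * ((n + p) / 2 * C) / (A * B)) ^ (n : ℝ) := by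
    rw [mul_rpow (by positivity) (by positivity), ← rpow_mul (by positivity),
      div_mul_cancel₀ _ hp.ne']
    congr 1
    rw [div_rpow (by positivity) (by positivity), div_rpow (by positivity) (by positivity), div_pow,
      ← rpow_natCast A 2, ← rpow_natCast _ 2, ← rpow_natCast _ 2, ← rpow_mul hΓ''.le,
      ← rpow_mul hΓ''.le, ← rpow_natCast √π n, ← rpow_mul (by positivity), ← rpow_mul (by positivity),
      ← rpow_mul (by positivity), sqrt_eq_rpow, ← rpow_mul pi_pos.le, ← rpow_mul pi_pos.le,
      div_mul_eq_mul_div, ← rpow_add pi_pos, mul_comm _ p]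
    congr 2
    · push_cast
      field_simp
      ring
    · ring
  rw [hbase, hR, mul_rpow (by positivity) (by positivity), mul_rpow (by positivity) (by positivity),
    rpow_neg hn0.le]
  have : 0 < (n : ℝ) ^ p := by positivity
  field_simp

theorem IsDensity.integral_pos {n : ℕ} {g : EuclideanSpace ℝ (Fin n) → ℝ} (hg : IsDensity g)
    (hne : g ≠ 0) : 0 < ∫ x, g x :=
  have ⟨_, hx⟩ := Function.ne_iff.1 hne
  hg.continuous.integral_pos_of_hasCompactSupport_nonneg_nonzero hg.hasCompactSupport hg.nonneg hx

theorem setOf_norm_rpow_le_one {n : ℕ} {p : ℝ} (hp : 0 < p) :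
    {y : EuclideanSpace ℝ (Fin n) | ‖y‖ ^ p ≤ 1} = Metric.closedBall 0 1 := by
  ext y
  rw [mem_closedBall_zero_iff, Set.mem_ofPred_eq]
  simpa using rpow_le_rpow_iff (norm_nonneg y) zero_le_one hp

theorem volume_norm_rpow_le_one {m : ℕ} {p : ℝ} (hp : 0 < p) :
    volume {y : EuclideanSpace ℝ (Fin (m + 1)) | ‖y‖ ^ p ≤ 1} =
      volume (Metric.ball (0 : EuclideanSpace ℝ (Fin (m + 1))) 1) := by
  rw [setOf_norm_rpow_le_one hp, Measure.addHaar_closedBall_eq_addHaar_ball]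

theorem norm_smul_rpow {n : ℕ} {p c : ℝ} (hc : 0 ≤ c) (y : EuclideanSpace ℝ (Fin n)) :
    ‖c • y‖ ^ p = c ^ p * ‖y‖ ^ p := by
  rw [norm_smul, norm_of_nonneg hc, mul_rpow hc (norm_nonneg y)]

/-- The inequality for the one-sided kernel `⟪x, y⟫₊ ^ p`. -/
theorem IsDensity.exists_forall_rpow_integral_mul_le {m : ℕ} {p lam : ℝ} (hp : 1 ≤ p)
    (hlam : 1 < lam) {f : EuclideanSpace ℝ (Fin (m + 1)) → ℝ} (hf : IsDensity f)
    (hf0 : 0 < ∫ x, f x) :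
    ∃ c, ∀ g : EuclideanSpace ℝ (Fin (m + 1)) → ℝ, IsDensity g → 0 < ∫ x, g x →
      (∫ x, f x) ^ (((m + 1 : ℕ) : ℝ) + (lam / (lam - 1)) * p) *
          (∫ x, g x) ^ (((m + 1 : ℕ) : ℝ) + (lam / (lam - 1)) * p) ≤
        dnpl (m + 1) p lam *
          ((∫ x, f x ^ lam) ^ (1 / lam)) ^ ((lam / (lam - 1)) * p) *
          ((∫ x, g x ^ lam) ^ (1 / lam)) ^ ((lam / (lam - 1)) * p) *
          (∫ y, g y * posMoment p (fun x => f (x - c)) y) ^ ((m + 1 : ℕ) : ℝ) := by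
  have hp0 : 0 < p := by linarith
  obtain ⟨h, hh, hev, hh1, hhl, c, hc⟩ := exists_even_polarVolume_le hp hf (q := lam) (by linarith)
  obtain ⟨k, K, hk, hk1, hkl, hK, hkK, hkV⟩ :=
    hh.exists_radial hp (q := lam) (by linarith) hev (hh1 ▸ hf0)
  rw [hh1] at hk1
  rw [hhl] at hkl
  refine ⟨c, fun g hg hg0 => ?_⟩
  set ω := volume.real (Metric.ball (0 : EuclideanSpace ℝ (Fin (m + 1))) 1) with hω
  have hω0 : 0 ≤ ω := measureReal_nonneg
  have hcont : Continuous fun x : EuclideanSpace ℝ (Fin (m + 1)) => ‖x‖ ^ p :=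
    continuous_norm.rpow_const fun _ => Or.inr hp0.le
  have hVK : polarVolume p k = ENNReal.ofReal ((1 / K) ^ (((m + 1 : ℕ) : ℝ) / p)) *
      volume (Metric.ball (0 : EuclideanSpace ℝ (Fin (m + 1))) 1) := by
    rw [← volume_norm_rpow_le_one hp0, ← volume_sublevel_eq hp0 (fun c hc y => norm_smul_rpow hc y)
      (by positivity), polarVolume]
    simp only [hkK, le_div_iff₀' hK]
  have hfc : IsDensity fun x => f (x - c) := hf.comp_sub c
  have hV := hc.trans (hkV.trans_eq hVK)
  have htop : ENNReal.ofReal ((1 / K) ^ (((m + 1 : ℕ) : ℝ) / p)) *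
      volume (Metric.ball (0 : EuclideanSpace ℝ (Fin (m + 1))) 1) ≠ ∞ :=
    ENNReal.mul_ne_top ENNReal.ofReal_ne_top measure_ball_lt_top.ne
  have hVr : volume.real {y | posMoment p (fun x => f (x - c)) y ≤ 1} ^ p ≤
      (1 / K) ^ ((m + 1 : ℕ) : ℝ) * ω ^ p := by
    have h1 := ENNReal.toReal_mono htop hV
    rw [ENNReal.toReal_mul, ENNReal.toReal_ofReal (by positivity)] at h1
    have h2 := rpow_le_rpow ENNReal.toReal_nonneg h1 hp0.le
    rwa [mul_rpow (by positivity) ENNReal.toReal_nonneg, ← rpow_mul (by positivity),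
      div_mul_cancel₀ _ hp0.ne'] at h2
  have hg1 := hg.rpow_integral_le m.succ_ne_zero hp0 hlam (continuous_posMoment hp hfc)
    (fun y => posMoment_nonneg hfc.nonneg y) (fun c hc y => posMoment_smul hc y)
    (ne_top_of_le_ne_top htop hV) hg0
  have hk2 := hk.rpow_integral_le m.succ_ne_zero hp0 hlam hcont (fun y => by positivity)
    (fun c hc y => norm_smul_rpow hc y)
    (by rw [volume_norm_rpow_le_one hp0]; exact measure_ball_lt_top.ne) (hk1 ▸ hf0)
  rw [measureReal_def, volume_norm_rpow_le_one hp0, ← measureReal_def, ← hω, hk1, hkl] at hk2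
  have hKM := hk.posMoment_const_eq hp hK hkK
  rw [← hω] at hKM
  have hΓ := Gamma_pos_of_pos (show 0 < (p + 1) / 2 by positivity)
  have hM0 : 0 ≤ ∫ x, k x * ‖x‖ ^ p :=
    integral_nonneg fun x => mul_nonneg (hk.nonneg x) (by positivity)
  have hI0 : 0 ≤ ∫ y, g y * posMoment p (fun x => f (x - c)) y :=
    integral_nonneg fun y => mul_nonneg (hg.nonneg y) (posMoment_nonneg hfc.nonneg y)
  have hf2 : 0 ≤ (∫ x, f x ^ lam) ^ (1 / lam) :=
    rpow_nonneg (integral_nonneg fun x => rpow_nonneg (hf.nonneg x) _) _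
  have hg2 : 0 ≤ (∫ x, g x ^ lam) ^ (1 / lam) :=
    rpow_nonneg (integral_nonneg fun x => rpow_nonneg (hg.nonneg x) _) _
  have ha : 0 ≤ anpl (m + 1) p lam := by
    have hq : 0 < lam / (lam - 1) := div_pos (by linarith) (by linarith)
    have := ProbabilityTheory.beta_pos (show 0 < ((m + 1 : ℕ) : ℝ) / p by positivity) hq
    rw [anpl_eq]
    positivity
  rw [dnpl_eq hp0, ← hω]
  set G₁ := ((m + 1 : ℕ) : ℝ) * ω * (Gamma (((m + 1 : ℕ) + p) / 2) / 2)
  set G₂ := Gamma ((p + 1) / 2) / 2 * √π ^ m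
  have hG₂ : 0 < G₂ := by positivity
  have hratio : G₁ / G₂ = (∫ x, k x * ‖x‖ ^ p) * (1 / K) := by
    rw [div_eq_iff hG₂.ne', mul_one_div, div_mul_eq_mul_div, eq_div_iff hK.ne', ← hKM, mul_comm]
  rw [hratio, mul_rpow hM0 (by positivity)]
  refine (mul_le_mul hk2 (hg1.trans (mul_le_mul_of_nonneg_left hVr (by positivity)))
    (by positivity) (by positivity)).trans_eq ?_
  ring

theorem IsDensity.comp_neg {n : ℕ} {g : EuclideanSpace ℝ (Fin n) → ℝ} (hg : IsDensity g) :
    IsDensity fun x => g (-x) :=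
  ⟨hg.continuous.comp continuous_neg, fun x => hg.nonneg (-x),
    hg.hasCompactSupport.comp_homeomorph (Homeomorph.neg _)⟩

theorem IsDensity.integral_mul_epsPow {n : ℕ} {p : ℝ} (hp : 1 ≤ p) (eps : ℝ)
    {f g : EuclideanSpace ℝ (Fin n) → ℝ} (hf : IsDensity f) (hg : IsDensity g) :
    ∫ y, ∫ x, f x * g y * epsPow eps p ⟪x, y⟫ =
      (1 - eps) * (∫ y, g y * posMoment p f y) + eps * ∫ y, g (-y) * posMoment p f y := by
  have hinner : ∀ y, ∫ x, f x * g y * epsPow eps p ⟪x, y⟫ =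
      (1 - eps) * (g y * posMoment p f y) + eps * (g y * posMoment p f (-y)) := by
    intro y
    have h1 := (hf.integrable_posMoment hp y).const_mul ((1 - eps) * g y)
    have h2 := (hf.integrable_posMoment hp (-y)).const_mul (eps * g y)
    rw [← mul_assoc, ← mul_assoc, posMoment, posMoment, ← integral_const_mul, ← integral_const_mul,
      ← integral_add h1 h2]
    congr 1 with x
    rw [epsPow, inner_neg_right]
    ring
  have hc := continuous_posMoment hp hf
  have h1 := (hg.integrable_mul hc).const_mul (1 - eps)
  have h2 := (hg.integrable_mul (hc.comp continuous_neg)).const_mul eps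
  simp only [Function.comp_def] at h2
  simp only [hinner]
  rw [integral_add h1 h2, integral_const_mul, integral_const_mul,
    ← integral_neg_eq_self fun y => g y * posMoment p f (-y)]
  simp only [neg_neg]

/-- Asymmetric functional version of the Lutwak–Yang–Zhang moment–entropy inequality,
case `λ ∈ (1, ∞)`, `ε ∈ [0, 1/2]`. -/
theorem functional_Renyi_asymmetric (n : ℕ) (hn : 2 ≤ n) (p : ℝ) (hp : 1 ≤ p)
    (lam : ℝ) (hlam : 1 < lam) (eps : ℝ) (heps0 : 0 ≤ eps) (heps1 : eps ≤ 1 / 2)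
    (f : EuclideanSpace ℝ (Fin n) → ℝ) (hf_cont : Continuous f)
    (hf_nonneg : ∀ x, 0 ≤ f x) (hf_supp : HasCompactSupport f) (hf_ne : f ≠ 0) :
    ∃ c : EuclideanSpace ℝ (Fin n),
      ∀ g : EuclideanSpace ℝ (Fin n) → ℝ, Continuous g → (∀ x, 0 ≤ g x) →
        HasCompactSupport g → g ≠ 0 →
        (∫ x, f x) ^ ((n : ℝ) + (lam / (lam - 1)) * p) *
            (∫ x, g x) ^ ((n : ℝ) + (lam / (lam - 1)) * p) ≤
          dnpl n p lam *
            ((∫ x, |f x| ^ lam) ^ (1 / lam)) ^ ((lam / (lam - 1)) * p) *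
            ((∫ x, |g x| ^ lam) ^ (1 / lam)) ^ ((lam / (lam - 1)) * p) *
            (∫ y, ∫ x, f (x - c) * g y * epsPow eps p ⟪x, y⟫) ^ (n : ℝ) := by
  obtain ⟨m, rfl⟩ : ∃ m, n = m + 1 := ⟨n - 1, by omega⟩
  have hp0 : 0 < p := by linarith
  have hf : IsDensity f := ⟨hf_cont, hf_nonneg, hf_supp⟩
  obtain ⟨c, hc⟩ := hf.exists_forall_rpow_integral_mul_le hp hlam (hf.integral_pos hf_ne)
  refine ⟨c, fun g hg_cont hg_nonneg hg_supp hg_ne => ?_⟩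
  have hg : IsDensity g := ⟨hg_cont, hg_nonneg, hg_supp⟩
  have hg0 := hg.integral_pos hg_ne
  have h1 := hc g hg hg0
  have h2 := hc _ hg.comp_neg (by rwa [integral_neg_eq_self g])
  rw [integral_neg_eq_self g, integral_neg_eq_self fun x => g x ^ lam] at h2
  simp only [abs_of_nonneg (hf_nonneg _), abs_of_nonneg (hg_nonneg _)]
  rw [(hf.comp_sub c).integral_mul_epsPow hp eps hg]
  have hm := posMoment_nonneg (p := p) (hf.comp_sub c).nonneg
  have hJ₁ : 0 ≤ ∫ y, g y * posMoment p (fun x => f (x - c)) y :=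
    integral_nonneg fun y => mul_nonneg (hg_nonneg y) (hm y)
  have hJ₂ : 0 ≤ ∫ y, g (-y) * posMoment p (fun x => f (x - c)) y :=
    integral_nonneg fun y => mul_nonneg (hg_nonneg _) (hm y)
  have hd : 0 ≤ dnpl (m + 1) p lam *
      ((∫ x, f x ^ lam) ^ (1 / lam)) ^ ((lam / (lam - 1)) * p) *
      ((∫ x, g x ^ lam) ^ (1 / lam)) ^ ((lam / (lam - 1)) * p) := by
    have hΓ := Gamma_pos_of_pos (show 0 < (p + 1) / 2 by positivity)
    have hΓ' := Gamma_pos_of_pos (show 0 < ((m + 1 : ℕ) + p) / 2 by positivity)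
    have hfl : 0 ≤ ∫ x, f x ^ lam := integral_nonneg fun x => rpow_nonneg (hf_nonneg x) _
    have hgl : 0 ≤ ∫ x, g x ^ lam := integral_nonneg fun x => rpow_nonneg (hg_nonneg x) _
    rw [dnpl_eq hp0]
    positivity
  rcases le_total (∫ y, g y * posMoment p (fun x => f (x - c)) y)
    (∫ y, g (-y) * posMoment p (fun x => f (x - c)) y) with hle | hle
  · refine h1.trans (mul_le_mul_of_nonneg_left (rpow_le_rpow hJ₁ ?_ (by positivity)) hd)
    nlinarith
  · refine h2.trans (mul_le_mul_of_nonneg_left (rpow_le_rpow hJ₂ ?_ (by positivity)) hd)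
    nlinarith
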